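/- arXiv:2501.11316 — 2 statements merged into one kernel-verified Lean document; each statement's English description precedes it below -/
import Mathlib

section
/- Let p be prime and k a positive integer with q = p^k, and assume no nonprincipal Dirichlet character modulo q has a real zero β with β ≥ 1 − c0/log q (nonexistence of the exceptional zero). Then, in the regime k = o(p/(log p)^4), Σ_{χ mod q, χ(−1)=−1} (f_χ · |L(1,χ)|^2)^{−1} = (ζ(2)/(2ζ(4))) · ((p−1)^2/(p^2+1)) · k · (1 + o(1)). -/
open Complex DirichletCharacter

namespace NegMoment

open Finset Filter Topology

lemma sum_period {q : ℕ} [NeZero q] (f : ZMod q → ℂ) (a : ℕ) :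
    ∑ n ∈ Finset.Ico a (a + q), f (n : ZMod q) = ∑ x : ZMod q, f x := by
  induction a with
  | zero =>
    rw [zero_add, ← Finset.range_eq_Ico]
    refine Finset.sum_nbij' (fun n => (n : ZMod q)) (fun x => x.val) ?_ ?_ ?_ ?_ ?_
    · intro n _; simp
    · intro x _; simpa using ZMod.val_lt x
    · intro n hn; simpa using ZMod.val_cast_of_lt (by simpa using hn)
    · intro x _; simp
    · intro n _; rfl
  | succ a ih =>
    have hq : 0 < q := Nat.pos_of_ne_zero (NeZero.ne q)
    rw [← ih, Finset.sum_eq_sum_Ico_succ_bot (by omega : a < a + q),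
      show a + 1 + q = (a + q) + 1 by ring, Finset.sum_Ico_succ_top (by omega)]
    push_cast
    simp [add_comm]

lemma norm_sum_Ico_le {q : ℕ} [NeZero q] (χ : DirichletCharacter ℂ q) (hχ : χ ≠ 1) (K M : ℕ) :
    ‖∑ n ∈ Finset.Ico K M, χ (n : ZMod q)‖ ≤ q := by
  induction M using Nat.strong_induction_on with
  | _ M ih =>
    have hq : 0 < q := Nat.pos_of_ne_zero (NeZero.ne q)
    by_cases h : M ≤ K + q
    · calc ‖∑ n ∈ Finset.Ico K M, χ (n : ZMod q)‖
          ≤ ∑ n ∈ Finset.Ico K M, ‖χ (n : ZMod q)‖ := norm_sum_le _ _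
        _ ≤ ∑ n ∈ Finset.Ico K M, 1 := Finset.sum_le_sum fun n _ => χ.norm_le_one _
        _ = ((M - K : ℕ) : ℝ) := by simp
        _ ≤ q := by exact_mod_cast (by omega)
    · have h1 := ih (M - q) (by omega)
      have h2 := sum_period (fun x => χ x) (M - q)
      rw [MulChar.sum_eq_zero_of_ne_one hχ, show M - q + q = M by omega] at h2
      rw [← Finset.sum_Ico_consecutive _ (by omega : K ≤ M - q) (by omega : M - q ≤ M), h2, add_zero]
      exact h1

lemma abel_bound {z : ℕ → ℂ} {B : ℝ} {K : ℕ} (hz : ∀ M, ‖∑ n ∈ Finset.Ico K M, z n‖ ≤ B)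
    {g : ℕ → ℝ} (hg0 : ∀ n, K ≤ n → 0 ≤ g n) (hg : ∀ n, K ≤ n → g (n + 1) ≤ g n) (M : ℕ) :
    ‖∑ n ∈ Finset.Ico K M, z n * (g n : ℂ)‖ ≤ B * g K := by
  have hB : 0 ≤ B := (norm_nonneg _).trans (hz K)
  rcases Nat.lt_or_ge K M with h | h
  swap
  · rw [Finset.Ico_eq_empty (by omega)]; simpa using mul_nonneg hB (hg0 K le_rfl)
  obtain ⟨m, rfl⟩ : ∃ m, M = K + (m + 1) := ⟨M - K - 1, by omega⟩
  have hG : ∀ i, ‖∑ j ∈ Finset.range i, z (K + j)‖ ≤ B := by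
    intro i
    have := hz (K + i)
    rwa [Finset.sum_Ico_eq_sum_range, Nat.add_sub_cancel_left] at this
  rw [Finset.sum_Ico_eq_sum_range, Nat.add_sub_cancel_left]
  have key := Finset.sum_range_by_parts (fun i => g (K + i)) (fun i => z (K + i)) (m + 1)
  simp only [Complex.real_smul, Nat.add_sub_cancel] at key
  have e : ∑ k ∈ Finset.range (m + 1), z (K + k) * (g (K + k) : ℂ)
      = ∑ k ∈ Finset.range (m + 1), (g (K + k) : ℂ) * z (K + k) :=
    Finset.sum_congr rfl fun _ _ => mul_comm _ _
  rw [e, key]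
  refine (norm_sub_le _ _).trans ?_
  have h1 : ‖(g (K + m) : ℂ) * ∑ i ∈ Finset.range (m + 1), z (K + i)‖ ≤ g (K + m) * B := by
    rw [norm_mul, Complex.norm_real, Real.norm_of_nonneg (hg0 _ (by omega))]
    exact mul_le_mul_of_nonneg_left (hG _) (hg0 _ (by omega))
  have h2 : ‖∑ i ∈ Finset.range m, ((g (K + (i + 1)) - g (K + i) : ℝ) : ℂ) *
      ∑ i ∈ Finset.range (i + 1), z (K + i)‖ ≤ ∑ i ∈ Finset.range m, (g (K + i) - g (K + (i + 1))) * B := by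
    refine (norm_sum_le _ _).trans (Finset.sum_le_sum fun i _ => ?_)
    have := hg (K + i) (by omega)
    rw [norm_mul, Complex.norm_real, Real.norm_eq_abs, abs_sub_comm,
      abs_of_nonneg (by rw [← add_assoc]; linarith)]
    exact mul_le_mul_of_nonneg_left (hG _) (by rw [← add_assoc]; linarith)
  rw [← Finset.sum_mul, Finset.sum_range_sub'] at h2
  simp only [add_zero] at h2
  linarith

/-- Generic tail bound. -/
lemma tail_bound {q : ℕ} [NeZero q] (χ : DirichletCharacter ℂ q) (hχ : χ ≠ 1) {K : ℕ}
    {g : ℕ → ℝ} (hg0 : ∀ n, K ≤ n → 0 ≤ g n) (hg : ∀ n, K ≤ n → g (n + 1) ≤ g n) {l : ℂ}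
    (hl : Tendsto (fun M : ℕ => ∑ n ∈ Finset.range (M * q), χ (n : ZMod q) * (g n : ℂ)) atTop (𝓝 l)) :
    ‖l - ∑ n ∈ Finset.range K, χ (n : ZMod q) * (g n : ℂ)‖ ≤ q * g K := by
  have hq : 0 < q := Nat.pos_of_ne_zero (NeZero.ne q)
  refine le_of_tendsto (hl.sub_const _).norm ?_
  filter_upwards [eventually_ge_atTop K] with M hM
  have hK : K ≤ M * q := hM.trans (Nat.le_mul_of_pos_right M hq)
  rw [← Finset.sum_range_add_sum_Ico _ hK, add_sub_cancel_left]
  exact abel_bound (norm_sum_Ico_le χ hχ K) hg0 hg _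

lemma cpow_diff_bound {s : ℂ} (hs : 0 < s.re) {a b : ℝ} (ha : 0 < a) (hab : a ≤ b) :
    ‖(b : ℂ) ^ (-s) - (a : ℂ) ^ (-s)‖ ≤ ‖s‖ * a ^ (-s.re - 1) * (b - a) := by
  have hs0 : -s ≠ 0 := by
    intro h; rw [neg_eq_zero] at h; rw [h] at hs; simp at hs
  have := Convex.norm_image_sub_le_of_norm_hasDerivWithin_le (𝕜 := ℝ) (s := Set.Icc a b)
    (f := fun t : ℝ => (t : ℂ) ^ (-s)) (f' := fun t : ℝ => -s * (t : ℂ) ^ (-s - 1))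
    (C := ‖s‖ * a ^ (-s.re - 1)) (x := a) (y := b) ?_ ?_ (convex_Icc a b)
    ⟨le_rfl, hab⟩ ⟨hab, le_rfl⟩
  · rwa [Real.norm_of_nonneg (sub_nonneg.2 hab)] at this
  · intro t ht
    have ht0 : 0 < t := lt_of_lt_of_le ha ht.1
    exact (hasDerivAt_ofReal_cpow_const ht0.ne' hs0).hasDerivWithinAt
  · intro t ht
    have ht0 : 0 < t := lt_of_lt_of_le ha ht.1
    rw [norm_mul, norm_neg, Complex.norm_cpow_eq_rpow_re_of_pos ht0]
    refine mul_le_mul_of_nonneg_left ?_ (norm_nonneg _)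
    simp only [sub_re, neg_re, one_re]
    exact Real.rpow_le_rpow_of_nonpos ha ht.1 (by linarith)

/-- Block sums. -/
noncomputable def block {q : ℕ} (χ : DirichletCharacter ℂ q) (m : ℕ) (s : ℂ) : ℂ :=
  ∑ n ∈ Finset.Ico (m * q) (m * q + q), χ (n : ZMod q) * (n : ℂ) ^ (-s)

lemma block_bound {q : ℕ} [NeZero q] (χ : DirichletCharacter ℂ q) (hχ : χ ≠ 1) (m : ℕ) (hm : 1 ≤ m)
    {s : ℂ} (hs : 1 / 4 < s.re) (hs' : ‖s‖ ≤ 4) :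
    ‖block χ m s‖ ≤ 4 * q * q * ((m : ℝ)) ^ (-(5 / 4 : ℝ)) := by
  have hq : 0 < q := Nat.pos_of_ne_zero (NeZero.ne q)
  have hmq : 1 ≤ m * q := Nat.mul_pos hm hq
  have h0 : ∑ n ∈ Finset.Ico (m * q) (m * q + q), χ (n : ZMod q) = 0 := by
    rw [sum_period (fun x => χ x), MulChar.sum_eq_zero_of_ne_one hχ]
  have h1 : block χ m s = ∑ n ∈ Finset.Ico (m * q) (m * q + q),
      χ (n : ZMod q) * ((n : ℂ) ^ (-s) - ((m * q : ℕ) : ℂ) ^ (-s)) := by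
    simp only [mul_sub, Finset.sum_sub_distrib, ← Finset.sum_mul, h0, zero_mul, sub_zero]
    rfl
  have hmq' : (1 : ℝ) ≤ ((m * q : ℕ) : ℝ) := by exact_mod_cast hmq
  have hm' : (1 : ℝ) ≤ (m : ℝ) := by exact_mod_cast hm
  have hmle : (m : ℝ) ≤ ((m * q : ℕ) : ℝ) := by exact_mod_cast Nat.le_mul_of_pos_right m hq
  rw [h1]
  calc _ ≤ ∑ n ∈ Finset.Ico (m * q) (m * q + q), 4 * (m : ℝ) ^ (-(5 / 4 : ℝ)) * q := by
        refine norm_sum_le_of_le _ fun n hn => ?_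
        rw [Finset.mem_Ico] at hn
        rw [norm_mul]
        have hn1 : ((m * q : ℕ) : ℝ) ≤ n := by exact_mod_cast hn.1
        have hn2 : (n : ℝ) ≤ ((m * q : ℕ) : ℝ) + q := by exact_mod_cast hn.2.le
        have := cpow_diff_bound (s := s) (by linarith) (a := ((m * q : ℕ) : ℝ)) (b := n)
          (by linarith) hn1
        rw [Complex.ofReal_natCast, Complex.ofReal_natCast] at this
        have hp : ((m * q : ℕ) : ℝ) ^ (-s.re - 1) ≤ (m : ℝ) ^ (-(5 / 4 : ℝ)) :=
          calc ((m * q : ℕ) : ℝ) ^ (-s.re - 1) ≤ (m : ℝ) ^ (-s.re - 1) :=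
                Real.rpow_le_rpow_of_nonpos (by linarith) hmle (by linarith)
            _ ≤ _ := Real.rpow_le_rpow_of_exponent_le hm' (by linarith)
        calc _ ≤ 1 * (‖s‖ * ((m * q : ℕ) : ℝ) ^ (-s.re - 1) * (n - ((m * q : ℕ) : ℝ))) :=
              mul_le_mul (χ.norm_le_one _) this (norm_nonneg _) zero_le_one
          _ ≤ 1 * (4 * (m : ℝ) ^ (-(5 / 4 : ℝ)) * q) := by
              gcongr
              linarith
          _ = _ := one_mul _
    _ = _ := by rw [Finset.sum_const, Nat.card_Ico, Nat.add_sub_cancel_left, nsmul_eq_mul]; ring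

lemma sum_block {q : ℕ} (χ : DirichletCharacter ℂ q) (M : ℕ) (s : ℂ) :
    ∑ m ∈ Finset.range M, block χ m s = ∑ n ∈ Finset.range (M * q), χ (n : ZMod q) * (n : ℂ) ^ (-s) := by
  induction M with
  | zero => simp
  | succ M ih =>
    rw [Finset.sum_range_succ, ih, block, Nat.succ_mul, Finset.range_eq_Ico, Finset.range_eq_Ico,
      Finset.sum_Ico_consecutive _ (Nat.zero_le _) (by omega)]

lemma chi_zero {q : ℕ} (χ : DirichletCharacter ℂ q) (hχ : χ ≠ 1) : χ (0 : ZMod q) = 0 := by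
  have hq : q ≠ 1 := by
    rintro rfl; exact hχ (level_one χ)
  exact map_zero' χ hq

lemma differentiable_term {q : ℕ} (χ : DirichletCharacter ℂ q) (hχ : χ ≠ 1) (n : ℕ) :
    Differentiable ℂ (fun s : ℂ => χ (n : ZMod q) * (n : ℂ) ^ (-s)) := by
  rcases eq_or_ne n 0 with rfl | hn
  · simp [chi_zero χ hχ]
  · intro s
    have : (n : ℂ) ≠ 0 := by exact_mod_cast hn
    exact ((differentiableAt_id.neg.const_cpow (Or.inl this))).const_mul _

lemma tendsto_LFunction_complex {q : ℕ} [NeZero q] (χ : DirichletCharacter ℂ q) (hχ : χ ≠ 1) {s : ℂ}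
    (hs : s ∈ Metric.ball (2 : ℂ) (7 / 4)) :
    Tendsto (fun M : ℕ => ∑ n ∈ Finset.range (M * q), χ (n : ZMod q) * (n : ℂ) ^ (-s)) atTop
      (𝓝 (χ.LFunction s)) := by
  set U := Metric.ball (2 : ℂ) (7 / 4) with hU
  have hUb : ∀ s ∈ U, 1 / 4 < s.re ∧ ‖s‖ ≤ 4 := by
    intro s hs
    rw [hU, mem_ball_iff_norm] at hs
    constructor
    · have := (abs_re_le_norm (s - 2)).trans hs.le
      have h2 := (abs_lt.1 ((abs_re_le_norm (s - 2)).trans_lt hs)).1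
      simp at h2
      linarith
    · calc ‖s‖ = ‖(s - 2) + 2‖ := by simp
        _ ≤ ‖s - 2‖ + ‖(2 : ℂ)‖ := norm_add_le _ _
        _ ≤ 7 / 4 + 2 := by gcongr; simp
        _ ≤ 4 := by norm_num
  have hu : Summable (fun m : ℕ => 4 * (q : ℝ) * q * (((m + 1 : ℕ) : ℝ)) ^ (-(5 / 4 : ℝ))) := by
    refine Summable.mul_left _ ?_
    exact (summable_nat_add_iff 1).2 (Real.summable_nat_rpow.2 (by norm_num))
  have hbd : ∀ (m : ℕ) (w : ℂ), w ∈ U → ‖block χ (m + 1) w‖ ≤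
      4 * (q : ℝ) * q * (((m + 1 : ℕ) : ℝ)) ^ (-(5 / 4 : ℝ)) := fun m w hw =>
    block_bound χ hχ (m + 1) (by omega) (hUb w hw).1 (hUb w hw).2
  have hdb : ∀ m, Differentiable ℂ (block χ m) := by
    intro m
    unfold block
    exact Differentiable.fun_sum fun n _ => differentiable_term χ hχ n
  have hG : DifferentiableOn ℂ (fun w => block χ 0 w + ∑' m, block χ (m + 1) w) U :=
    (hdb 0).differentiableOn.add
      (differentiableOn_tsum_of_summable_norm hu (fun m => (hdb (m + 1)).differentiableOn)
        Metric.isOpen_ball hbd)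
  have htend : ∀ w ∈ U, Tendsto (fun M : ℕ => ∑ n ∈ Finset.range (M * q), χ (n : ZMod q) * (n : ℂ) ^ (-w))
      atTop (𝓝 (block χ 0 w + ∑' m, block χ (m + 1) w)) := by
    intro w hw
    have h1 : Summable (fun m => block χ (m + 1) w) :=
      Summable.of_norm_bounded hu (fun m => hbd m w hw)
    have h2 : Summable (fun m => block χ m w) := (summable_nat_add_iff 1).1 h1
    have h3 := h2.hasSum.tendsto_sum_nat
    rw [h2.tsum_eq_zero_add] at h3
    simpa only [sum_block] using h3
  have heq : Set.EqOn (fun w => block χ 0 w + ∑' m, block χ (m + 1) w) (χ.LFunction) U := by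
    refine AnalyticOnNhd.eqOn_of_preconnected_of_eventuallyEq (𝕜 := ℂ) (z₀ := 2)
      (hG.analyticOnNhd Metric.isOpen_ball)
      ((differentiable_LFunction hχ).differentiableOn.analyticOnNhd Metric.isOpen_ball)
      (convex_ball _ _).isPreconnected (Metric.mem_ball_self (by norm_num)) ?_
    filter_upwards [Metric.ball_mem_nhds (2 : ℂ) (by norm_num : (0 : ℝ) < 1)] with w hw
    have hwU : w ∈ U := Metric.ball_subset_ball (by norm_num) hw
    have hw1 : 1 < w.re := by
      rw [mem_ball_iff_norm] at hw
      have h2 := (abs_lt.1 ((abs_re_le_norm (w - 2)).trans_lt hw)).1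
      simp at h2
      linarith
    refine tendsto_nhds_unique (htend w hwU) ?_
    rw [LFunction_eq_LSeries χ hw1]
    have h4 := (LSeriesSummable_of_one_lt_re χ hw1).hasSum.tendsto_sum_nat
    have hq : 0 < q := Nat.pos_of_ne_zero (NeZero.ne q)
    have h5 := h4.comp (tendsto_id.atTop_mul_const' hq)
    refine h5.congr fun M => ?_
    simp only [Function.comp, id]
    refine Finset.sum_congr rfl fun n _ => ?_
    rw [LSeries.term_def]
    split_ifs with h
    · subst h
      simp [chi_zero χ hχ]
    · rw [cpow_neg, div_eq_mul_inv]
  rw [← heq hs]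
  exact htend s hs

lemma tendsto_LFunction {q : ℕ} [NeZero q] (χ : DirichletCharacter ℂ q) (hχ : χ ≠ 1) {σ : ℝ}
    (h1 : 1 / 2 ≤ σ) (h2 : σ ≤ 2) :
    Tendsto (fun M : ℕ => ∑ n ∈ Finset.range (M * q), χ (n : ZMod q) * (((n : ℝ) ^ (-σ) : ℝ) : ℂ)) atTop
      (𝓝 (χ.LFunction σ)) := by
  have h := tendsto_LFunction_complex χ hχ (s := (σ : ℂ)) ?_
  · refine h.congr fun M => Finset.sum_congr rfl fun n _ => ?_
    rw [Complex.ofReal_cpow (Nat.cast_nonneg n)]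
    simp
  · rw [mem_ball_iff_norm, show (σ : ℂ) - 2 = ((σ - 2 : ℝ) : ℂ) by push_cast; ring,
      Complex.norm_real, Real.norm_eq_abs, abs_lt]
    constructor <;> linarith

lemma LFunction_approx {q : ℕ} [NeZero q] (χ : DirichletCharacter ℂ q) (hχ : χ ≠ 1) {σ : ℝ}
    (h1 : 1 / 2 ≤ σ) (h2 : σ ≤ 2) {K : ℕ} (hK : 1 ≤ K) :
    ‖χ.LFunction σ - ∑ n ∈ Finset.range K, χ (n : ZMod q) * (((n : ℝ) ^ (-σ) : ℝ) : ℂ)‖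
      ≤ q * (K : ℝ) ^ (-σ) := by
  refine tail_bound χ hχ (g := fun n => (n : ℝ) ^ (-σ)) (fun n _ => by positivity) (fun n hn => ?_)
    (tendsto_LFunction χ hχ h1 h2)
  have : (0 : ℝ) < n := by exact_mod_cast (by omega)
  exact Real.rpow_le_rpow_of_nonpos this (by push_cast; linarith) (by linarith)

end NegMoment

namespace NegMoment

open Finset Filter Topology

/-- The quantity `1 + log q`. -/
noncomputable def ell (q : ℕ) : ℝ := 1 + Real.log q

lemma one_le_ell (q : ℕ) : 1 ≤ ell q := by
  have := Real.log_natCast_nonneg q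
  unfold ell; linarith

lemma harm_bound (K : ℕ) : ∑ n ∈ Finset.range (K + 1), ((n : ℝ))⁻¹ ≤ ell K := by
  have h := harmonic_le_one_add_log K
  rw [harmonic] at h
  push_cast at h
  rw [Finset.sum_range_succ']
  simpa [ell] using h

lemma harm_bound' (K : ℕ) : ∑ n ∈ Finset.range K, ((n : ℝ))⁻¹ ≤ ell K := by
  refine le_trans ?_ (harm_bound K)
  rw [Finset.sum_range_succ]
  have : (0 : ℝ) ≤ ((K : ℝ))⁻¹ := by positivity
  linarith

lemma sum_rpow_le {x : ℝ} (hx : 0 < x) (hx1 : x ≤ 1) (M : ℕ) :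
    ∑ n ∈ Finset.range M, (n : ℝ) ^ (-(1 + x)) ≤ 2 / x := by
  have h2x : 1 + 1 / x ≤ 2 / x := by
    have : 1 ≤ 1 / x := by rw [le_div_iff₀ hx]; linarith
    have e : 2 / x = 1 / x + 1 / x := by ring
    linarith
  have hmono : ∑ n ∈ Finset.range M, (n : ℝ) ^ (-(1 + x)) ≤
      ∑ n ∈ Finset.range (M + 1 + 1), (n : ℝ) ^ (-(1 + x)) := by
    refine Finset.sum_le_sum_of_subset_of_nonneg (by intro n; simp; omega) fun n _ _ => by positivity
  refine hmono.trans (le_trans ?_ h2x)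
  rw [Finset.sum_range_succ', Finset.sum_range_succ']
  have h := AntitoneOn.sum_le_integral (f := fun t : ℝ => t ^ (-(1 + x))) (x₀ := 1) (a := M) ?_
  · have hi : ∫ t in (1 : ℝ)..(1 + M), t ^ (-(1 + x)) = ((1 + M : ℝ) ^ (-(1 + x) + 1) - 1 ^ (-(1 + x) + 1)) / (-(1 + x) + 1) := by
      apply integral_rpow
      right
      refine ⟨by linarith, ?_⟩
      rw [Set.uIcc_of_le (by linarith [Nat.cast_nonneg (α := ℝ) M])]
      rintro ⟨h, _⟩; linarith
    rw [hi] at h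
    have h3 : ((1 + M : ℝ) ^ (-(1 + x) + 1) - 1 ^ (-(1 + x) + 1)) / (-(1 + x) + 1) ≤ 1 / x := by
      rw [show -(1 + x) + 1 = -x by ring, Real.one_rpow, div_neg, ← neg_div]
      gcongr
      have : (0 : ℝ) ≤ (1 + M : ℝ) ^ (-x) := by positivity
      linarith
    have h4 : ∑ i ∈ Finset.range M, ((i + 1 + 1 : ℕ) : ℝ) ^ (-(1 + x)) =
      ∑ i ∈ Finset.range M, (1 + ((i + 1 : ℕ) : ℝ)) ^ (-(1 + x)) := by
      refine Finset.sum_congr rfl fun i _ => ?_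
      push_cast; congr 1; ring
    rw [h4]
    have h5 : ((0 : ℕ) : ℝ) ^ (-(1 + x)) = 0 := by
      rw [Nat.cast_zero, Real.zero_rpow (by linarith)]
    have h6 : ((0 + 1 : ℕ) : ℝ) ^ (-(1 + x)) = 1 := by simp
    rw [h5, h6]
    linarith
  · intro a ha b _ hab
    exact Real.rpow_le_rpow_of_nonpos (by linarith [ha.1]) hab (by linarith)

lemma norm_LSeries_le {q : ℕ} [NeZero q] (χ : DirichletCharacter ℂ q) {x : ℝ} (hx : 0 < x) (hx1 : x ≤ 1) :
    ‖χ.LFunction ((1 + x : ℝ) : ℂ)‖ ≤ 2 / x := by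
  have hre : 1 < (((1 + x : ℝ) : ℂ)).re := by simp [hx]
  rw [LFunction_eq_LSeries χ hre]
  have hs := LSeriesSummable_of_one_lt_re χ hre
  refine (norm_tsum_le_tsum_norm hs.norm).trans ?_
  refine Real.tsum_le_of_sum_range_le (fun n => norm_nonneg _) fun M => ?_
  refine le_trans (Finset.sum_le_sum fun n _ => ?_) (sum_rpow_le hx hx1 M)
  rw [LSeries.norm_term_eq]
  split_ifs with h
  · positivity
  · rw [Complex.ofReal_re, Real.rpow_neg (by positivity), div_eq_mul_inv]
    exact mul_le_of_le_one_left (by positivity) (χ.norm_le_one _)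

lemma norm_LFunction_le {q : ℕ} [NeZero q] (χ : DirichletCharacter ℂ q) (hχ : χ ≠ 1) {x : ℝ} (hx : 0 ≤ x)
    (hx1 : x ≤ 1) : ‖χ.LFunction ((1 + x : ℝ) : ℂ)‖ ≤ 2 * ell q := by
  have hq : 1 ≤ q := Nat.pos_of_ne_zero (NeZero.ne q)
  have hq' : (1 : ℝ) ≤ q := by exact_mod_cast hq
  have h := LFunction_approx χ hχ (σ := 1 + x) (by linarith) (by linarith) hq
  have h1 : (q : ℝ) * (q : ℝ) ^ (-(1 + x)) ≤ 1 := by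
    calc (q : ℝ) * (q : ℝ) ^ (-(1 + x)) ≤ (q : ℝ) * (q : ℝ) ^ (-1 : ℝ) := by
          gcongr
          linarith
      _ = 1 := by rw [Real.rpow_neg_one, mul_inv_cancel₀ (by positivity)]
  have h2 : ‖∑ n ∈ Finset.range q, χ (n : ZMod q) * (((n : ℝ) ^ (-(1 + x)) : ℝ) : ℂ)‖ ≤ ell q := by
    refine le_trans (norm_sum_le_of_le _ (n := fun n : ℕ => ((n : ℝ))⁻¹) fun n _ => ?_) (harm_bound' q)
    rw [norm_mul, Complex.norm_real, Real.norm_of_nonneg (by positivity)]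
    refine (mul_le_of_le_one_left (by positivity) (χ.norm_le_one _)).trans ?_
    rcases Nat.eq_zero_or_pos n with rfl | hn
    · simp [Real.zero_rpow (by linarith : -x + -1 ≠ 0)]
    · rw [← Real.rpow_neg_one]
      exact Real.rpow_le_rpow_of_exponent_le (by exact_mod_cast hn) (by linarith)
  have := one_le_ell q
  have h3 := norm_add_le (χ.LFunction ((1 + x : ℝ) : ℂ) - ∑ n ∈ Finset.range q, χ (n : ZMod q) * (((n : ℝ) ^ (-(1 + x)) : ℝ) : ℂ)) (∑ n ∈ Finset.range q, χ (n : ZMod q) * (((n : ℝ) ^ (-(1 + x)) : ℝ) : ℂ))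
  rw [sub_add_cancel] at h3
  linarith

lemma g_bound {x t : ℝ} (ht : 1 ≤ t) : t ^ (-1 : ℝ) - t ^ (-(1 + x)) ≤ x * Real.log t * t⁻¹ := by
  have ht0 : 0 < t := by linarith
  have : t ^ (-(1 + x)) = t⁻¹ * Real.exp (- (x * Real.log t)) := by
    rw [show -(1 + x) = -1 + -x by ring, Real.rpow_add ht0, Real.rpow_neg_one,
      Real.rpow_def_of_pos ht0]
    congr 2; ring
  rw [this, Real.rpow_neg_one]
  have h := Real.add_one_le_exp (-(x * Real.log t))
  have h' : 0 < t⁻¹ := by positivity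
  nlinarith

lemma LFunction_diff {q : ℕ} [NeZero q] (χ : DirichletCharacter ℂ q) (hχ : χ ≠ 1) (hq : 3 ≤ q) {x : ℝ} (hx : 0 < x)
    (hx1 : x ≤ 1) : ‖χ.LFunction 1 - χ.LFunction ((1 + x : ℝ) : ℂ)‖ ≤ 2 * x * ell q ^ 2 := by
  have hq' : (3 : ℝ) ≤ q := by exact_mod_cast hq
  have t1 := tendsto_LFunction χ hχ (σ := 1) (by norm_num) (by norm_num)
  have t2 := tendsto_LFunction χ hχ (σ := 1 + x) (by linarith) (by linarith)
  have t := t1.sub t2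
  set g : ℕ → ℝ := fun n => (n : ℝ) ^ (-1 : ℝ) - (n : ℝ) ^ (-(1 + x)) with hg
  have hl : 0 ≤ Real.log q := Real.log_natCast_nonneg q
  have he : ell q = 1 + Real.log q := rfl
  have key := tail_bound χ hχ (K := q) (g := g) (l := χ.LFunction 1 - χ.LFunction ((1 + x : ℝ) : ℂ))
    (fun n hn => ?_) (fun n hn => ?_) ?_
  · have hgq : (q : ℝ) * g q ≤ x * ell q := by
      have := g_bound (x := x) (t := q) (by linarith)
      calc (q : ℝ) * g q ≤ q * (x * Real.log q * (q : ℝ)⁻¹) := by gcongr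
        _ = x * Real.log q := by field_simp
        _ ≤ x * ell q := by gcongr; linarith
    have hs : ‖∑ n ∈ Finset.range q, χ (n : ZMod q) * (g n : ℂ)‖ ≤ x * ell q * ell q := by
      refine le_trans (norm_sum_le_of_le _ (n := fun n : ℕ => x * ell q * ((n : ℝ))⁻¹) fun n hn => ?_) ?_
      · rw [norm_mul, Complex.norm_real, Real.norm_eq_abs]
        refine (mul_le_of_le_one_left (by positivity) (χ.norm_le_one _)).trans ?_
        rcases Nat.eq_zero_or_pos n with rfl | hn0
        · simp [hg, Real.zero_rpow (by linarith : -x + -1 ≠ 0), Real.rpow_neg_one]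
        · have hn1 : (1 : ℝ) ≤ n := by exact_mod_cast hn0
          rw [abs_of_nonneg]
          · refine (g_bound hn1).trans ?_
            gcongr
            have : Real.log n ≤ Real.log q := Real.log_le_log (by linarith) (by exact_mod_cast (Finset.mem_range.1 hn).le)
            linarith
          · exact sub_nonneg.2 (Real.rpow_le_rpow_of_exponent_le hn1 (by linarith))
      · rw [← Finset.mul_sum]
        have := one_le_ell q
        exact mul_le_mul_of_nonneg_left (harm_bound' q) (by positivity)
    have h3 := norm_add_le (χ.LFunction 1 - χ.LFunction ((1 + x : ℝ) : ℂ) - ∑ n ∈ Finset.range q, χ (n : ZMod q) * (g n : ℂ)) (∑ n ∈ Finset.range q, χ (n : ZMod q) * (g n : ℂ))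
    rw [sub_add_cancel] at h3
    have h1 := one_le_ell q
    nlinarith [mul_le_mul_of_nonneg_left h1 (by positivity : 0 ≤ x * ell q)]
  · have hn1 : (1 : ℝ) ≤ n := by exact_mod_cast (by omega)
    exact sub_nonneg.2 (Real.rpow_le_rpow_of_exponent_le hn1 (by linarith))
  · have hn3 : (3 : ℝ) ≤ n := by exact_mod_cast (by omega)
    have hanti : AntitoneOn (fun t : ℝ => t ^ (-1 : ℝ) - t ^ (-(1 + x))) (Set.Ici 3) := by
      refine antitoneOn_of_deriv_nonpos (convex_Ici 3) ?_ ?_ ?_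
      · refine ContinuousOn.sub ?_ ?_
        · exact ContinuousOn.rpow_const continuousOn_id fun t ht => Or.inl (by simp at ht ⊢; linarith)
        · exact ContinuousOn.rpow_const continuousOn_id fun t ht => Or.inl (by simp at ht ⊢; linarith)
      · intro t ht
        simp at ht
        exact (((Real.hasDerivAt_rpow_const (Or.inl (by linarith))).sub
          (Real.hasDerivAt_rpow_const (Or.inl (by linarith)))).differentiableAt).differentiableWithinAt
      · intro t ht
        simp at ht
        have ht0 : 0 < t := by linarith
        have hd := ((Real.hasDerivAt_rpow_const (x := t) (p := -1) (Or.inl (by linarith))).sub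
          (Real.hasDerivAt_rpow_const (x := t) (p := -(1 + x)) (Or.inl (by linarith)))).deriv
        have e1 : t ^ (-1 - 1 : ℝ) = t ^ (-(1 + x) - 1) * Real.exp (x * Real.log t) := by
          rw [mul_comm x, ← Real.rpow_def_of_pos ht0, ← Real.rpow_add ht0]; congr 1; ring
        refine (le_of_eq hd).trans ?_
        rw [e1]
        have hlog : 1 ≤ Real.log t := by
          rw [Real.le_log_iff_exp_le ht0]
          linarith [Real.exp_one_lt_d9]
        have h1 := Real.add_one_le_exp (x * Real.log t)
        have h2 : 0 < t ^ (-(1 + x) - 1) := by positivity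
        have h3 : 1 + x ≤ Real.exp (x * Real.log t) := by nlinarith
        nlinarith
    have := hanti (by simpa using hn3 : (n : ℝ) ∈ Set.Ici 3) (by simp; linarith : (n : ℝ) + 1 ∈ Set.Ici 3) (by linarith)
    simpa [hg] using this
  · have e : ((1 : ℝ) : ℂ) = 1 := by simp
    rw [e] at t
    refine t.congr fun M => ?_
    rw [← Finset.sum_sub_distrib]
    refine Finset.sum_congr rfl fun n _ => ?_
    rw [hg]; push_cast; ring

lemma complex_lower {q : ℕ} [NeZero q] (χ : DirichletCharacter ℂ q) (hχ : χ ^ 2 ≠ 1) (hq : 3 ≤ q) :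
    1 / (2048 * ell q ^ 7) ≤ ‖χ.LFunction 1‖ := by
  have hχ1 : χ ≠ 1 := by rintro rfl; simp at hχ
  have hl := one_le_ell q
  set l := ell q with hldef
  set x : ℝ := 1 / (4096 * l ^ 9) with hxdef
  have hl9 : 1 ≤ l ^ 9 := one_le_pow₀ hl
  have hx0 : 0 < x := by positivity
  have hx1 : x ≤ 1 := by
    rw [hxdef, div_le_one (by positivity)]; linarith
  have h1 := norm_LFunction_product_ge_one χ hx0 0
  have e1 : (1 : ℂ) + x + I * ((0 : ℝ) : ℂ) = ((1 + x : ℝ) : ℂ) := by push_cast; ring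
  have e2 : (1 : ℂ) + x + 2 * I * ((0 : ℝ) : ℂ) = ((1 + x : ℝ) : ℂ) := by push_cast; ring
  have e3 : (1 : ℂ) + x = ((1 + x : ℝ) : ℂ) := by push_cast; ring
  rw [e1, e2, e3, norm_mul, norm_mul, norm_pow, norm_pow] at h1
  have b1 := norm_LSeries_le (1 : DirichletCharacter ℂ q) hx0 hx1
  have b2 := norm_LFunction_le (χ ^ 2) hχ hx0.le hx1
  have b3 := LFunction_diff χ hχ1 hq hx0 hx1
  set A := ‖χ.LFunction ((1 + x : ℝ) : ℂ)‖ with hA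
  have hA0 : 0 ≤ A := norm_nonneg _
  have h2 : 1 ≤ (2 / x) ^ 3 * A ^ 4 * (2 * l) := by
    refine h1.le.trans ?_
    gcongr
  have h3 : 4 * x * l ^ 2 ≤ A := by
    by_contra hcon
    push Not at hcon
    have : A ^ 4 < (4 * x * l ^ 2) ^ 4 := pow_lt_pow_left₀ hcon hA0 (by norm_num)
    have h4 : (2 / x) ^ 3 * A ^ 4 * (2 * l) < (2 / x) ^ 3 * (4 * x * l ^ 2) ^ 4 * (2 * l) := by
      gcongr
    have h5 : (2 / x) ^ 3 * (4 * x * l ^ 2) ^ 4 * (2 * l) = 1 := by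
      have : (2 / x) ^ 3 * (4 * x * l ^ 2) ^ 4 * (2 * l) = 4096 * l ^ 9 * x := by field_simp; ring
      rw [this, hxdef]; field_simp
    linarith
  have h6 : A ≤ ‖χ.LFunction 1‖ + ‖χ.LFunction 1 - χ.LFunction ((1 + x : ℝ) : ℂ)‖ := by
    rw [hA, norm_sub_rev]
    have := norm_add_le (χ.LFunction 1) (χ.LFunction ((1 + x : ℝ) : ℂ) - χ.LFunction 1)
    simpa using this
  have h7 : 1 / (2048 * l ^ 7) = 2 * x * l ^ 2 := by rw [hxdef]; field_simp; ring
  rw [h7]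
  linarith

end NegMoment

namespace NegMoment

open Finset Filter Topology

lemma rpow_tangent {γ x y : ℝ} (hγ : 0 ≤ γ) (hγ1 : γ ≤ 1) (hx : 0 < x) (hy : 0 < y) :
    y ^ γ ≤ x ^ γ + γ * x ^ (γ - 1) * (y - x) := by
  have h := rpow_one_add_le_one_add_mul_self (s := (y - x) / x) (p := γ) ?_ hγ hγ1
  · have e : 1 + (y - x) / x = y / x := by field_simp; ring
    rw [e, Real.div_rpow hy.le hx.le, div_le_iff₀ (by positivity)] at h
    refine h.trans (le_of_eq ?_)
    rw [Real.rpow_sub_one hx.ne']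
    field_simp
  · rw [le_div_iff₀ hx]; linarith

lemma R_nonneg {q : ℕ} [NeZero q] {χ : DirichletCharacter ℂ q} (hχ2 : χ ^ 2 = 1) (n : ℕ) :
    0 ≤ ∑ d ∈ n.divisors, (χ (d : ZMod q)).re := by
  have h := zetaMul_nonneg hχ2 n
  have h2 := (Complex.nonneg_iff.1 h).1
  rw [zetaMul, ArithmeticFunction.coe_zeta_mul_apply, Complex.re_sum] at h2
  refine h2.trans (le_of_eq (Finset.sum_congr rfl fun d hd => ?_))
  have : d ≠ 0 := by rintro rfl; simp at hd
  simp [toArithmeticFunction, this]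

lemma chi_real {q : ℕ} [NeZero q] {χ : DirichletCharacter ℂ q} (hχ2 : χ ^ 2 = 1) (a : ZMod q) :
    (((χ a).re : ℝ) : ℂ) = χ a := by
  rcases MulChar.isQuadratic_iff_sq_eq_one.mpr hχ2 a with h | h | h <;> simp [h]

/-- The hyperbola sum. -/
lemma S_ge_one {q : ℕ} [NeZero q] {χ : DirichletCharacter ℂ q} (hχ2 : χ ^ 2 = 1) (X : ℕ) (hX : 1 ≤ X) (β : ℝ) :
    1 ≤ ∑ d ∈ Finset.Icc 1 X, ∑ m ∈ Finset.Icc 1 (X / d), (χ (d : ZMod q)).re * (d : ℝ) ^ (-β) * (m : ℝ) ^ (-β) := by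
  have e : ∑ d ∈ Finset.Icc 1 X, ∑ m ∈ Finset.Icc 1 (X / d), (χ (d : ZMod q)).re * (d : ℝ) ^ (-β) * (m : ℝ) ^ (-β)
      = ∑ n ∈ Finset.Icc 1 X, ∑ d ∈ n.divisors, (χ (d : ZMod q)).re * (n : ℝ) ^ (-β) := by
    rw [Finset.sum_sigma', Finset.sum_sigma']
    refine Finset.sum_bij' (fun a _ => ⟨a.1 * a.2, a.1⟩) (fun b _ => ⟨b.2, b.1 / b.2⟩) ?_ ?_ ?_ ?_ ?_
    · rintro ⟨d, m⟩ h
      simp only [Finset.mem_sigma, Finset.mem_Icc, Nat.mem_divisors] at h ⊢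
      have hd : 0 < d := h.1.1
      have := (Nat.le_div_iff_mul_le hd).1 h.2.2
      refine ⟨⟨Nat.mul_pos hd h.2.1, by rw [mul_comm]; exact this⟩, Dvd.intro _ rfl, ?_⟩
      exact (Nat.mul_pos hd h.2.1).ne'
    · rintro ⟨n, d⟩ h
      simp only [Finset.mem_sigma, Finset.mem_Icc, Nat.mem_divisors] at h ⊢
      have hn : 0 < n := h.1.1
      have hd : 0 < d := Nat.pos_of_dvd_of_pos h.2.1 hn
      have hdn := Nat.le_of_dvd hn h.2.1
      exact ⟨⟨hd, hdn.trans h.1.2⟩, Nat.div_pos hdn hd, Nat.div_le_div_right h.1.2⟩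
    · rintro ⟨d, m⟩ h
      simp only [Finset.mem_sigma, Finset.mem_Icc] at h
      have hd : 0 < d := h.1.1
      simp [Nat.mul_div_cancel_left _ hd]
    · rintro ⟨n, d⟩ h
      simp only [Finset.mem_sigma, Finset.mem_Icc, Nat.mem_divisors] at h
      simp [Nat.mul_div_cancel' h.2.1]
    · rintro ⟨d, m⟩ h
      simp only
      push_cast
      rw [Real.mul_rpow (by positivity) (by positivity)]
      ring
  rw [e]
  have h1 : ∑ n ∈ ({1} : Finset ℕ), ∑ d ∈ n.divisors, (χ (d : ZMod q)).re * (n : ℝ) ^ (-β) = 1 := by simp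
  rw [← h1]
  refine Finset.sum_le_sum_of_subset_of_nonneg (by intro n; simp; omega) fun n _ _ => ?_
  rw [← Finset.sum_mul]
  exact mul_nonneg (R_nonneg hχ2 n) (by positivity)

/-- Partial zeta sums. -/
noncomputable def W (β : ℝ) (n : ℕ) : ℝ := ∑ m ∈ Finset.Icc 1 n, (m : ℝ) ^ (-β)

lemma W_succ (β : ℝ) (n : ℕ) : W β (n + 1) = W β n + ((n + 1 : ℕ) : ℝ) ^ (-β) := by
  unfold W; rw [Finset.sum_Icc_succ_top (by omega)]

lemma W_anti {β : ℝ} (hβ : 0 ≤ β) (hβ1 : β < 1) {n X : ℕ} (hn : 1 ≤ n) (h : n ≤ X) :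
    W β X - (X : ℝ) ^ (1 - β) / (1 - β) ≤ W β n - (n : ℝ) ^ (1 - β) / (1 - β) := by
  induction X, h using Nat.le_induction with
  | base => exact le_rfl
  | succ X hX ih =>
    refine le_trans ?_ ih
    rw [W_succ]
    have hX0 : (0 : ℝ) < X := by exact_mod_cast (by omega)
    have ht := rpow_tangent (γ := 1 - β) (x := ((X + 1 : ℕ) : ℝ)) (y := X) (by linarith) (by linarith)
      (by positivity) hX0
    have hb : 0 < 1 - β := by linarith
    have : (X : ℝ) ^ (1 - β) / (1 - β) ≤ ((X + 1 : ℕ) : ℝ) ^ (1 - β) / (1 - β) - ((X + 1 : ℕ) : ℝ) ^ (-β) := by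
      rw [div_le_iff₀ hb, sub_mul, div_mul_cancel₀ _ hb.ne']
      refine ht.trans (le_of_eq ?_)
      rw [show 1 - β - 1 = -β by ring]
      push_cast; ring
    linarith

lemma W_mono {β : ℝ} (hβ : 0 ≤ β) (hβ1 : β < 1) {n X : ℕ} (hn : 1 ≤ n) (h : n ≤ X) :
    W β n - (n : ℝ) ^ (1 - β) / (1 - β) - (n : ℝ) ^ (-β) ≤ W β X - (X : ℝ) ^ (1 - β) / (1 - β) - (X : ℝ) ^ (-β) := by
  induction X, h using Nat.le_induction with
  | base => exact le_rfl
  | succ X hX ih =>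
    refine le_trans ih ?_
    rw [W_succ]
    have hX0 : (0 : ℝ) < X := by exact_mod_cast (by omega)
    have ht := rpow_tangent (γ := 1 - β) (y := ((X + 1 : ℕ) : ℝ)) (x := X) (by linarith) (by linarith)
      hX0 (by positivity)
    have hb : 0 < 1 - β := by linarith
    have : ((X + 1 : ℕ) : ℝ) ^ (1 - β) / (1 - β) ≤ (X : ℝ) ^ (1 - β) / (1 - β) + (X : ℝ) ^ (-β) := by
      rw [div_le_iff₀ hb, add_mul, div_mul_cancel₀ _ hb.ne']
      refine ht.trans (le_of_eq ?_)
      rw [show 1 - β - 1 = -β by ring]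
      push_cast; ring
    linarith

/-- There is a constant `C` approximating the zeta sums. -/
lemma W_approx {β : ℝ} (hβ : 0 ≤ β) (hβ1 : β < 1) (X : ℕ) (hX : 1 ≤ X) :
    ∃ C : ℝ, C ≤ 1 - 1 / (1 - β) ∧ - (1 / (1 - β)) ≤ C ∧ ∀ y : ℝ, 1 ≤ y → y ≤ X →
      |W β ⌊y⌋₊ - (y ^ (1 - β) / (1 - β) + C)| ≤ (⌊y⌋₊ : ℝ) ^ (-β) := by
  have hW1 : W β 1 = 1 := by simp [W]
  refine ⟨W β X - (X : ℝ) ^ (1 - β) / (1 - β), ?_, ?_, ?_⟩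
  · have := W_anti hβ hβ1 le_rfl hX
    rw [hW1] at this
    simpa using this
  · have := W_mono hβ hβ1 le_rfl hX
    rw [hW1] at this
    have h2 : (0 : ℝ) ≤ (X : ℝ) ^ (-β) := by positivity
    simp at this ⊢
    linarith
  · intro y hy1 hyX
    set n := ⌊y⌋₊ with hn
    have hn1 : 1 ≤ n := Nat.le_floor (by exact_mod_cast hy1)
    have hnX : n ≤ X := by
      have := Nat.floor_le_floor hyX
      simpa using this
    have hny : (n : ℝ) ≤ y := Nat.floor_le (by linarith)
    have hny' : y < n + 1 := Nat.lt_floor_add_one y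
    have hn0 : (0 : ℝ) < n := by exact_mod_cast hn1
    have h1 := W_anti hβ hβ1 hn1 hnX
    have h2 := W_mono hβ hβ1 hn1 hnX
    have h2' : (0 : ℝ) ≤ (X : ℝ) ^ (-β) := by positivity
    have hb : 0 < 1 - β := by linarith
    have ht := rpow_tangent (γ := 1 - β) (y := y) (x := n) (by linarith) (by linarith) hn0 (by linarith)
    rw [show 1 - β - 1 = -β by ring] at ht
    have hnb : (0 : ℝ) ≤ (n : ℝ) ^ (-β) := by positivity
    have h3 : y ^ (1 - β) / (1 - β) ≤ (n : ℝ) ^ (1 - β) / (1 - β) + (n : ℝ) ^ (-β) := by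
      rw [div_le_iff₀ hb, add_mul, div_mul_cancel₀ _ hb.ne']
      refine ht.trans ?_
      have : (n : ℝ) ^ (-β) * (y - n) ≤ (n : ℝ) ^ (-β) := mul_le_of_le_one_right hnb (by linarith)
      nlinarith
    have h4 : (n : ℝ) ^ (1 - β) / (1 - β) ≤ y ^ (1 - β) / (1 - β) := by
      gcongr
    rw [abs_le]
    constructor <;> linarith

end NegMoment

namespace NegMoment

open Finset Filter Topology

lemma L_real {q : ℕ} [NeZero q] {χ : DirichletCharacter ℂ q} (hχ : χ ≠ 1) (hχ2 : χ ^ 2 = 1) {σ : ℝ}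
    (h1 : 1 / 2 ≤ σ) (h2 : σ ≤ 2) : (((χ.LFunction σ).re : ℝ) : ℂ) = χ.LFunction σ := by
  have h := tendsto_LFunction χ hχ h1 h2
  have h3 := (Complex.continuous_im.tendsto _).comp h
  have h4 : (χ.LFunction σ).im = 0 := by
    refine tendsto_nhds_unique h3 ?_
    refine (tendsto_const_nhds (x := (0:ℝ))).congr fun M => ?_
    simp only [Function.comp]
    rw [Complex.im_sum]
    symm
    refine Finset.sum_eq_zero fun n _ => ?_
    rw [← chi_real hχ2, ← Complex.ofReal_mul, Complex.ofReal_im]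
  apply Complex.ext <;> simp [h4]

lemma L_two_nonneg {q : ℕ} [NeZero q] {χ : DirichletCharacter ℂ q} (hχ : χ ≠ 1) (hχ2 : χ ^ 2 = 1) :
    0 ≤ (χ.LFunction ((2:ℝ):ℂ)).re := by
  have h := tendsto_LFunction χ hχ (σ := 2) (by norm_num) le_rfl
  have h3 := (Complex.continuous_re.tendsto _).comp h
  refine ge_of_tendsto h3 ?_
  filter_upwards [eventually_ge_atTop 2] with M hM
  have hq : 0 < q := Nat.pos_of_ne_zero (NeZero.ne q)
  simp only [Function.comp]
  rw [Complex.re_sum]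
  have hs := sum_rpow_le (x := 1) (by norm_num) le_rfl (M * q)
  have e : ∑ n ∈ range (M * q), (χ (n : ZMod q) * (((n:ℝ) ^ (-(2:ℝ)) : ℝ) : ℂ)).re
      = ∑ n ∈ range (M * q), ((χ (n : ZMod q)).re + 1) * (n:ℝ) ^ (-(2:ℝ))
        - ∑ n ∈ range (M * q), (n:ℝ) ^ (-(1 + 1:ℝ)) := by
    rw [← Finset.sum_sub_distrib]
    refine Finset.sum_congr rfl fun n _ => ?_
    rw [Complex.re_mul_ofReal, show (1 + 1 : ℝ) = 2 by norm_num]; ring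
  rw [e]
  have h5 : 2 ≤ ∑ n ∈ range (M * q), ((χ (n : ZMod q)).re + 1) * (n:ℝ) ^ (-(2:ℝ)) := by
    have := Finset.single_le_sum (s := range (M * q))
      (f := fun n : ℕ => ((χ (n : ZMod q)).re + 1) * (n:ℝ) ^ (-(2:ℝ))) (fun n _ => ?_)
      (a := 1) (by rw [Finset.mem_range]; nlinarith)
    · refine le_trans (le_of_eq ?_) this; simp; norm_num
    · refine mul_nonneg ?_ (by positivity)
      have h6 := (Complex.abs_re_le_norm (χ (n : ZMod q))).trans (χ.norm_le_one _)
      have := neg_abs_le (χ (n : ZMod q)).re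
      linarith
  exact sub_nonneg.2 (hs.trans (by linarith))

lemma L_nonneg {q : ℕ} [NeZero q] {χ : DirichletCharacter ℂ q} (hχ : χ ≠ 1) (hχ2 : χ ^ 2 = 1) {β : ℝ}
    (hb : 1 / 2 ≤ β) (hb1 : β ≤ 2) (hz : ∀ σ : ℝ, β ≤ σ → χ.LFunction σ ≠ 0) :
    0 ≤ (χ.LFunction β).re := by
  by_contra hneg
  push Not at hneg
  have hc : ContinuousOn (fun σ : ℝ => (χ.LFunction σ).re) (Set.Icc β 2) := by
    refine Continuous.continuousOn ?_
    exact Complex.continuous_re.comp ((differentiable_LFunction hχ).continuous.comp Complex.continuous_ofReal)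
  have := intermediate_value_Icc hb1 hc
  obtain ⟨σ, hσ, h0⟩ := this ⟨hneg.le, L_two_nonneg hχ hχ2⟩
  refine hz σ hσ.1 ?_
  rw [← L_real hχ hχ2 (by linarith [hσ.1]) hσ.2]
  simpa using h0

lemma real_sum_approx {q : ℕ} [NeZero q] {χ : DirichletCharacter ℂ q} (hχ : χ ≠ 1) (hχ2 : χ ^ 2 = 1) {σ : ℝ}
    (h1 : 1 / 2 ≤ σ) (h2 : σ ≤ 2) (D : ℕ) (hD : 1 ≤ D) :
    |∑ d ∈ Finset.Icc 1 D, (χ (d : ZMod q)).re * (d : ℝ) ^ (-σ) - (χ.LFunction σ).re| ≤ q * (D : ℝ) ^ (-σ) := by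
  have h := LFunction_approx χ hχ h1 h2 (K := D + 1) (by omega)
  have e : ∑ n ∈ range (D + 1), χ (n : ZMod q) * (((n:ℝ) ^ (-σ) : ℝ) : ℂ)
      = ((∑ d ∈ Finset.Icc 1 D, (χ (d : ZMod q)).re * (d : ℝ) ^ (-σ) : ℝ) : ℂ) := by
    rw [Finset.range_eq_Ico, Finset.sum_eq_sum_Ico_succ_bot (by omega)]
    push_cast
    rw [chi_zero χ hχ, zero_mul, zero_add]
    refine Finset.sum_congr (by ext; simp) fun n _ => ?_
    rw [chi_real hχ2]
  rw [e, ← L_real hχ hχ2 h1 h2, ← Complex.ofReal_sub, Complex.norm_real, Real.norm_eq_abs, abs_sub_comm] at h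
  refine h.trans ?_
  have : (0:ℝ) < D := by exact_mod_cast hD
  have := Real.rpow_le_rpow_of_nonpos this (y := ((D + 1 : ℕ) : ℝ)) (z := -σ) (by push_cast; linarith) (by linarith)
  gcongr

lemma part_two {q : ℕ} [NeZero q] {χ : DirichletCharacter ℂ q} (hχ : χ ≠ 1) (hχ2 : χ ^ 2 = 1) {β : ℝ}
    (hβ : 0 ≤ β) (D E : ℕ) (hD : 1 ≤ D) :
    |∑ d ∈ Finset.Ioc D (D * E), ∑ m ∈ Finset.Icc 1 (D * E / d), (χ (d : ZMod q)).re * (d : ℝ) ^ (-β) * (m : ℝ) ^ (-β)|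
      ≤ E * (q * (D : ℝ) ^ (-β)) := by
  rw [Finset.sum_comm' (t' := Finset.Icc 1 E) (s' := fun m => Finset.Ioc D (D * E / m))]
  · calc _ ≤ ∑ m ∈ Finset.Icc 1 E, (q * (D : ℝ) ^ (-β)) := by
          refine (Finset.abs_sum_le_sum_abs _ _).trans (Finset.sum_le_sum fun m hm => ?_)
          rw [← Finset.sum_mul, abs_mul]
          have hm1 : (1:ℝ) ≤ m := by exact_mod_cast (Finset.mem_Icc.1 hm).1
          have h1 : |(m:ℝ) ^ (-β)| ≤ 1 := by
            rw [abs_of_nonneg (by positivity)]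
            exact Real.rpow_le_one_of_one_le_of_nonpos hm1 (by linarith)
          have h2 : |∑ d ∈ Finset.Ioc D (D * E / m), (χ (d : ZMod q)).re * (d : ℝ) ^ (-β)| ≤ q * (D : ℝ) ^ (-β) := by
            have := abel_bound (z := fun n : ℕ => χ (n : ZMod q)) (B := q) (K := D + 1)
              (fun M => norm_sum_Ico_le χ hχ _ _) (g := fun n => (n:ℝ) ^ (-β)) (fun n _ => by positivity)
              (fun n hn => ?_) (D * E / m + 1)
            · have e : ∑ n ∈ Finset.Ico (D + 1) (D * E / m + 1), χ (n : ZMod q) * (((n:ℝ) ^ (-β) : ℝ) : ℂ)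
                = ((∑ d ∈ Finset.Ioc D (D * E / m), (χ (d : ZMod q)).re * (d : ℝ) ^ (-β) : ℝ) : ℂ) := by
                push_cast
                refine Finset.sum_congr (by ext; simp) fun n _ => ?_
                rw [chi_real hχ2]
              rw [e, Complex.norm_real, Real.norm_eq_abs] at this
              refine this.trans ?_
              have : (0:ℝ) < D := by exact_mod_cast hD
              have := Real.rpow_le_rpow_of_nonpos this (y := ((D + 1 : ℕ) : ℝ)) (z := -β) (by push_cast; linarith) (by linarith)
              gcongr
            · have : (0 : ℝ) < n := by exact_mod_cast (by omega)
              exact Real.rpow_le_rpow_of_nonpos this (by push_cast; linarith) (by linarith)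
          calc _ ≤ (q * (D : ℝ) ^ (-β)) * 1 := by gcongr
            _ = _ := mul_one _
      _ = _ := by simp
  · intro d m
    simp only [Finset.mem_Ioc, Finset.mem_Icc]
    constructor
    · rintro ⟨⟨h1, h2⟩, h3, h4⟩
      have h5 := (Nat.le_div_iff_mul_le (by omega)).1 h4
      refine ⟨⟨h1, (Nat.le_div_iff_mul_le (by omega)).2 (by rw [mul_comm]; exact h5)⟩, h3, ?_⟩
      by_contra hc
      nlinarith
    · rintro ⟨⟨h1, h2⟩, h3, h4⟩
      have h5 := (Nat.le_div_iff_mul_le (by omega)).1 h2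
      refine ⟨⟨h1, ?_⟩, h3, (Nat.le_div_iff_mul_le (by omega)).2 (by rw [mul_comm]; exact h5)⟩
      nlinarith

lemma real_main {q : ℕ} [NeZero q] {χ : DirichletCharacter ℂ q} (hχ : χ ≠ 1) (hχ2 : χ ^ 2 = 1)
    (hq : 4 ≤ Real.log q) (hz : ∀ σ : ℝ, 1 - 1 / Real.log q ≤ σ → χ.LFunction σ ≠ 0) :
    1 ≤ Real.exp 5 * Real.log q * ((χ.LFunction 1).re + q * ((q:ℝ)^4)⁻¹) + Real.log q * (q * ((q:ℝ)^3)⁻¹)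
      + (q:ℝ)^(-(3/4:ℝ)) * (Real.exp 4 * ell (q^4 : ℕ)) + q * (q * ((q:ℝ)^3)⁻¹) := by
  set Λ := Real.log q with hΛ
  set β := 1 - 1 / Λ with hβ
  have hq0 : 0 < q := Nat.pos_of_ne_zero (NeZero.ne q)
  have hq0' : (0:ℝ) < q := by exact_mod_cast hq0
  have hq1 : (1:ℝ) ≤ q := by exact_mod_cast hq0
  have hΛ0 : 0 < Λ := by linarith
  have hL4 : 1 / Λ ≤ 1 / 4 := by gcongr
  have hLp : 0 < 1 / Λ := by positivity
  have hb34 : 3 / 4 ≤ β := by rw [hβ]; linarith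
  have hb1 : β < 1 := by rw [hβ]; linarith
  have hinv : 1 / (1 - β) = Λ := by rw [hβ]; field_simp; ring
  have h1b : 1 - β = 1 / Λ := by rw [hβ]; ring
  set D := q ^ 4 with hD
  have hD1 : 1 ≤ D := Nat.one_le_pow _ _ hq0
  have hDr : (D:ℝ) = (q:ℝ)^4 := by rw [hD]; push_cast; rfl
  have hDb : (D:ℝ) ^ (-β) ≤ ((q:ℝ)^3)⁻¹ := by
    calc (D:ℝ) ^ (-β) ≤ (D:ℝ) ^ (-(3/4:ℝ)) := by
          apply Real.rpow_le_rpow_of_exponent_le (by exact_mod_cast hD1); linarith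
      _ = ((q:ℝ)^3)⁻¹ := by
          rw [hDr, ← Real.rpow_natCast, ← Real.rpow_mul hq0'.le, ← Real.rpow_natCast, ← Real.rpow_neg hq0'.le]
          norm_num
  have hexp : ∀ n : ℕ, ((q:ℝ)^n) ^ (1 - β) = Real.exp n := by
    intro n
    rw [h1b, Real.rpow_def_of_pos (by positivity), Real.log_pow, ← hΛ]
    congr 1; field_simp
  set X := D * q with hX
  have hXr : (X:ℝ) = (q:ℝ)^5 := by rw [hX, hD]; push_cast; ring
  have hX1 : 1 ≤ X := Nat.mul_pos hD1 hq0
  obtain ⟨C, hC1, hC2, hC⟩ := W_approx (β := β) (by linarith) hb1 X hX1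
  rw [hinv] at hC1 hC2
  have hS := S_ge_one hχ2 X hX1 β
  have hsplit : Finset.Icc 1 X = Finset.Icc 1 D ∪ Finset.Ioc D X := by
    ext d; simp only [Finset.mem_Icc, Finset.mem_union, Finset.mem_Ioc]
    have : D ≤ X := Nat.le_mul_of_pos_right D hq0
    omega
  rw [hsplit, Finset.sum_union (by
    rw [Finset.disjoint_left]; intro d; simp; omega)] at hS
  have hp2 := part_two hχ hχ2 (β := β) (by linarith) D q hD1
  rw [← hX] at hp2
  have hp2' := (abs_le.1 hp2).2
  have hp2'' : (q:ℝ) * (q * (D : ℝ) ^ (-β)) ≤ q * (q * ((q:ℝ)^3)⁻¹) := by gcongr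
  -- part one
  have hA1 := real_sum_approx hχ hχ2 (σ := 1) (by norm_num) (by norm_num) D hD1
  have hAb := real_sum_approx hχ hχ2 (σ := β) (by linarith) (by linarith) D hD1
  have hLb := L_nonneg hχ hχ2 (β := β) (by linarith) (by linarith) hz
  have hp1 : ∑ d ∈ Finset.Icc 1 D, ∑ m ∈ Finset.Icc 1 (X / d), (χ (d : ZMod q)).re * (d : ℝ) ^ (-β) * (m : ℝ) ^ (-β)
      ≤ Real.exp 5 * Λ * (∑ d ∈ Finset.Icc 1 D, (χ (d : ZMod q)).re * (d : ℝ) ^ (-1:ℝ))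
        + C * (∑ d ∈ Finset.Icc 1 D, (χ (d : ZMod q)).re * (d : ℝ) ^ (-β))
        + (q:ℝ)^(-(3/4:ℝ)) * (Real.exp 4 * ∑ d ∈ Finset.Icc 1 D, (d:ℝ)⁻¹) := by
    rw [Finset.mul_sum, Finset.mul_sum, Finset.mul_sum, Finset.mul_sum, ← Finset.sum_add_distrib, ← Finset.sum_add_distrib]
    refine Finset.sum_le_sum fun d hd => ?_
    rw [Finset.mem_Icc] at hd
    have hd0 : (0:ℝ) < d := by exact_mod_cast hd.1
    have hdD : (d:ℝ) ≤ (q:ℝ)^4 := by rw [← hDr]; exact_mod_cast hd.2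
    rw [← Finset.mul_sum]
    change _ * W β (X / d) ≤ _
    have hqXd : q ≤ X / d := (Nat.le_div_iff_mul_le hd.1).2 (by rw [hX, mul_comm]; exact Nat.mul_le_mul_right _ hd.2)
    have hfl : ⌊(X:ℝ) / d⌋₊ = X / d := Nat.floor_div_eq_div X d
    have hy := hC ((X:ℝ) / d) (by
      rw [le_div_iff₀ hd0, hXr]
      calc 1 * (d:ℝ) ≤ (q:ℝ)^4 := by linarith
        _ ≤ (q:ℝ)^5 := pow_le_pow_right₀ hq1 (by norm_num)) (div_le_self (by positivity) (by exact_mod_cast hd.1))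
    rw [hfl] at hy
    have hy2 : ((X / d : ℕ):ℝ) ^ (-β) ≤ (q:ℝ)^(-(3/4:ℝ)) := by
      calc ((X / d : ℕ):ℝ) ^ (-β) ≤ (q:ℝ) ^ (-β) := by
            apply Real.rpow_le_rpow_of_nonpos hq0' (by exact_mod_cast hqXd) (by linarith)
        _ ≤ _ := Real.rpow_le_rpow_of_exponent_le hq1 (by linarith)
    have hy3 := hy.trans hy2
    set e := W β (X / d) - (((X:ℝ) / d) ^ (1 - β) / (1 - β) + C) with he
    have hW : W β (X / d) = Real.exp 5 * ((d:ℝ) ^ (1 - β))⁻¹ * Λ + C + e := by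
      have : ((X:ℝ) / d) ^ (1 - β) / (1 - β) = Real.exp 5 * ((d:ℝ) ^ (1 - β))⁻¹ * Λ := by
        rw [Real.div_rpow (by positivity) hd0.le, hXr, hexp 5, ← hinv]
        push_cast; ring
      rw [he, this]; ring
    have hdd : (d:ℝ) ^ (-β) * ((d:ℝ) ^ (1 - β))⁻¹ = (d:ℝ) ^ (-1:ℝ) := by
      rw [← Real.rpow_neg hd0.le, ← Real.rpow_add hd0]; congr 1; ring
    have hdd2 : (d:ℝ) ^ (-β) ≤ Real.exp 4 * (d:ℝ)⁻¹ := by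
      have : (d:ℝ) ^ (-β) = (d:ℝ)⁻¹ * (d:ℝ) ^ (1 - β) := by
        rw [← Real.rpow_neg_one, ← Real.rpow_add hd0]; congr 1; ring
      rw [this, mul_comm]
      have h4 := hexp 4
      push_cast at h4
      rw [← h4]
      gcongr
    have hr : |(χ (d : ZMod q)).re| ≤ 1 := (Complex.abs_re_le_norm _).trans (χ.norm_le_one _)
    have herr : (χ (d : ZMod q)).re * (d : ℝ) ^ (-β) * e ≤ (q:ℝ)^(-(3/4:ℝ)) * (Real.exp 4 * (d:ℝ)⁻¹) := by
      refine (le_abs_self _).trans ?_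
      rw [abs_mul, abs_mul, abs_of_nonneg (show 0 ≤ (d:ℝ) ^ (-β) by positivity)]
      calc _ ≤ 1 * (Real.exp 4 * (d:ℝ)⁻¹) * (q:ℝ)^(-(3/4:ℝ)) := by gcongr
        _ = _ := by ring
    rw [hW]
    calc _ = Real.exp 5 * Λ * ((χ (d : ZMod q)).re * ((d : ℝ) ^ (-β) * ((d:ℝ) ^ (1 - β))⁻¹))
          + C * ((χ (d : ZMod q)).re * (d : ℝ) ^ (-β)) + (χ (d : ZMod q)).re * (d : ℝ) ^ (-β) * e := by ring
      _ ≤ _ := by rw [hdd]; linarith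
  have hH : ∑ d ∈ Finset.Icc 1 D, (d:ℝ)⁻¹ ≤ ell D := by
    refine le_trans ?_ (harm_bound D)
    exact Finset.sum_le_sum_of_subset_of_nonneg (by intro n; simp) fun n _ _ => by positivity
  have hT1 : Real.exp 5 * Λ * (∑ d ∈ Finset.Icc 1 D, (χ (d : ZMod q)).re * (d : ℝ) ^ (-1:ℝ))
      ≤ Real.exp 5 * Λ * ((χ.LFunction 1).re + q * ((q:ℝ)^4)⁻¹) := by
    have := (abs_le.1 hA1).2
    rw [Real.rpow_neg_one (D:ℝ), hDr, Complex.ofReal_one] at this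
    gcongr
    linarith
  have hT2 : C * (∑ d ∈ Finset.Icc 1 D, (χ (d : ZMod q)).re * (d : ℝ) ^ (-β)) ≤ Λ * (q * ((q:ℝ)^3)⁻¹) := by
    have h1 := (abs_le.1 hAb).1
    have h2 : (q:ℝ) * (D : ℝ) ^ (-β) ≤ q * ((q:ℝ)^3)⁻¹ := by gcongr
    set A := ∑ d ∈ Finset.Icc 1 D, (χ (d : ZMod q)).re * (d : ℝ) ^ (-β)
    have h3 : -(q * ((q:ℝ)^3)⁻¹) ≤ A := by linarith
    have h4 : 0 ≤ q * ((q:ℝ)^3)⁻¹ := by positivity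
    have hC0 : C ≤ 0 := by linarith
    nlinarith [mul_nonneg_of_nonpos_of_nonpos hC0 (show -(q * ((q:ℝ)^3)⁻¹) - A ≤ 0 by linarith)]
  have hT3 : (q:ℝ)^(-(3/4:ℝ)) * (Real.exp 4 * ∑ d ∈ Finset.Icc 1 D, (d:ℝ)⁻¹) ≤ (q:ℝ)^(-(3/4:ℝ)) * (Real.exp 4 * ell D) := by
    gcongr
  linarith

lemma real_err : ∃ Q : ℕ, ∀ q : ℕ, Q ≤ q → 4 ≤ Real.log q ∧
    Real.exp 5 * Real.log q * (q * ((q:ℝ)^4)⁻¹) + Real.log q * (q * ((q:ℝ)^3)⁻¹)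
      + (q:ℝ)^(-(3/4:ℝ)) * (Real.exp 4 * ell (q^4 : ℕ)) + q * (q * ((q:ℝ)^3)⁻¹) ≤ 1 / 2 := by
  have hlog : Tendsto (fun x : ℝ => Real.log x * x ^ (-(3/4:ℝ))) atTop (𝓝 0) := by
    have := (isLittleO_log_rpow_atTop (r := 3/4) (by norm_num)).tendsto_div_nhds_zero
    refine this.congr' ?_
    filter_upwards [eventually_gt_atTop 0] with x hx
    rw [Real.rpow_neg hx.le]; rfl
  have hpow : Tendsto (fun x : ℝ => x ^ (-(3/4:ℝ))) atTop (𝓝 0) := tendsto_rpow_neg_atTop (by norm_num)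
  have htot : Tendsto (fun x : ℝ => (Real.exp 5 + 1 + 4 * Real.exp 4) * (Real.log x * x ^ (-(3/4:ℝ)))
      + (Real.exp 4 + 1) * x ^ (-(3/4:ℝ))) atTop (𝓝 0) := by
    have := (hlog.const_mul (Real.exp 5 + 1 + 4 * Real.exp 4)).add (hpow.const_mul (Real.exp 4 + 1))
    simpa using this
  have hev : ∀ᶠ x : ℝ in atTop, 4 ≤ Real.log x ∧ 1 ≤ x ∧ (Real.exp 5 + 1 + 4 * Real.exp 4) * (Real.log x * x ^ (-(3/4:ℝ)))
      + (Real.exp 4 + 1) * x ^ (-(3/4:ℝ)) ≤ 1 / 2 := by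
    filter_upwards [Real.tendsto_log_atTop.eventually_ge_atTop 4, eventually_ge_atTop 1,
      htot.eventually_le_const (show (0:ℝ) < 1/2 by norm_num)] with x h1 h2 h3 using ⟨h1, h2, h3⟩
  obtain ⟨Q, hQ⟩ := eventually_atTop.1 (tendsto_natCast_atTop_atTop.eventually hev)
  refine ⟨Q, fun q hq => ?_⟩
  obtain ⟨h1, h2, h3⟩ := hQ q hq
  refine ⟨h1, ?_⟩
  have hq0 : (0:ℝ) < q := by linarith
  have hp : ∀ n : ℕ, 1 ≤ n → ((q:ℝ)^n)⁻¹ ≤ (q:ℝ) ^ (-(3/4:ℝ)) := by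
    intro n hn
    rw [← Real.rpow_natCast, ← Real.rpow_neg hq0.le]
    apply Real.rpow_le_rpow_of_exponent_le h2
    have : (1:ℝ) ≤ n := by exact_mod_cast hn
    linarith
  have e1 : (q:ℝ) * ((q:ℝ)^4)⁻¹ = ((q:ℝ)^3)⁻¹ := by field_simp
  have e2 : (q:ℝ) * ((q:ℝ)^3)⁻¹ = ((q:ℝ)^2)⁻¹ := by field_simp
  have e3 : (q:ℝ) * ((q:ℝ)^2)⁻¹ = ((q:ℝ)^1)⁻¹ := by field_simp
  have e4 : ell (q^4 : ℕ) = 1 + 4 * Real.log q := by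
    simp [ell, Real.log_pow]
  rw [e1, e2, e3, e4]
  refine le_trans ?_ h3
  have g1 := hp 3 (by norm_num)
  have g2 := hp 2 (by norm_num)
  have g3 := hp 1 (by norm_num)
  have k1 : Real.exp 5 * Real.log q * ((q:ℝ)^3)⁻¹ ≤ Real.exp 5 * Real.log q * (q:ℝ) ^ (-(3/4:ℝ)) := by gcongr
  have k2 : Real.log q * ((q:ℝ)^2)⁻¹ ≤ Real.log q * (q:ℝ) ^ (-(3/4:ℝ)) := by gcongr
  linarith

/-- Lower bound for real characters without exceptional zeros. -/
lemma real_lower : ∃ Q : ℕ, ∀ (q : ℕ) [NeZero q] (χ : DirichletCharacter ℂ q), Q ≤ q → χ ≠ 1 → χ ^ 2 = 1 →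
    (∀ σ : ℝ, 1 - 1 / Real.log q ≤ σ → χ.LFunction σ ≠ 0) →
    0 < Real.log q ∧ 1 / (2 * Real.exp 5 * Real.log q) ≤ ‖χ.LFunction 1‖ := by
  obtain ⟨Q, hQ⟩ := real_err
  refine ⟨Q, fun q _ χ hq hχ hχ2 hz => ?_⟩
  obtain ⟨h1, h2⟩ := hQ q hq
  have h3 := real_main hχ hχ2 h1 hz
  have h0 : 0 < Real.log q := by linarith
  refine ⟨h0, le_trans ?_ (Complex.abs_re_le_norm _)⟩
  refine le_trans ?_ (le_abs_self _)
  rw [div_le_iff₀ (by positivity)]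
  linarith

end NegMoment

namespace NegMoment

open Finset Filter Topology

lemma orth {q : ℕ} [NeZero q] (a b : ZMod q) :
    ∑ χ : DirichletCharacter ℂ q, χ a * star (χ b) = if IsUnit b ∧ b = a then (q.totient : ℂ) else 0 := by
  by_cases hb : IsUnit b
  · have h := sum_char_inv_mul_char_eq ℂ hb a
    simp only [hb, true_and]
    rw [← h]
    refine Finset.sum_congr rfl fun χ _ => ?_
    have h1 : χ b⁻¹ * χ b = 1 := by
      rw [← map_mul, ZMod.inv_mul_of_unit _ hb, map_one]
    have h2 : star (χ b) * χ b = 1 := by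
      have hn : ‖χ b‖ = 1 := χ.unit_norm_eq_one hb.unit
      have := Complex.conj_mul' (χ b)
      rw [hn] at this
      simpa using this
    have hne : χ b ≠ 0 := right_ne_zero_of_mul_eq_one h1
    have : star (χ b) = χ b⁻¹ := mul_right_cancel₀ hne (h2.trans h1.symm)
    rw [this, mul_comm]
  · simp only [hb, false_and, if_false]
    refine Finset.sum_eq_zero fun χ _ => ?_
    rw [MulChar.map_nonunit χ hb]; simp

open scoped Classical in
lemma parseval {q : ℕ} [NeZero q] (f g : ZMod q → ℝ) :
    ∑ χ : DirichletCharacter ℂ q, (∑ a, χ a * (f a : ℂ)) * star (∑ b, χ b * (g b : ℂ))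
      = (((q.totient : ℝ) * ∑ a, (if IsUnit a then f a * g a else 0) : ℝ) : ℂ) := by
  have e : ∀ χ : DirichletCharacter ℂ q, (∑ a, χ a * (f a : ℂ)) * star (∑ b, χ b * (g b : ℂ))
      = ∑ a, ∑ b, (χ a * star (χ b)) * (f a * g b : ℂ) := by
    intro χ
    rw [star_sum, Finset.sum_mul_sum]
    refine Finset.sum_congr rfl fun a _ => Finset.sum_congr rfl fun b _ => ?_
    simp only [star_mul', RCLike.star_def, Complex.conj_ofReal]
    ring
  simp_rw [e]
  rw [Finset.sum_comm]
  simp_rw [Finset.sum_comm (s := (Finset.univ : Finset (DirichletCharacter ℂ q))), ← Finset.sum_mul, orth]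
  push_cast
  rw [Finset.mul_sum]
  refine Finset.sum_congr rfl fun a _ => ?_
  rw [Finset.sum_eq_single a]
  · by_cases h : IsUnit a <;> simp [h]
  · intro b _ hb; simp [hb]
  · simp

lemma sum_range_eq {q : ℕ} [NeZero q] {M : Type*} [AddCommMonoid M] (g : ZMod q → ℕ → M) :
    ∑ n ∈ range q, g (n : ZMod q) n = ∑ a : ZMod q, g a a.val := by
  refine Finset.sum_nbij' (fun n => (n : ZMod q)) (fun x => x.val) ?_ ?_ ?_ ?_ ?_
  · intro n _; simp
  · intro x _; simpa using ZMod.val_lt x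
  · intro n hn; simpa using ZMod.val_cast_of_lt (by simpa using hn)
  · intro x _; simp
  · intro n hn
    rw [ZMod.val_cast_of_lt (by simpa using hn)]

lemma norm_sq_ofReal (z : ℂ) : ((‖z‖ ^ 2 : ℝ) : ℂ) = z * star z := by
  rw [RCLike.star_def, Complex.mul_conj']; push_cast; rfl

open scoped Classical in
lemma parseval_nat {q : ℕ} [NeZero q] (c : ℕ → ℝ) :
    ∑ χ : DirichletCharacter ℂ q, ‖∑ n ∈ range q, χ (n : ZMod q) * (c n : ℂ)‖ ^ 2
      = (q.totient : ℝ) * ∑ n ∈ range q, (if IsUnit (n : ZMod q) then c n ^ 2 else 0) := by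
  have h := parseval (q := q) (fun a => c a.val) (fun a => c a.val)
  apply Complex.ofReal_injective
  rw [Complex.ofReal_sum]
  have e : ∀ χ : DirichletCharacter ℂ q, ∑ n ∈ range q, χ (n : ZMod q) * (c n : ℂ) = ∑ a : ZMod q, χ a * (c a.val : ℂ) :=
    fun χ => sum_range_eq (fun a n => χ a * (c n : ℂ))
  simp_rw [norm_sq_ofReal, e]
  rw [sum_range_eq (fun a n => if IsUnit a then c n ^ 2 else 0)]
  convert h using 2
  congr 1
  refine Finset.sum_congr rfl fun a _ => ?_
  rw [pow_two]

lemma parseval_le {q : ℕ} [NeZero q] (c : ℕ → ℝ) :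
    ∑ χ : DirichletCharacter ℂ q, ‖∑ n ∈ range q, χ (n : ZMod q) * (c n : ℂ)‖ ^ 2
      ≤ (q : ℝ) * ∑ n ∈ range q, c n ^ 2 := by
  classical
  rw [parseval_nat]
  gcongr with n hn
  · exact Nat.totient_le q
  · split_ifs
    · exact le_rfl
    · positivity

lemma conv_le (q : ℕ) (f g : ℕ → ℝ) (hf : ∀ n, 0 ≤ f n) (hg : ∀ n, 0 ≤ g n) :
    ∑ n ∈ range q, ∑ x ∈ n.divisorsAntidiagonal, f x.1 * g x.2 ≤ (∑ n ∈ range q, f n) * ∑ n ∈ range q, g n := by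
  rw [Finset.sum_mul_sum, ← Finset.sum_product', Finset.sum_sigma']
  have hinj : Set.InjOn (fun a : (_ : ℕ) × ℕ × ℕ => a.2) ((range q).sigma fun n => n.divisorsAntidiagonal : Finset ((_ : ℕ) × ℕ × ℕ)) := by
    rintro ⟨n, x⟩ h1 ⟨m, y⟩ h2 h
    simp only [Finset.coe_sigma, Set.mem_sigma_iff, Finset.mem_coe, Nat.mem_divisorsAntidiagonal] at h1 h2 h
    subst h
    obtain rfl : n = m := h1.2.1.symm.trans h2.2.1
    rfl
  rw [← Finset.sum_image (f := fun x : ℕ × ℕ => f x.1 * g x.2) hinj]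
  refine Finset.sum_le_sum_of_subset_of_nonneg ?_ fun x _ _ => mul_nonneg (hf _) (hg _)
  intro x hx
  simp only [Finset.mem_image, Finset.mem_sigma, Nat.mem_divisorsAntidiagonal, Finset.mem_product, Finset.mem_range] at hx ⊢
  obtain ⟨⟨n, y⟩, ⟨h1, h2, h3⟩, rfl⟩ := hx
  simp only at h1 h2 h3 ⊢
  subst h2
  have ha : 0 < y.1 := Nat.pos_of_ne_zero (left_ne_zero_of_mul h3)
  have hb : 0 < y.2 := Nat.pos_of_ne_zero (right_ne_zero_of_mul h3)
  constructor <;> nlinarith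

lemma card_div_mul (a b : ℕ) : (a * b).divisors.card ≤ a.divisors.card * b.divisors.card := by
  rw [Nat.divisors_mul]
  exact Finset.card_mul_le

lemma card_div_sq (n : ℕ) : ((n.divisors.card : ℝ)) ^ 2 ≤ ∑ x ∈ n.divisorsAntidiagonal, (x.1.divisors.card : ℝ) * x.2.divisors.card := by
  have : (n.divisors.card : ℝ) ^ 2 = ∑ x ∈ n.divisorsAntidiagonal, (n.divisors.card : ℝ) := by
    rw [Finset.sum_const, ← Nat.map_div_right_divisors, Finset.card_map]
    simp [pow_two]
  rw [this]
  refine Finset.sum_le_sum fun x hx => ?_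
  rw [← (Nat.mem_divisorsAntidiagonal.1 hx).1]
  exact_mod_cast card_div_mul _ _

end NegMoment

namespace NegMoment

open Finset Filter Topology

lemma sum_card_div (q : ℕ) : ∑ n ∈ range q, (n.divisors.card : ℝ) * (n:ℝ)⁻¹ ≤ ell q ^ 2 := by
  have h := conv_le q (fun n => (n:ℝ)⁻¹) (fun n => (n:ℝ)⁻¹) (fun n => by positivity) (fun n => by positivity)
  have hl := one_le_ell q
  have h0 : 0 ≤ ∑ n ∈ range q, (n:ℝ)⁻¹ := Finset.sum_nonneg fun n _ => by positivity
  refine le_trans (le_trans (le_of_eq ?_) h) ?_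
  · refine Finset.sum_congr rfl fun n _ => ?_
    have : ∑ x ∈ n.divisorsAntidiagonal, ((x.1:ℝ))⁻¹ * ((x.2:ℝ))⁻¹ = ∑ x ∈ n.divisorsAntidiagonal, (n:ℝ)⁻¹ := by
      refine Finset.sum_congr rfl fun x hx => ?_
      rw [← (Nat.mem_divisorsAntidiagonal.1 hx).1]
      push_cast; rw [mul_inv]
    rw [this, Finset.sum_const, ← Nat.map_div_right_divisors, Finset.card_map, nsmul_eq_mul]
  · rw [pow_two]
    have := harm_bound' q
    gcongr

lemma sum_card_div_sq (q : ℕ) : ∑ n ∈ range q, (n.divisors.card : ℝ) ^ 2 * (n:ℝ)⁻¹ ≤ ell q ^ 4 := by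
  have h := conv_le q (fun n => (n.divisors.card : ℝ) * (n:ℝ)⁻¹) (fun n => (n.divisors.card : ℝ) * (n:ℝ)⁻¹)
    (fun n => by positivity) (fun n => by positivity)
  have h0 : 0 ≤ ∑ n ∈ range q, (n.divisors.card : ℝ) * (n:ℝ)⁻¹ := Finset.sum_nonneg fun n _ => by positivity
  refine le_trans (le_trans (Finset.sum_le_sum fun n _ => ?_) h) ?_
  · have : ∑ x ∈ n.divisorsAntidiagonal, ((x.1.divisors.card : ℝ) * (x.1:ℝ)⁻¹) * ((x.2.divisors.card : ℝ) * (x.2:ℝ)⁻¹)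
        = ∑ x ∈ n.divisorsAntidiagonal, ((x.1.divisors.card : ℝ) * x.2.divisors.card) * (n:ℝ)⁻¹ := by
      refine Finset.sum_congr rfl fun x hx => ?_
      rw [← (Nat.mem_divisorsAntidiagonal.1 hx).1]
      push_cast; rw [mul_inv]; ring
    rw [this, ← Finset.sum_mul]
    gcongr
    exact card_div_sq n
  · have := sum_card_div q
    calc _ ≤ ell q ^ 2 * ell q ^ 2 := by gcongr
      _ = _ := by ring

/-- Truncation parameter. -/
def NN (q : ℕ) : ℕ := Nat.sqrt (q - 1)

lemma NN_sq {q : ℕ} (hq : 1 ≤ q) : NN q * NN q < q := by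
  have := Nat.sqrt_le (q - 1)
  unfold NN; omega

lemma NN_pos {q : ℕ} (hq : 2 ≤ q) : 1 ≤ NN q := by
  unfold NN
  exact Nat.sqrt_pos.2 (by omega)

/-- The mollifier. -/
noncomputable def MM {q : ℕ} (χ : DirichletCharacter ℂ q) : ℂ :=
  ∑ n ∈ range (NN q + 1), χ (n : ZMod q) * (((ArithmeticFunction.moebius n : ℝ) * (n:ℝ)⁻¹ : ℝ) : ℂ)

/-- The short partial sum. -/
noncomputable def PP {q : ℕ} (χ : DirichletCharacter ℂ q) : ℂ :=
  ∑ n ∈ range (NN q + 1), χ (n : ZMod q) * (((n:ℝ)⁻¹ : ℝ) : ℂ)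

lemma abs_mu (n : ℕ) : |(ArithmeticFunction.moebius n : ℝ)| ≤ 1 := by
  exact_mod_cast ArithmeticFunction.abs_moebius_le_one (n := n)

lemma MM_bound {q : ℕ} (hq : 1 ≤ q) (χ : DirichletCharacter ℂ q) : ‖MM χ‖ ≤ ell q := by
  refine (norm_sum_le _ _).trans ?_
  refine le_trans ?_ (harm_bound q)
  calc _ ≤ ∑ n ∈ range (NN q + 1), (n:ℝ)⁻¹ := by
        refine Finset.sum_le_sum fun n _ => ?_
        rw [norm_mul, Complex.norm_real, Real.norm_eq_abs, abs_mul, abs_of_nonneg (show 0 ≤ (n:ℝ)⁻¹ by positivity)]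
        have h1 := χ.norm_le_one (n : ZMod q)
        have h2 := abs_mu n
        calc _ ≤ 1 * (1 * (n:ℝ)⁻¹) := by gcongr
          _ = _ := by ring
    _ ≤ _ := by
        refine Finset.sum_le_sum_of_subset_of_nonneg ?_ fun n _ _ => by positivity
        intro n; simp only [Finset.mem_range]
        have := NN_sq hq
        have : NN q ≤ NN q * NN q := Nat.le_mul_self _
        omega

/-- Coefficients of the product. -/
def cc (N n : ℕ) : ℤ := ∑ x ∈ n.divisorsAntidiagonal with (x.1 ≤ N ∧ x.2 ≤ N), ArithmeticFunction.moebius x.2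

lemma cc_one {N : ℕ} (hN : 1 ≤ N) : cc N 1 = 1 := by
  have : (Nat.divisorsAntidiagonal 1).filter (fun x => x.1 ≤ N ∧ x.2 ≤ N) = {(1,1)} := by
    rw [Nat.divisorsAntidiagonal_one, Finset.filter_singleton]; simp [hN]
  rw [cc, this]; simp

lemma cc_small {N n : ℕ} (h1 : 1 < n) (h2 : n ≤ N) : cc N n = 0 := by
  have : n.divisorsAntidiagonal.filter (fun x => x.1 ≤ N ∧ x.2 ≤ N) = n.divisorsAntidiagonal := by
    refine Finset.filter_true_of_mem fun x hx => ?_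
    exact ⟨(Nat.divisor_le (Nat.fst_mem_divisors_of_mem_antidiagonal hx)).trans h2,
      (Nat.divisor_le (Nat.snd_mem_divisors_of_mem_antidiagonal hx)).trans h2⟩
  rw [cc, this]
  have h := congrArg (fun f => f n) ArithmeticFunction.coe_zeta_mul_moebius
  simp only [ArithmeticFunction.mul_apply, ArithmeticFunction.one_apply_ne h1.ne'] at h
  rw [← h]
  refine Finset.sum_congr rfl fun x hx => ?_
  have := Nat.mem_divisorsAntidiagonal.1 hx
  have : x.1 ≠ 0 := by rintro h0; rw [h0] at this; simp at this; omega
  simp [ArithmeticFunction.zeta_apply, this]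

lemma cc_bound (N n : ℕ) : |(cc N n : ℝ)| ≤ n.divisors.card := by
  unfold cc
  push_cast
  refine (Finset.abs_sum_le_sum_abs _ _).trans ?_
  calc _ ≤ ∑ x ∈ n.divisorsAntidiagonal with (x.1 ≤ N ∧ x.2 ≤ N), (1:ℝ) := Finset.sum_le_sum fun x _ => abs_mu _
    _ ≤ ∑ x ∈ n.divisorsAntidiagonal, (1:ℝ) :=
        Finset.sum_le_sum_of_subset_of_nonneg (Finset.filter_subset _ _) fun _ _ _ => by norm_num
    _ = _ := by rw [Finset.sum_const, ← Nat.map_div_right_divisors, Finset.card_map]; simp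

lemma PM_eq {q : ℕ} (hq : 1 ≤ q) (χ : DirichletCharacter ℂ q) :
    PP χ * MM χ = ∑ n ∈ range q, χ (n : ZMod q) * (((cc (NN q) n : ℝ) * (n:ℝ)⁻¹ : ℝ) : ℂ) := by
  set N := NN q with hN
  set F : ℕ × ℕ → ℂ := fun x => χ ((x.1 * x.2 : ℕ) : ZMod q) *
    (((ArithmeticFunction.moebius x.2 : ℝ) * ((x.1 * x.2 : ℕ):ℝ)⁻¹ : ℝ) : ℂ) with hF
  have h1 : PP χ * MM χ = ∑ x ∈ range (N + 1) ×ˢ range (N + 1), F x := by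
    rw [PP, MM, Finset.sum_mul_sum, Finset.sum_product]
    refine Finset.sum_congr rfl fun a _ => Finset.sum_congr rfl fun b _ => ?_
    simp only [hF]
    push_cast
    rw [map_mul, mul_inv]; ring
  rw [h1, ← Finset.sum_filter_of_ne (p := fun x => x.1 * x.2 ≠ 0)]
  · rw [← Finset.sum_fiberwise_of_maps_to (t := range q) (g := fun x => x.1 * x.2)]
    · refine Finset.sum_congr rfl fun n _ => ?_
      have : ∀ x ∈ ((range (N + 1) ×ˢ range (N + 1)).filter (fun x => x.1 * x.2 ≠ 0)).filter (fun x => x.1 * x.2 = n),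
          F x = χ (n : ZMod q) * (((n:ℝ)⁻¹ : ℝ) : ℂ) * (ArithmeticFunction.moebius x.2 : ℂ) := by
        intro x hx
        have := (Finset.mem_filter.1 hx).2
        simp only [hF, this]
        push_cast; ring
      rw [Finset.sum_congr rfl this, ← Finset.mul_sum]
      have e : ((range (N + 1) ×ˢ range (N + 1)).filter (fun x => x.1 * x.2 ≠ 0)).filter (fun x => x.1 * x.2 = n)
          = n.divisorsAntidiagonal.filter (fun x => x.1 ≤ N ∧ x.2 ≤ N) := by
        ext x
        simp only [Finset.mem_filter, Finset.mem_product, Finset.mem_range, Nat.mem_divisorsAntidiagonal, Nat.lt_succ_iff]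
        constructor
        · rintro ⟨⟨h1, h2⟩, h3⟩; exact ⟨⟨h3, h3 ▸ h2⟩, h1⟩
        · rintro ⟨⟨h3, h2⟩, h1⟩; exact ⟨⟨h1, h3 ▸ h2⟩, h3⟩
      rw [e, cc]
      push_cast; ring
    · intro x hx
      simp only [Finset.mem_filter, Finset.mem_product, Finset.mem_range, Nat.lt_succ_iff] at hx ⊢
      exact lt_of_le_of_lt (Nat.mul_le_mul hx.1.1 hx.1.2) (NN_sq hq)
  · intro x _ hx h0
    apply hx
    simp only [hF, h0]; simp

lemma PM_var {q : ℕ} [NeZero q] (hq : 2 ≤ q) :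
    ∑ χ : DirichletCharacter ℂ q, ‖PP χ * MM χ - 1‖ ^ 2 ≤ q * (ell q ^ 4 / NN q) := by
  set N := NN q with hN
  have hN1 : 1 ≤ N := NN_pos hq
  have hN0 : (0:ℝ) < N := by exact_mod_cast hN1
  set e : ℕ → ℝ := fun n => if n = 1 then 0 else (cc N n : ℝ) * (n:ℝ)⁻¹ with he
  have h1 : ∀ χ : DirichletCharacter ℂ q, PP χ * MM χ - 1 = ∑ n ∈ range q, χ (n : ZMod q) * (e n : ℂ) := by
    intro χ
    rw [PM_eq (by omega), sub_eq_iff_eq_add]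
    have : ∀ n ∈ range q, χ (n : ZMod q) * (((cc N n : ℝ) * (n:ℝ)⁻¹ : ℝ) : ℂ)
        = χ (n : ZMod q) * (e n : ℂ) + if n = 1 then 1 else 0 := by
      intro n _
      by_cases h : n = 1
      · subst h; simp [he, cc_one hN1]
      · simp [he, h]
    rw [Finset.sum_congr rfl this, Finset.sum_add_distrib, Finset.sum_ite_eq']
    simp; omega
  simp_rw [h1]
  refine (parseval_le e).trans ?_
  gcongr
  rw [div_eq_inv_mul]
  refine le_trans ?_ (mul_le_mul_of_nonneg_left (sum_card_div_sq q) (by positivity))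
  rw [Finset.mul_sum]
  refine Finset.sum_le_sum fun n _ => ?_
  by_cases h : n = 1
  · simp only [he, h, if_true]; rw [zero_pow two_ne_zero]; positivity
  simp only [he, h, if_false]
  rcases Nat.eq_zero_or_pos n with h0 | h0
  · subst h0; simp
  by_cases hnN : n ≤ N
  · rw [cc_small (by omega) hnN]; simp; positivity
  · have hcb := cc_bound N n
    have hn0 : (0:ℝ) < n := by exact_mod_cast h0
    have hnN' : (N:ℝ) ≤ n := by exact_mod_cast (by omega)
    have : (cc N n : ℝ) ^ 2 ≤ (n.divisors.card : ℝ) ^ 2 := by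
      rw [← sq_abs]; gcongr
    have h3 : (n:ℝ)⁻¹ ≤ (N:ℝ)⁻¹ := by gcongr
    calc _ = (n:ℝ)⁻¹ * ((cc N n : ℝ) ^ 2 * (n:ℝ)⁻¹) := by ring
      _ ≤ _ := by gcongr

/-- Coefficients of the long tail. -/
noncomputable def tt (q n : ℕ) : ℝ := (if n ≤ NN q then 0 else (n:ℝ)⁻¹) + ∑ j ∈ Finset.Ico 1 q, ((n + j * q : ℕ):ℝ)⁻¹

lemma sum_blocks {q : ℕ} (χ : DirichletCharacter ℂ q) (J : ℕ) (hJ : 1 ≤ J) :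
    ∑ n ∈ range (J * q), χ (n : ZMod q) * (((n:ℝ)⁻¹ : ℝ) : ℂ)
      = ∑ n ∈ range q, χ (n : ZMod q) * (((n:ℝ)⁻¹ + ∑ j ∈ Finset.Ico 1 J, ((n + j * q : ℕ):ℝ)⁻¹ : ℝ) : ℂ) := by
  induction J, hJ using Nat.le_induction with
  | base => simp
  | succ J hJ ih =>
    rw [Nat.succ_mul, Finset.sum_range_add, ih, ← Finset.sum_add_distrib]
    refine Finset.sum_congr rfl fun n _ => ?_
    rw [Finset.sum_Ico_succ_top hJ]
    have : ((J * q + n : ℕ) : ZMod q) = n := by simp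
    rw [this, ← mul_add, ← Complex.ofReal_add, add_assoc, add_comm (J * q) n]

lemma tail_eq {q : ℕ} (hq : 2 ≤ q) (χ : DirichletCharacter ℂ q) :
    ∑ n ∈ range (q * q), χ (n : ZMod q) * (((n:ℝ)⁻¹ : ℝ) : ℂ) - PP χ
      = ∑ n ∈ range q, χ (n : ZMod q) * (tt q n : ℂ) := by
  have hNq : NN q + 1 ≤ q := by
    have := NN_sq (q := q) (by omega)
    have : NN q ≤ NN q * NN q := Nat.le_mul_self _
    omega
  have h1 : PP χ = ∑ n ∈ range q, χ (n : ZMod q) * (((if n ≤ NN q then (n:ℝ)⁻¹ else 0) : ℝ) : ℂ) := by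
    rw [← Finset.sum_range_add_sum_Ico _ hNq, PP]
    rw [Finset.sum_eq_zero (s := Finset.Ico _ _), add_zero]
    · refine Finset.sum_congr rfl fun n hn => ?_
      rw [if_pos (by simpa [Nat.lt_succ_iff] using hn)]
    · intro n hn
      rw [if_neg (by rw [Finset.mem_Ico] at hn; omega)]; simp
  rw [sum_blocks χ q (by omega), h1, ← Finset.sum_sub_distrib]
  refine Finset.sum_congr rfl fun n _ => ?_
  rw [← mul_sub, ← Complex.ofReal_sub]
  congr 2
  unfold tt
  split_ifs <;> ring

lemma tt_bound {q : ℕ} (hq : 2 ≤ q) (n : ℕ) : tt q n ^ 2 ≤ 2 * ((NN q : ℝ)⁻¹ * (n:ℝ)⁻¹) + 2 * (ell q / q) ^ 2 := by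
  have hq0 : (0:ℝ) < q := by exact_mod_cast (by omega)
  have h2 : ∑ j ∈ Finset.Ico 1 q, ((n + j * q : ℕ):ℝ)⁻¹ ≤ ell q / q := by
    calc _ ≤ ∑ j ∈ Finset.Ico 1 q, (j:ℝ)⁻¹ * (q:ℝ)⁻¹ := by
          refine Finset.sum_le_sum fun j hj => ?_
          have hj0 : (0:ℝ) < j := by exact_mod_cast (Finset.mem_Ico.1 hj).1
          rw [← mul_inv]
          have : (0:ℝ) < j * q := by positivity
          gcongr
          push_cast
          have : (0:ℝ) ≤ n := by positivity
          linarith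
      _ = (∑ j ∈ Finset.Ico 1 q, (j:ℝ)⁻¹) * (q:ℝ)⁻¹ := by rw [Finset.sum_mul]
      _ ≤ ell q * (q:ℝ)⁻¹ := by
          gcongr
          refine le_trans ?_ (harm_bound' q)
          exact Finset.sum_le_sum_of_subset_of_nonneg (by intro j; simp) fun j _ _ => by positivity
      _ = _ := by ring
  have h20 : 0 ≤ ∑ j ∈ Finset.Ico 1 q, ((n + j * q : ℕ):ℝ)⁻¹ := Finset.sum_nonneg fun j _ => by positivity
  have h1 : (if n ≤ NN q then (0:ℝ) else (n:ℝ)⁻¹) ^ 2 ≤ (NN q : ℝ)⁻¹ * (n:ℝ)⁻¹ := by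
    split_ifs with h
    · simp; positivity
    · rw [pow_two]
      have : (0:ℝ) < NN q := by exact_mod_cast NN_pos hq
      have : (NN q : ℝ) ≤ n := by exact_mod_cast (by omega)
      gcongr
  have h3 : (∑ j ∈ Finset.Ico 1 q, ((n + j * q : ℕ):ℝ)⁻¹) ^ 2 ≤ (ell q / q) ^ 2 := by gcongr
  unfold tt
  refine (add_sq_le).trans ?_
  linarith

lemma T_var {q : ℕ} [NeZero q] (hq : 2 ≤ q) :
    ∑ χ : DirichletCharacter ℂ q, ‖∑ n ∈ range (q * q), χ (n : ZMod q) * (((n:ℝ)⁻¹ : ℝ) : ℂ) - PP χ‖ ^ 2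
      ≤ q * (4 * ell q ^ 2 / NN q) := by
  have hq0 : (0:ℝ) < q := by exact_mod_cast (by omega)
  have hN0 : (0:ℝ) < NN q := by exact_mod_cast NN_pos hq
  have hNq : (NN q : ℝ) ≤ q := by
    have := NN_sq (q := q) (by omega)
    have : NN q ≤ NN q * NN q := Nat.le_mul_self _
    exact_mod_cast (by omega)
  have hl := one_le_ell q
  simp_rw [tail_eq hq]
  refine (parseval_le _).trans ?_
  gcongr
  refine (Finset.sum_le_sum fun n _ => tt_bound hq n).trans ?_
  rw [Finset.sum_add_distrib, ← Finset.mul_sum, ← Finset.mul_sum, Finset.sum_const, Finset.card_range, nsmul_eq_mul]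
  have h1 : (NN q:ℝ)⁻¹ * ∑ n ∈ range q, (n:ℝ)⁻¹ ≤ (NN q:ℝ)⁻¹ * ell q ^ 2 := by
    gcongr
    refine (harm_bound' q).trans ?_
    nlinarith
  have h2 : (q:ℝ) * (2 * (ell q / q) ^ 2) ≤ 2 * ((NN q:ℝ)⁻¹ * ell q ^ 2) := by
    have : (q:ℝ) * (2 * (ell q / q) ^ 2) = 2 * ((q:ℝ)⁻¹ * ell q ^ 2) := by field_simp
    rw [this]
    gcongr
  have : 4 * ell q ^ 2 / NN q = 4 * ((NN q:ℝ)⁻¹ * ell q ^ 2) := by ring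
  rw [this]; linarith

lemma LM_var {q : ℕ} [NeZero q] (hq : 2 ≤ q) (S : Finset (DirichletCharacter ℂ q)) (hS : ∀ χ ∈ S, χ ≠ 1) :
    ∑ χ ∈ S, ‖χ.LFunction 1 * MM χ - 1‖ ^ 2 ≤ q * (18 * ell q ^ 4 / NN q) := by
  have hq0 : (0:ℝ) < q := by exact_mod_cast (by omega)
  have hq2 : (2:ℝ) ≤ q := by exact_mod_cast hq
  have hN0 : (0:ℝ) < NN q := by exact_mod_cast NN_pos hq
  have hNq : (NN q : ℝ) ≤ q := by
    have := NN_sq (q := q) (by omega)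
    have : NN q ≤ NN q * NN q := Nat.le_mul_self _
    exact_mod_cast (by omega)
  have hl := one_le_ell q
  have hpt : ∀ χ ∈ S, ‖χ.LFunction 1 * MM χ - 1‖ ^ 2 ≤ 3 * ‖PP χ * MM χ - 1‖ ^ 2
      + 3 * ell q ^ 2 * ‖∑ n ∈ range (q * q), χ (n : ZMod q) * (((n:ℝ)⁻¹ : ℝ) : ℂ) - PP χ‖ ^ 2 + 3 * ell q ^ 2 * (q:ℝ)⁻¹ ^ 2 := by
    intro χ hχ
    set Z := ∑ n ∈ range (q * q), χ (n : ZMod q) * (((n:ℝ)⁻¹ : ℝ) : ℂ) with hZ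
    have hr := LFunction_approx χ (hS χ hχ) (σ := 1) (by norm_num) (by norm_num) (K := q * q) (by nlinarith)
    simp only [Real.rpow_neg_one, Complex.ofReal_one] at hr
    rw [← hZ] at hr
    have hr' : ‖χ.LFunction 1 - Z‖ ≤ (q:ℝ)⁻¹ := by
      refine hr.trans (le_of_eq ?_)
      push_cast; field_simp
    have hM := MM_bound (by omega) χ
    have e : χ.LFunction 1 * MM χ - 1 = (PP χ * MM χ - 1) + (Z - PP χ) * MM χ + (χ.LFunction 1 - Z) * MM χ := by ring
    have h1 : ‖χ.LFunction 1 * MM χ - 1‖ ≤ ‖PP χ * MM χ - 1‖ + ‖Z - PP χ‖ * ell q + (q:ℝ)⁻¹ * ell q := by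
      rw [e]
      refine (norm_add₃_le).trans ?_
      rw [norm_mul, norm_mul]
      gcongr
    set a := ‖PP χ * MM χ - 1‖
    set b := ‖Z - PP χ‖
    calc _ ≤ (a + b * ell q + (q:ℝ)⁻¹ * ell q) ^ 2 := by gcongr
      _ ≤ _ := by nlinarith [sq_nonneg (a - b * ell q), sq_nonneg (a - (q:ℝ)⁻¹ * ell q), sq_nonneg (b * ell q - (q:ℝ)⁻¹ * ell q)]
  refine (Finset.sum_le_sum hpt).trans ?_
  rw [Finset.sum_add_distrib, Finset.sum_add_distrib, ← Finset.mul_sum, ← Finset.mul_sum, Finset.sum_const, nsmul_eq_mul]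
  have h1 : ∑ χ ∈ S, ‖PP χ * MM χ - 1‖ ^ 2 ≤ q * (ell q ^ 4 / NN q) :=
    (Finset.sum_le_univ_sum_of_nonneg fun χ => by positivity).trans (PM_var hq)
  have h2 : ∑ χ ∈ S, ‖∑ n ∈ range (q * q), χ (n : ZMod q) * (((n:ℝ)⁻¹ : ℝ) : ℂ) - PP χ‖ ^ 2 ≤ q * (4 * ell q ^ 2 / NN q) :=
    (Finset.sum_le_univ_sum_of_nonneg fun χ => by positivity).trans (T_var hq)
  have hc : (S.card : ℝ) ≤ q := by
    have := Finset.card_le_univ S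
    rw [← Nat.card_eq_fintype_card, card_eq_totient_of_hasEnoughRootsOfUnity] at this
    exact_mod_cast this.trans (Nat.totient_le q)
  have h3 : (S.card : ℝ) * (3 * ell q ^ 2 * (q:ℝ)⁻¹ ^ 2) ≤ q * (3 * ell q ^ 4 / NN q) := by
    have g1 : (q:ℝ)⁻¹ ^ 2 ≤ (NN q : ℝ)⁻¹ := by
      rw [pow_two]
      have a1 : (q:ℝ)⁻¹ ≤ 1 := inv_le_one_of_one_le₀ (by linarith)
      calc (q:ℝ)⁻¹ * (q:ℝ)⁻¹ ≤ 1 * (NN q : ℝ)⁻¹ := by gcongr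
        _ = _ := one_mul _
    have g2 : ell q ^ 2 ≤ ell q ^ 4 := pow_le_pow_right₀ hl (by norm_num)
    rw [div_eq_mul_inv]
    gcongr
  have h2' : 3 * ell q ^ 2 * ∑ χ ∈ S, ‖∑ n ∈ range (q * q), χ (n : ZMod q) * (((n:ℝ)⁻¹ : ℝ) : ℂ) - PP χ‖ ^ 2
      ≤ 3 * ell q ^ 2 * (q * (4 * ell q ^ 2 / NN q)) := by gcongr
  have e : q * (18 * ell q ^ 4 / NN q) = 3 * (q * (ell q ^ 4 / NN q)) + 3 * ell q ^ 2 * (q * (4 * ell q ^ 2 / NN q))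
      + q * (3 * ell q ^ 4 / NN q) := by ring
  rw [e]; linarith

end NegMoment

namespace NegMoment

open Finset Filter Topology

lemma pt_bound {L M : ℂ} {l : ℝ} (hl : 1 ≤ l) (hM : ‖M‖ ≤ l) (hL : 1 / (2048 * l ^ 7) ≤ ‖L‖) :
    |(‖L‖ ^ 2)⁻¹ - ‖M‖ ^ 2| ≤ 10 * l ^ 2 * ‖L * M - 1‖ + 2 ^ 25 * l ^ 14 * ‖L * M - 1‖ ^ 2 := by
  set u := ‖L * M - 1‖ with hu
  have hu0 : 0 ≤ u := norm_nonneg _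
  have hL0 : 0 < ‖L‖ := lt_of_lt_of_le (by positivity) hL
  have hM0 : 0 ≤ ‖M‖ := norm_nonneg _
  rcases le_or_gt u (1/2) with h | h
  · have hw : |‖L‖ * ‖M‖ - 1| ≤ u := by
      have := abs_norm_sub_norm_le (L * M) 1
      rwa [norm_mul, norm_one] at this
    set a := ‖L‖
    set m := ‖M‖
    have hw1 := (abs_le.1 hw).1
    have hw2 := (abs_le.1 hw).2
    have hinv : (a ^ 2)⁻¹ ≤ 4 * l ^ 2 := by
      rw [inv_le_comm₀ (by positivity) (by positivity), inv_le_iff_one_le_mul₀ (by positivity)]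
      have : 1 / 2 ≤ a * l := by
        have : a * m ≤ a * l := by gcongr
        linarith
      nlinarith
    have e : (a ^ 2)⁻¹ - m ^ 2 = -((a ^ 2)⁻¹ * ((a * m - 1) * (a * m + 1))) := by
      field_simp; ring
    rw [e, abs_neg, abs_mul, abs_mul, abs_of_nonneg (show 0 ≤ (a ^ 2)⁻¹ by positivity), abs_of_nonneg (show 0 ≤ a * m + 1 by positivity)]
    calc _ ≤ 4 * l ^ 2 * (u * (5 / 2)) := by
          gcongr; linarith
      _ = 10 * l ^ 2 * u := by ring
      _ ≤ _ := by
          have : 0 ≤ 2 ^ 25 * l ^ 14 * u ^ 2 := by positivity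
          linarith
  · have h1 : (‖L‖ ^ 2)⁻¹ ≤ 2 ^ 22 * l ^ 14 := by
      rw [inv_le_comm₀ (by positivity) (by positivity)]
      calc (2 ^ 22 * l ^ 14)⁻¹ = (1 / (2048 * l ^ 7)) ^ 2 := by field_simp; norm_num
        _ ≤ _ := by gcongr
    have h2 : ‖M‖ ^ 2 ≤ 2 ^ 22 * l ^ 14 := by
      calc ‖M‖ ^ 2 ≤ l ^ 2 := by gcongr
        _ ≤ l ^ 14 := pow_le_pow_right₀ hl (by norm_num)
        _ ≤ _ := by nlinarith [pow_pos (show 0 < l by linarith) 14]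
    have h3 : |(‖L‖ ^ 2)⁻¹ - ‖M‖ ^ 2| ≤ 2 ^ 23 * l ^ 14 := by
      have : 0 ≤ (‖L‖ ^ 2)⁻¹ := by positivity
      have : 0 ≤ ‖M‖ ^ 2 := by positivity
      rw [abs_le]; constructor <;> linarith
    have h4 : (1:ℝ) / 4 ≤ u ^ 2 := by nlinarith
    have h5 : 2 ^ 23 * l ^ 14 ≤ 2 ^ 25 * l ^ 14 * u ^ 2 := by
      have : 2 ^ 23 * l ^ 14 = 2 ^ 25 * l ^ 14 * (1 / 4) := by ring
      rw [this]; gcongr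
    have : 0 ≤ 10 * l ^ 2 * u := by positivity
    linarith

lemma card_chars_le {q : ℕ} [NeZero q] (S : Finset (DirichletCharacter ℂ q)) : (S.card : ℝ) ≤ q := by
  have := Finset.card_le_univ S
  rw [← Nat.card_eq_fintype_card, card_eq_totient_of_hasEnoughRootsOfUnity] at this
  exact_mod_cast this.trans (Nat.totient_le q)

/-- Relative error. -/
noncomputable def E1 (q : ℕ) : ℝ := 18 * 2 ^ 26 * ell q ^ 18 / NN q + 10 / ell q

lemma sum_compare {q : ℕ} [NeZero q] (hq : 3 ≤ q) (S : Finset (DirichletCharacter ℂ q)) (hS : ∀ χ ∈ S, χ ^ 2 ≠ 1) :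
    |∑ χ ∈ S, (‖χ.LFunction 1‖ ^ 2)⁻¹ - ∑ χ ∈ S, ‖MM χ‖ ^ 2| ≤ q * E1 q := by
  have hl := one_le_ell q
  have hl0 : 0 < ell q := by linarith
  have hN0 : (0:ℝ) < NN q := by exact_mod_cast NN_pos (by omega)
  have hV := LM_var (q := q) (by omega) S (fun χ hχ h => hS χ hχ (by rw [h]; simp))
  rw [← Finset.sum_sub_distrib]
  refine (Finset.abs_sum_le_sum_abs _ _).trans ?_
  have hpt : ∀ χ ∈ S, |(‖χ.LFunction 1‖ ^ 2)⁻¹ - ‖MM χ‖ ^ 2| ≤ 2 ^ 26 * ell q ^ 14 * ‖χ.LFunction 1 * MM χ - 1‖ ^ 2 + 10 / ell q := by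
    intro χ hχ
    refine (pt_bound hl (MM_bound (by omega) χ) (complex_lower χ (hS χ hχ) hq)).trans ?_
    set u := ‖χ.LFunction 1 * MM χ - 1‖
    set l := ell q
    have h1 : u ≤ l ^ 3 * u ^ 2 + (l ^ 3)⁻¹ := by
      have h0 : 0 ≤ u := norm_nonneg _
      rw [← sub_nonneg]
      have : l ^ 3 * u ^ 2 + (l ^ 3)⁻¹ - u = (l ^ 3)⁻¹ * ((l ^ 3 * u - 1) ^ 2 + l ^ 3 * u) := by
        field_simp; ring
      rw [this]; positivity
    have h2 : 10 * l ^ 2 * u ≤ 10 * l ^ 5 * u ^ 2 + 10 / l := by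
      calc _ ≤ 10 * l ^ 2 * (l ^ 3 * u ^ 2 + (l ^ 3)⁻¹) := by gcongr
        _ = _ := by field_simp
    have h3 : 10 * l ^ 5 * u ^ 2 ≤ 2 ^ 25 * l ^ 14 * u ^ 2 := by
      have : l ^ 5 ≤ l ^ 14 := pow_le_pow_right₀ hl (by norm_num)
      gcongr; norm_num
    linarith
  refine (Finset.sum_le_sum hpt).trans ?_
  rw [Finset.sum_add_distrib, ← Finset.mul_sum, Finset.sum_const, nsmul_eq_mul]
  have h1 : 2 ^ 26 * ell q ^ 14 * ∑ χ ∈ S, ‖χ.LFunction 1 * MM χ - 1‖ ^ 2 ≤ 2 ^ 26 * ell q ^ 14 * (q * (18 * ell q ^ 4 / NN q)) := by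
    gcongr
  have h2 : (S.card : ℝ) * (10 / ell q) ≤ q * (10 / ell q) := by
    have := card_chars_le S
    gcongr
  have e : q * E1 q = 2 ^ 26 * ell q ^ 14 * (q * (18 * ell q ^ 4 / NN q)) + q * (10 / ell q) := by
    unfold E1; ring
  rw [e]; linarith

/-- Mollifier coefficients. -/
noncomputable def mm (q n : ℕ) : ℝ := if n ≤ NN q then (ArithmeticFunction.moebius n : ℝ) * (n:ℝ)⁻¹ else 0

lemma MM_eq {q : ℕ} [NeZero q] (hq : 2 ≤ q) (χ : DirichletCharacter ℂ q) :
    MM χ = ∑ a : ZMod q, χ a * (mm q a.val : ℂ) := by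
  have hNq : NN q + 1 ≤ q := by
    have := NN_sq (q := q) (by omega)
    have : NN q ≤ NN q * NN q := Nat.le_mul_self _
    omega
  rw [← sum_range_eq (fun a n => χ a * (mm q n : ℂ)), ← Finset.sum_range_add_sum_Ico _ hNq, MM]
  rw [Finset.sum_eq_zero (s := Finset.Ico _ _), add_zero]
  · refine Finset.sum_congr rfl fun n hn => ?_
    rw [mm, if_pos (by simpa [Nat.lt_succ_iff] using hn)]
  · intro n hn
    rw [mm, if_neg (by rw [Finset.mem_Ico] at hn; omega)]; simp

lemma mm_neg {q : ℕ} [NeZero q] (hq : 3 ≤ q) (a : ZMod q) : mm q (-a).val * mm q a.val = 0 := by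
  by_cases h0 : a = 0
  · subst h0; simp [mm]
  have hne : NeZero a := ⟨h0⟩
  have h1 := ZMod.val_neg_of_ne_zero a
  have h2 := ZMod.val_lt a
  have h3 := NN_sq (q := q) (by omega)
  unfold mm
  by_cases ha : a.val ≤ NN q
  · by_cases hb : (-a).val ≤ NN q
    · exfalso
      have : q ≤ 2 * NN q := by omega
      have hN1 : 1 ≤ NN q := NN_pos (by omega)
      have : NN q * NN q < 2 * NN q := by omega
      have : NN q < 2 := by nlinarith
      omega
    · simp [hb]
  · simp [ha]

open scoped Classical in
lemma odd_mean {q : ℕ} [NeZero q] (hq : 3 ≤ q) :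
    ∑ χ : DirichletCharacter ℂ q, (if χ.Odd then ‖MM χ‖ ^ 2 else 0)
      = (q.totient : ℝ) / 2 * ∑ n ∈ range q, (if IsUnit (n : ZMod q) then mm q n ^ 2 else 0) := by
  have h1 := parseval (q := q) (fun a => mm q a.val) (fun a => mm q a.val)
  have h2 := parseval (q := q) (fun a => mm q (-a).val) (fun a => mm q a.val)
  rw [Finset.sum_eq_zero (s := Finset.univ) (f := fun a : ZMod q => if IsUnit a then mm q (-a).val * mm q a.val else 0)
    (by intro a _; rw [mm_neg hq]; simp)] at h2
  apply Complex.ofReal_injective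
  rw [Complex.ofReal_sum]
  have hpt : ∀ χ : DirichletCharacter ℂ q, (((if χ.Odd then ‖MM χ‖ ^ 2 else 0 : ℝ)) : ℂ)
      = (1/2) * ((∑ a, χ a * (mm q a.val : ℂ)) * star (∑ b, χ b * (mm q b.val : ℂ)))
        - (1/2) * ((∑ a, χ a * (mm q (-a).val : ℂ)) * star (∑ b, χ b * (mm q b.val : ℂ))) := by
    intro χ
    have hneg : ∑ a, χ a * (mm q (-a).val : ℂ) = χ (-1) * ∑ a, χ a * (mm q a.val : ℂ) := by
      rw [Finset.mul_sum, ← Equiv.sum_comp (Equiv.neg (ZMod q))]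
      refine Finset.sum_congr rfl fun a _ => ?_
      simp only [Equiv.neg_apply, neg_neg]
      rw [← mul_assoc, ← map_mul, neg_one_mul]
    rw [hneg, ← MM_eq (by omega)]
    rcases χ.even_or_odd with he | ho
    · have : ¬ χ.Odd := by
        intro ho
        have h := he.symm.trans ho
        norm_num at h
      rw [if_neg this, he]; simp
    · rw [if_pos ho, norm_sq_ofReal, ho]; ring
  rw [Finset.sum_congr rfl fun χ _ => hpt χ, Finset.sum_sub_distrib, ← Finset.mul_sum, ← Finset.mul_sum, h1, h2]
  rw [sum_range_eq (fun a n => if IsUnit a then mm q n ^ 2 else 0)]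
  simp_rw [pow_two]
  push_cast
  ring

lemma card_real {p i : ℕ} (hp : p.Prime) (hp2 : p ≠ 2) [NeZero (p ^ i)] (S : Finset (DirichletCharacter ℂ (p ^ i)))
    (hS : ∀ χ ∈ S, χ ^ 2 = 1) : (S.card : ℝ) ≤ 2 := by
  classical
  have : IsCyclic (ZMod (p ^ i))ˣ := ZMod.isCyclic_units_of_prime_pow p hp hp2 i
  obtain ⟨e⟩ := mulEquiv_units ℂ (p ^ i)
  have hc : IsCyclic (DirichletCharacter ℂ (p ^ i)) := isCyclic_of_surjective e.symm e.symm.surjective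
  have h := IsCyclic.card_pow_eq_one_le (α := DirichletCharacter ℂ (p ^ i)) (n := 2) (by norm_num)
  have h2 : S.card ≤ 2 := by
    refine le_trans (Finset.card_le_card ?_) h
    intro χ hχ; simpa using hS χ hχ
  exact_mod_cast h2

/-- The series of squarefree numbers. -/
noncomputable def aa (n : ℕ) : ℝ := ((ArithmeticFunction.moebius n : ℝ) * (n:ℝ)⁻¹) ^ 2

lemma aa_nonneg (n : ℕ) : 0 ≤ aa n := by unfold aa; positivity

lemma summable_aa : Summable aa := by
  refine Summable.of_nonneg_of_le aa_nonneg (fun n => ?_) (Real.summable_one_div_nat_pow.2 (show 1 < 2 by norm_num))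
  unfold aa
  have := abs_mu n
  rw [mul_pow, ← sq_abs (ArithmeticFunction.moebius n : ℝ)]
  calc _ ≤ 1 ^ 2 * ((n:ℝ)⁻¹) ^ 2 := by gcongr
    _ = _ := by simp

open scoped Classical in
lemma A_bound {p i : ℕ} (hp : p.Prime) (hi : 1 ≤ i) :
    |∑ n ∈ range (p ^ i), (if IsUnit (n : ZMod (p ^ i)) then mm (p ^ i) n ^ 2 else 0) - ∑' n, aa n|
      ≤ ∑' n, aa n - ∑ n ∈ range (min (NN (p ^ i) + 1) p), aa n := by
  have h1 : ∑ n ∈ range (p ^ i), (if IsUnit (n : ZMod (p ^ i)) then mm (p ^ i) n ^ 2 else 0) ≤ ∑' n, aa n := by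
    refine le_trans (Finset.sum_le_sum fun n _ => ?_) (summable_aa.sum_le_tsum (range (p ^ i)) fun n _ => aa_nonneg n)
    have := aa_nonneg n
    split_ifs
    · unfold mm; split_ifs
      · exact le_rfl
      · simpa using this
    · exact this
  have h2 : ∑ n ∈ range (min (NN (p ^ i) + 1) p), aa n
      ≤ ∑ n ∈ range (p ^ i), (if IsUnit (n : ZMod (p ^ i)) then mm (p ^ i) n ^ 2 else 0) := by
    have hsub : range (min (NN (p ^ i) + 1) p) ⊆ range (p ^ i) := by
      intro n hn
      rw [Finset.mem_range] at hn ⊢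
      have : p ≤ p ^ i := Nat.le_self_pow (by omega) p
      have := hn.trans_le (min_le_right _ _)
      omega
    refine le_trans (Finset.sum_le_sum fun n hn => ?_) (Finset.sum_le_sum_of_subset_of_nonneg hsub fun n _ _ => ?_)
    · rcases Nat.eq_zero_or_pos n with rfl | h0
      · simp [aa, mm]
      · rw [Finset.mem_range] at hn
        have hnp := hn.trans_le (min_le_right _ _)
        have hnN := hn.trans_le (min_le_left _ _)
        have : IsUnit (n : ZMod (p ^ i)) := by
          rw [ZMod.isUnit_iff_coprime]
          exact Nat.Coprime.pow_right _ (Nat.coprime_of_lt_prime (by omega) hnp hp).symm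
        rw [if_pos this, mm, if_pos (by omega), aa]
    · split_ifs <;> positivity
  rw [abs_le]; constructor <;> linarith

lemma NN_ge (q : ℕ) (hq : 2 ≤ q) : (q:ℝ) ^ (1/2:ℝ) ≤ 2 * NN q := by
  have h := Nat.sqrt_lt'.1 (Nat.lt_succ_self (Nat.sqrt (q - 1)))
  have hN := NN_pos hq
  change q - 1 < (NN q + 1) ^ 2 at h
  have : q ≤ (2 * NN q) ^ 2 := by nlinarith [Nat.sub_add_cancel (show 1 ≤ q by omega)]
  rw [← Real.sqrt_eq_rpow]
  apply Real.sqrt_le_iff.2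
  constructor
  · positivity
  · exact_mod_cast this

lemma tendsto_ell_pow (n : ℕ) {r : ℝ} (hr : 0 < r) :
    Tendsto (fun q : ℕ => ell q ^ n / (q:ℝ) ^ r) atTop (𝓝 0) := by
  have h := (isLittleO_log_rpow_rpow_atTop (n:ℝ) hr).tendsto_div_nhds_zero
  have h2 := (h.const_mul ((2:ℝ)^n)).comp tendsto_natCast_atTop_atTop
  rw [mul_zero] at h2
  refine squeeze_zero' (Eventually.of_forall fun q => ?_) ?_ h2
  · have := one_le_ell q
    positivity
  · filter_upwards [(Real.tendsto_log_atTop.comp tendsto_natCast_atTop_atTop).eventually_ge_atTop 1] with q hq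
    simp only [Function.comp] at hq ⊢
    rw [Real.rpow_natCast, ← mul_div_assoc, ← mul_pow]
    have := one_le_ell q
    gcongr
    unfold ell; linarith

lemma tendsto_E1 : Tendsto (fun q : ℕ => E1 q + 2 * ell q ^ 2 / q) atTop (𝓝 0) := by
  have h1 := (tendsto_ell_pow 18 (r := 1/2) (by norm_num)).const_mul (2 * (18 * 2 ^ 26))
  have h2 : Tendsto (fun q : ℕ => 10 / ell q) atTop (𝓝 0) := by
    refine Tendsto.div_atTop tendsto_const_nhds ?_
    exact tendsto_atTop_add_const_left _ _ (Real.tendsto_log_atTop.comp tendsto_natCast_atTop_atTop)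
  have h3 := (tendsto_ell_pow 2 (r := 1) (by norm_num)).const_mul 2
  have h := (h1.add h2).add h3
  simp only [mul_zero, add_zero] at h
  refine squeeze_zero' (Eventually.of_forall fun q => ?_) ?_ h
  · have := one_le_ell q
    unfold E1; positivity
  · filter_upwards [eventually_ge_atTop 2] with q hq
    have hN0 : (0:ℝ) < NN q := by exact_mod_cast NN_pos hq
    have hq0 : (0:ℝ) < q := by exact_mod_cast (by omega)
    have hN := NN_ge q hq
    have hl := one_le_ell q
    unfold E1
    rw [Real.rpow_one, mul_div_assoc 2]
    gcongr
    rw [div_le_iff₀ hN0]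
    have : (0:ℝ) < (q:ℝ) ^ (1/2:ℝ) := by positivity
    have e : 2 * (18 * 2 ^ 26) * (ell q ^ 18 / (q:ℝ) ^ (1/2:ℝ)) * NN q = 18 * 2 ^ 26 * ell q ^ 18 * ((2 * NN q) / (q:ℝ) ^ (1/2:ℝ)) := by ring
    rw [e]
    refine le_mul_of_one_le_right (by positivity) ?_
    rw [le_div_iff₀ this]; linarith

open scoped Classical in
lemma core {η : ℝ} (hη : 0 < η) : ∃ P0 : ℕ, ∀ (p i : ℕ) [NeZero (p ^ i)], p.Prime → P0 ≤ p → 1 ≤ i →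
    |∑ χ : DirichletCharacter ℂ (p ^ i), (if χ.Odd ∧ χ ^ 2 ≠ 1 then (‖χ.LFunction 1‖ ^ 2)⁻¹ else 0)
      - (∑' n, aa n) / 2 * ((p ^ i : ℕ) : ℝ)| ≤ η * ((p ^ i : ℕ) : ℝ) := by
  set c := ∑' n, aa n with hc
  have hc0 : 0 ≤ c := tsum_nonneg aa_nonneg
  have t1 := tendsto_E1.eventually_le_const (show 0 < η / 3 by positivity)
  have t2 : Tendsto (fun R => c - ∑ n ∈ range R, aa n) atTop (𝓝 0) := by
    have := summable_aa.hasSum.tendsto_sum_nat.const_sub c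
    simpa [hc] using this
  have t3 := t2.eventually_le_const (show 0 < η / 3 by positivity)
  have t4 : Tendsto (fun p : ℕ => c / 2 / (p:ℝ)) atTop (𝓝 0) := tendsto_const_nhds.div_atTop tendsto_natCast_atTop_atTop
  have t5 := t4.eventually_le_const (show 0 < η / 3 by positivity)
  obtain ⟨Q1, hQ1⟩ := eventually_atTop.1 t1
  obtain ⟨R0, hR0⟩ := eventually_atTop.1 t3
  obtain ⟨P1, hP1⟩ := eventually_atTop.1 t5
  refine ⟨3 + Q1 + (R0 ^ 2 + R0 + 1) + P1, fun p i _ hp hpP hi => ?_⟩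
  set q := p ^ i with hq
  have hpq : p ≤ q := Nat.le_self_pow (by omega) p
  have hq3 : 3 ≤ q := by omega
  have hq0 : (0:ℝ) < q := by exact_mod_cast (by omega)
  have hp0 : (0:ℝ) < p := by exact_mod_cast hp.pos
  set S : Finset (DirichletCharacter ℂ q) := Finset.univ.filter (fun χ => χ.Odd ∧ χ ^ 2 ≠ 1) with hS
  have g1 := sum_compare hq3 S (fun χ hχ => (Finset.mem_filter.1 hχ).2.2)
  have g2 := odd_mean (q := q) hq3
  have g3 := A_bound (p := p) (i := i) hp hi
  rw [← hq, ← hc] at g3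
  have g3' : |∑ n ∈ range q, (if IsUnit (n : ZMod q) then mm q n ^ 2 else 0) - c| ≤ η / 3 := by
    have hmin : R0 ≤ min (NN q + 1) p := by
      have : R0 ≤ NN q := by
        unfold NN; rw [Nat.le_sqrt']; omega
      rw [le_min_iff]; constructor <;> omega
    have hR := hR0 _ hmin
    have g3'' : |∑ n ∈ range q, (if IsUnit (n : ZMod q) then mm q n ^ 2 else 0) - c|
        ≤ c - ∑ n ∈ range (min (NN q + 1) p), aa n := by
      convert g3
    linarith
  set A := ∑ n ∈ range q, (if IsUnit (n : ZMod q) then mm q n ^ 2 else 0) with hA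
  -- split odd sum
  set S' : Finset (DirichletCharacter ℂ q) := Finset.univ.filter (fun χ => χ.Odd ∧ χ ^ 2 = 1) with hS'
  have g4 : ∑ χ : DirichletCharacter ℂ q, (if χ.Odd then ‖MM χ‖ ^ 2 else 0) = ∑ χ ∈ S, ‖MM χ‖ ^ 2 + ∑ χ ∈ S', ‖MM χ‖ ^ 2 := by
    rw [hS, hS', Finset.sum_filter, Finset.sum_filter, ← Finset.sum_add_distrib]
    refine Finset.sum_congr rfl fun χ _ => ?_
    by_cases h1 : χ.Odd <;> by_cases h2 : χ ^ 2 = 1 <;> simp [h1, h2]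
  have g5 : ∑ χ ∈ S', ‖MM χ‖ ^ 2 ≤ 2 * ell q ^ 2 := by
    have hcard := card_real (p := p) (i := i) hp (by omega) S' (fun χ hχ => (Finset.mem_filter.1 hχ).2.2)
    calc _ ≤ ∑ χ ∈ S', ell q ^ 2 := by
          refine Finset.sum_le_sum fun χ _ => ?_
          have := MM_bound (by omega) χ
          gcongr
      _ = S'.card * ell q ^ 2 := by rw [Finset.sum_const, nsmul_eq_mul]
      _ ≤ _ := by gcongr
  have g5' : 0 ≤ ∑ χ ∈ S', ‖MM χ‖ ^ 2 := Finset.sum_nonneg fun _ _ => by positivity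
  have hphi : (q.totient : ℝ) = q * (1 - 1 / p) := by
    rw [hq, Nat.totient_prime_pow hp hi]
    have e : p ^ i = p ^ (i - 1) * p := by rw [← pow_succ]; congr 1; omega
    rw [e]
    push_cast [hp.one_le]
    field_simp
  have hphi0 : (0:ℝ) ≤ q.totient := by positivity
  have hphiq : (q.totient : ℝ) ≤ q := by exact_mod_cast Nat.totient_le q
  have g6 : |(q.totient : ℝ) / 2 * A - c / 2 * q| ≤ q / 2 * (η / 3) + q * (c / 2 / p) := by
    have e : (q.totient : ℝ) / 2 * A - c / 2 * q = (q.totient : ℝ) / 2 * (A - c) + -(q * (c / 2 / p)) := by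
      rw [hphi]; field_simp; ring
    rw [e]
    refine (abs_add_le _ _).trans ?_
    rw [abs_neg, abs_of_nonneg (show 0 ≤ q * (c / 2 / p) by positivity), abs_mul, abs_of_nonneg (show 0 ≤ (q.totient : ℝ) / 2 by positivity)]
    gcongr
  have g7 := hP1 p (by omega)
  have g8 := hQ1 q (by omega)
  rw [← Finset.sum_filter]
  rw [g4] at g2
  have g9 : q * E1 q + 2 * ell q ^ 2 ≤ q * (η / 3) := by
    calc _ = q * (E1 q + 2 * ell q ^ 2 / q) := by field_simp
      _ ≤ _ := by gcongr
  have g10 : q * (c / 2 / p) ≤ q * (η / 3) := by gcongr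
  rw [abs_le] at g1 g6 ⊢
  rw [← g2] at g6
  have : 0 ≤ q * (η / 3) := by positivity
  constructor <;> linarith [g1.1, g1.2, g6.1, g6.2]

end NegMoment

namespace NegMoment
open Finset Filter Topology

lemma aa_prime_pow {p : ℕ} (hp : p.Prime) : ∑' e, aa (p ^ e) = 1 + ((p:ℝ) ^ 2)⁻¹ := by
  rw [tsum_eq_sum (s := range 2)]
  · rw [Finset.sum_range_succ, Finset.sum_range_one]
    unfold aa
    rw [pow_one, pow_zero, ArithmeticFunction.moebius_apply_prime hp]
    simp
  · intro e he
    have : 2 ≤ e := by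
      have : 1 < e := by simpa using he
      omega
    unfold aa
    rw [ArithmeticFunction.moebius_apply_prime_pow hp (by omega), if_neg (by omega)]
    simp

lemma zeta_hasProd (m : ℕ) (hm : 2 ≤ m) :
    HasProd (fun p : Nat.Primes => (1 - (((p:ℕ):ℂ) ^ m)⁻¹)⁻¹) (riemannZeta m) := by
  have := riemannZeta_eulerProduct_hasProd (s := (m:ℂ)) (by simp; omega)
  convert this using 4 with p
  rw [Complex.cpow_neg, Complex.cpow_natCast]

lemma zeta_ratio : ((∑' n, aa n : ℝ) : ℂ) * riemannZeta 4 = riemannZeta 2 := by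
  have h : HasProd (fun p : Nat.Primes => ∑' e, aa ((p:ℕ) ^ e)) (∑' n, aa n) := by
    refine EulerProduct.eulerProduct_hasProd (f := aa) ?_ ?_ ?_ ?_
    · simp [aa]
    · intro m n hmn
      unfold aa
      rw [ArithmeticFunction.isMultiplicative_moebius.map_mul_of_coprime hmn]
      push_cast
      rw [mul_inv]; ring
    · simpa [Real.norm_eq_abs, abs_of_nonneg (aa_nonneg _)] using summable_aa
    · simp [aa]
  have h' : HasProd (fun p : Nat.Primes => ((∑' e, aa ((p:ℕ) ^ e) : ℝ) : ℂ)) ((∑' n, aa n : ℝ) : ℂ) :=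
    h.map Complex.ofRealHom Complex.continuous_ofReal
  have h4 := zeta_hasProd 4 (by norm_num)
  have h2 := zeta_hasProd 2 (by norm_num)
  have := h'.mul h4
  push_cast at h2
  rw [show ((4:ℕ):ℂ) = 4 by norm_num] at this
  refine this.unique ?_
  convert h2 using 2 with p
  have hp := p.2
  have hp0 : ((p:ℕ):ℂ) ≠ 0 := by exact_mod_cast hp.ne_zero
  have e := aa_prime_pow hp
  have e2 : ((∑' e, aa ((p:ℕ) ^ e) : ℝ) : ℂ) = 1 + (((p:ℕ):ℂ) ^ 2)⁻¹ := by
    rw [e]; push_cast; rfl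
  have n2 : ((p:ℕ):ℂ) ^ 2 - 1 ≠ 0 := by
    have : ((p:ℕ):ℂ) ^ 2 ≠ 1 := by
      have := Nat.one_lt_pow (n := 2) (by norm_num) hp.one_lt
      exact_mod_cast this.ne'
    exact sub_ne_zero.2 this
  have n4 : ((p:ℕ):ℂ) ^ 4 - 1 ≠ 0 := by
    have : ((p:ℕ):ℂ) ^ 4 ≠ 1 := by
      have := Nat.one_lt_pow (n := 4) (by norm_num) hp.one_lt
      exact_mod_cast this.ne'
    exact sub_ne_zero.2 this
  rw [e2]
  have f2 : (1 - (((p:ℕ):ℂ) ^ 2)⁻¹)⁻¹ = ((p:ℕ):ℂ) ^ 2 / (((p:ℕ):ℂ) ^ 2 - 1) := by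
    field_simp
  have f4 : (1 - (((p:ℕ):ℂ) ^ 4)⁻¹)⁻¹ = ((p:ℕ):ℂ) ^ 4 / (((p:ℕ):ℂ) ^ 4 - 1) := by
    field_simp
  rw [f2, f4]
  field_simp
  ring

lemma const_eq : (riemannZeta 2 / (2 * riemannZeta 4)).re = (∑' n, aa n) / 2 := by
  have h4 : riemannZeta 4 ≠ 0 := riemannZeta_ne_zero_of_one_lt_re (by norm_num)
  have e : riemannZeta 2 / (2 * riemannZeta 4) = (((∑' n, aa n) / 2 : ℝ) : ℂ) := by
    rw [← zeta_ratio, Complex.ofReal_div, Complex.ofReal_ofNat]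
    field_simp
  rw [e, Complex.ofReal_re]

lemma c_pos : 1 ≤ ∑' n, aa n := by
  have := summable_aa.le_tsum 1 (fun n _ => aa_nonneg n)
  simpa [aa] using this

end NegMoment

namespace NegMoment
open Finset Filter Topology

lemma odd_changeLevel {m n : ℕ} (h : m ∣ n) (ψ : DirichletCharacter ℂ m) :
    (changeLevel h ψ).Odd ↔ ψ.Odd := by
  unfold DirichletCharacter.Odd
  have := changeLevel_eq_cast_of_dvd ψ h (-1)
  rw [Units.val_neg, Units.val_one, ZMod.cast_neg h, ZMod.cast_one h] at this
  rw [this]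

lemma L_changeLevel {p i k : ℕ} [NeZero (p ^ i)] [NeZero (p ^ k)] (hp : p.Prime) (hi : 1 ≤ i) (hik : p ^ i ∣ p ^ k)
    (ψ : DirichletCharacter ℂ (p ^ i)) (hψ : ψ ≠ 1) :
    (changeLevel hik ψ).LFunction 1 = ψ.LFunction 1 := by
  rw [LFunction_changeLevel hik ψ (.inl hψ), Finset.prod_eq_one, mul_one]
  intro r hr
  have hrp : r = p := by
    have h1 := Nat.prime_of_mem_primeFactors hr
    exact (Nat.prime_dvd_prime_iff_eq h1 hp).1 (h1.dvd_of_dvd_pow (Nat.dvd_of_mem_primeFactors hr))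
  have : ψ (r : ZMod (p ^ i)) = 0 := by
    apply MulChar.map_nonunit
    rw [hrp, ZMod.isUnit_iff_coprime, Nat.coprime_pow_right_iff (by omega)]
    simpa using hp.one_lt.ne'
  rw [this]; simp

open scoped Classical in
lemma S_eq {p i k : ℕ} [NeZero (p ^ i)] [NeZero (p ^ k)] (hp : p.Prime) (hi : 1 ≤ i) (hik : i ≤ k) :
    ∑ χ : DirichletCharacter ℂ (p ^ k), (if (χ.Odd ∧ χ ^ 2 ≠ 1) ∧ χ.conductor ∣ p ^ i then (‖χ.LFunction 1‖ ^ 2)⁻¹ else 0)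
    = ∑ χ : DirichletCharacter ℂ (p ^ i), (if χ.Odd ∧ χ ^ 2 ≠ 1 then (‖χ.LFunction 1‖ ^ 2)⁻¹ else 0) := by
  have hd : p ^ i ∣ p ^ k := pow_dvd_pow p hik
  rw [← Finset.sum_filter, ← Finset.sum_filter]
  symm
  refine Finset.sum_bij (fun ψ _ => changeLevel hd ψ) ?_ ?_ ?_ ?_
  · intro ψ hψ
    rw [Finset.mem_filter] at hψ ⊢
    refine ⟨Finset.mem_univ _, ⟨(odd_changeLevel hd ψ).2 hψ.2.1, ?_⟩, ?_⟩
    · rw [← map_pow, Ne, changeLevel_eq_one_iff]; exact hψ.2.2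
    · exact conductor_dvd_of_mem_conductorSet _ (changeLevel_factorsThrough ψ hd)
  · intro a _ b _ h
    exact changeLevel_injective hd h
  · intro χ hχ
    rw [Finset.mem_filter] at hχ
    have hf : FactorsThrough χ (p ^ i) := (factorsThrough_conductor χ).mono χ hχ.2.2 hd
    have e := hf.eq_changeLevel
    refine ⟨hf.χ₀, ?_, e.symm⟩
    rw [Finset.mem_filter]
    have h := hχ.2.1
    rw [e, odd_changeLevel, ← map_pow, Ne, changeLevel_eq_one_iff] at h
    exact ⟨Finset.mem_univ _, h⟩
  · intro ψ hψ
    rw [Finset.mem_filter] at hψ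
    rw [L_changeLevel hp hi hd ψ]
    rintro rfl
    exact hψ.2.2 (one_pow 2)

lemma odd_ne_one {q : ℕ} {χ : DirichletCharacter ℂ q} (h : χ.Odd) : χ ≠ 1 := by
  rintro rfl
  unfold DirichletCharacter.Odd at h
  rw [MulChar.one_apply (by simp)] at h
  norm_num at h

lemma cond_form {p k : ℕ} [NeZero (p ^ k)] (hp : p.Prime) {χ : DirichletCharacter ℂ (p ^ k)} (h : χ ≠ 1) :
    ∃ j, 1 ≤ j ∧ j ≤ k ∧ χ.conductor = p ^ j := by
  obtain ⟨j, hj, e⟩ := (Nat.dvd_prime_pow hp).1 χ.conductor_dvd_level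
  refine ⟨j, ?_, hj, e⟩
  by_contra h0
  have : j = 0 := by omega
  rw [this, pow_zero] at e
  exact h (eq_one_iff_conductor_eq_one.2 e)

lemma weight {p k : ℕ} [NeZero (p ^ k)] (hp : p.Prime) {χ : DirichletCharacter ℂ (p ^ k)} (h : χ ≠ 1) :
    ((χ.conductor:ℝ))⁻¹ = ((p:ℝ)⁻¹) ^ k +
      ∑ i ∈ Finset.Ico 1 k, (if χ.conductor ∣ p ^ i then ((p:ℝ)⁻¹) ^ i - ((p:ℝ)⁻¹) ^ (i + 1) else 0) := by
  obtain ⟨j, h1, h2, e⟩ := cond_form hp h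
  rw [e]
  simp only [Nat.pow_dvd_pow_iff_le_right hp.one_lt]
  rw [← Finset.sum_filter]
  have : (Finset.Ico 1 k).filter (fun i => j ≤ i) = Finset.Ico j k := by
    ext i; simp only [Finset.mem_filter, Finset.mem_Ico]; omega
  rw [this]
  have t := Finset.sum_Ico_sub (fun i => ((p:ℝ)⁻¹) ^ i) h2
  have t' : ∑ i ∈ Finset.Ico j k, (((p:ℝ)⁻¹) ^ i - ((p:ℝ)⁻¹) ^ (i + 1)) = ((p:ℝ)⁻¹) ^ j - ((p:ℝ)⁻¹) ^ k := by
    rw [← neg_sub (((p:ℝ)⁻¹) ^ k), ← t, ← Finset.sum_neg_distrib]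
    exact Finset.sum_congr rfl fun i _ => by ring
  rw [t']; push_cast; rw [inv_pow]; ring

open scoped Classical in
lemma T_eq {p k : ℕ} [NeZero (p ^ k)] (hp : p.Prime) (S : ℕ → ℝ) (hk : 1 ≤ k)
    (hS : ∀ i, 1 ≤ i → i ≤ k → ∑ χ : DirichletCharacter ℂ (p ^ k), (if (χ.Odd ∧ χ ^ 2 ≠ 1) ∧ χ.conductor ∣ p ^ i then (‖χ.LFunction 1‖ ^ 2)⁻¹ else 0) = S i) :
    ∑ χ : DirichletCharacter ℂ (p ^ k), (if χ.Odd ∧ χ ^ 2 ≠ 1 then 1 / ((χ.conductor:ℝ) * ‖χ.LFunction 1‖ ^ 2) else 0)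
    = ((p:ℝ)⁻¹) ^ k * S k + ∑ i ∈ Finset.Ico 1 k, (((p:ℝ)⁻¹) ^ i - ((p:ℝ)⁻¹) ^ (i + 1)) * S i := by
  have e : ∀ i ∈ Finset.Ico 1 k, (((p:ℝ)⁻¹) ^ i - ((p:ℝ)⁻¹) ^ (i + 1)) * S i =
      ∑ χ : DirichletCharacter ℂ (p ^ k), (((p:ℝ)⁻¹) ^ i - ((p:ℝ)⁻¹) ^ (i + 1)) * (if (χ.Odd ∧ χ ^ 2 ≠ 1) ∧ χ.conductor ∣ p ^ i then (‖χ.LFunction 1‖ ^ 2)⁻¹ else 0) := by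
    intro i hi
    rw [Finset.mem_Ico] at hi
    rw [← hS i hi.1 hi.2.le, Finset.mul_sum]
  rw [Finset.sum_congr rfl e, Finset.sum_comm, ← hS k hk le_rfl, Finset.mul_sum, ← Finset.sum_add_distrib]
  refine Finset.sum_congr rfl fun χ _ => ?_
  by_cases h : χ.Odd ∧ χ ^ 2 ≠ 1
  · have hw := weight hp (odd_ne_one h.1)
    simp only [h, true_and, χ.conductor_dvd_level, if_true, ne_eq, not_false_eq_true, and_self]
    rw [one_div, mul_inv, hw, add_mul, Finset.sum_mul]
    congr 1
    refine Finset.sum_congr rfl fun i _ => ?_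
    split_ifs <;> simp
  · simp [h]

lemma final_bound {p k : ℕ} {c η : ℝ} (hp : 1 ≤ p) (hk : 1 ≤ k) (hη : 0 ≤ η) (S : ℕ → ℝ)
    (hS : ∀ i, 1 ≤ i → i ≤ k → |S i - c * (p:ℝ) ^ i| ≤ η * (p:ℝ) ^ i) :
    |((p:ℝ)⁻¹) ^ k * S k + ∑ i ∈ Finset.Ico 1 k, (((p:ℝ)⁻¹) ^ i - ((p:ℝ)⁻¹) ^ (i + 1)) * S i
      - c * (1 + ((k:ℝ) - 1) * (1 - (p:ℝ)⁻¹))| ≤ η * k := by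
  have hp0 : (0:ℝ) < p := by exact_mod_cast hp
  have hx0 : (0:ℝ) < (p:ℝ)⁻¹ := by positivity
  have hx1 : (p:ℝ)⁻¹ ≤ 1 := inv_le_one_of_one_le₀ (by exact_mod_cast hp)
  have hxp : ∀ i : ℕ, ((p:ℝ)⁻¹) ^ i * (p:ℝ) ^ i = 1 := fun i => by
    rw [← mul_pow, inv_mul_cancel₀ hp0.ne', one_pow]
  set x := (p:ℝ)⁻¹ with hx
  have e : c * (1 + ((k:ℝ) - 1) * (1 - x)) = x ^ k * (c * (p:ℝ) ^ k) + ∑ i ∈ Finset.Ico 1 k, (x ^ i - x ^ (i + 1)) * (c * (p:ℝ) ^ i) := by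
    have : ∀ i ∈ Finset.Ico 1 k, (x ^ i - x ^ (i + 1)) * (c * (p:ℝ) ^ i) = c * (1 - x) := fun i _ => by
      linear_combination c * (1 - x) * hxp i
    rw [Finset.sum_congr rfl this, Finset.sum_const, Nat.card_Ico, nsmul_eq_mul, Nat.cast_sub hk, Nat.cast_one]
    linear_combination -c * hxp k
  rw [e]
  have e2 : x ^ k * S k + ∑ i ∈ Finset.Ico 1 k, (x ^ i - x ^ (i + 1)) * S i -
      (x ^ k * (c * (p:ℝ) ^ k) + ∑ i ∈ Finset.Ico 1 k, (x ^ i - x ^ (i + 1)) * (c * (p:ℝ) ^ i)) =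
      x ^ k * (S k - c * (p:ℝ) ^ k) + ∑ i ∈ Finset.Ico 1 k, (x ^ i - x ^ (i + 1)) * (S i - c * (p:ℝ) ^ i) := by
    simp only [mul_sub, Finset.sum_sub_distrib]; ring
  rw [e2]
  have b1 : |x ^ k * (S k - c * (p:ℝ) ^ k)| ≤ η := by
    rw [abs_mul, abs_of_pos (pow_pos hx0 k)]
    calc _ ≤ x ^ k * (η * (p:ℝ) ^ k) := by gcongr; exact hS k hk le_rfl
      _ = η := by linear_combination η * hxp k
  have b2 : |∑ i ∈ Finset.Ico 1 k, (x ^ i - x ^ (i + 1)) * (S i - c * (p:ℝ) ^ i)| ≤ ∑ i ∈ Finset.Ico 1 k, η := by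
    refine (Finset.abs_sum_le_sum_abs _ _).trans (Finset.sum_le_sum fun i hi => ?_)
    rw [Finset.mem_Ico] at hi
    have hd : 0 ≤ x ^ i - x ^ (i + 1) := by
      rw [pow_succ]; nlinarith [pow_pos hx0 i]
    rw [abs_mul, abs_of_nonneg hd]
    calc _ ≤ (x ^ i - x ^ (i + 1)) * (η * (p:ℝ) ^ i) := by gcongr; exact hS i hi.1 hi.2.le
      _ = η * (1 - x) := by linear_combination η * (1 - x) * hxp i
      _ ≤ η := by nlinarith
  rw [Finset.sum_const, Nat.card_Ico, nsmul_eq_mul, Nat.cast_sub hk, Nat.cast_one] at b2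
  refine (abs_add_le _ _).trans ?_
  linarith

open scoped Classical in
lemma real_part : ∃ Q : ℕ, ∀ (p k : ℕ) [NeZero (p ^ k)], p.Prime → p ≠ 2 → Q ≤ p ^ k →
    (∀ χ : DirichletCharacter ℂ (p ^ k), χ ≠ 1 → ∀ β : ℝ, 1 - 1 / Real.log (p ^ k : ℕ) ≤ β → χ.LFunction (β:ℂ) ≠ 0) →
    ∑ χ : DirichletCharacter ℂ (p ^ k), (if χ.Odd ∧ χ ^ 2 = 1 then 1 / ((χ.conductor:ℝ) * ‖χ.LFunction 1‖ ^ 2) else 0)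
      ≤ 8 * Real.exp 5 ^ 2 * ((k:ℝ) ^ 2 * Real.log p ^ 2 / p) := by
  obtain ⟨Q, hQ⟩ := real_lower
  refine ⟨Q, fun p k _ hp hp2 hq hz => ?_⟩
  have hp0 : (0:ℝ) < p := by exact_mod_cast hp.pos
  rw [← Finset.sum_filter]
  have hcard := card_real (p := p) (i := k) hp hp2 (Finset.univ.filter (fun χ : DirichletCharacter ℂ (p ^ k) => χ.Odd ∧ χ ^ 2 = 1))
    (fun χ hχ => (Finset.mem_filter.1 hχ).2.2)
  calc _ ≤ ∑ χ ∈ Finset.univ.filter (fun χ : DirichletCharacter ℂ (p ^ k) => χ.Odd ∧ χ ^ 2 = 1),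
        4 * Real.exp 5 ^ 2 * ((k:ℝ) ^ 2 * Real.log p ^ 2 / p) := by
        refine Finset.sum_le_sum fun χ hχ => ?_
        rw [Finset.mem_filter] at hχ
        have h1 := odd_ne_one hχ.2.1
        obtain ⟨hl, hL⟩ := hQ (p ^ k) χ hq h1 hχ.2.2 (hz χ h1)
        obtain ⟨j, hj, hjk, e⟩ := cond_form hp h1
        have hf : (p:ℝ) ≤ χ.conductor := by
          rw [e]; exact_mod_cast Nat.le_self_pow (by omega) p
        have hlog : Real.log ((p ^ k : ℕ):ℝ) = k * Real.log p := by
          push_cast; rw [Real.log_pow]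
        calc _ ≤ 1 / ((p:ℝ) * (1 / (2 * Real.exp 5 * Real.log ((p ^ k : ℕ):ℝ))) ^ 2) := by gcongr
          _ = _ := by
            rw [hlog] at hl ⊢
            field_simp
            ring
    _ = _ * (4 * Real.exp 5 ^ 2 * ((k:ℝ) ^ 2 * Real.log p ^ 2 / p)) := by
        rw [Finset.sum_const, nsmul_eq_mul]
    _ ≤ 2 * (4 * Real.exp 5 ^ 2 * ((k:ℝ) ^ 2 * Real.log p ^ 2 / p)) := by gcongr
    _ = _ := by ring

end NegMoment

open scoped Classical in
/-- Let `q = p^k` (`p` prime, `k ≥ 1`) and assume no exceptional zero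
(with respect to the zero-free-region constant `c0`). In the regime `k = o(p/(log p)⁴)`
(as `q → ∞`), `Σ_{χ odd} (f_χ |L(1,χ)|²)⁻¹ = (ζ(2)/(2ζ(4))) ((p−1)²/(p²+1)) k (1+o(1))`. -/
theorem negative_square_moment_odd_with_conductor :
    ∃ c0 > (0 : ℝ), ∀ ε > (0 : ℝ), ∃ δ > (0 : ℝ), ∃ Q : ℕ,
      ∀ (p k : ℕ) (hp : p.Prime) (_hk : 1 ≤ k),
        haveI : NeZero (p ^ k) := ⟨pow_ne_zero k hp.ne_zero⟩
        (∀ χ : DirichletCharacter ℂ (p ^ k), χ ≠ 1 → ∀ β : ℝ,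
            1 - c0 / Real.log (p ^ k : ℕ) ≤ β → χ.LFunction (β : ℂ) ≠ 0) →
        (k : ℝ) ≤ δ * p / (Real.log p) ^ 4 → Q ≤ p ^ k →
        |(∑ χ : DirichletCharacter ℂ (p ^ k),
            if χ.Odd then 1 / ((χ.conductor : ℝ) * ‖χ.LFunction 1‖ ^ 2) else 0) -
          (riemannZeta 2 / (2 * riemannZeta 4)).re *
            (((p : ℝ) - 1) ^ 2 / ((p : ℝ) ^ 2 + 1)) * k| ≤
        ε * ((riemannZeta 2 / (2 * riemannZeta 4)).re *
            (((p : ℝ) - 1) ^ 2 / ((p : ℝ) ^ 2 + 1)) * k) := by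
  refine ⟨1, one_pos, fun ε hε => ?_⟩
  set c := ∑' n, NegMoment.aa n with hc
  have hc1 : 1 ≤ c := NegMoment.c_pos
  obtain ⟨P0, hP0⟩ := NegMoment.core (η := ε * c / 12) (by positivity)
  obtain ⟨Q, hQ⟩ := NegMoment.real_part
  obtain ⟨P1, hP1⟩ := exists_nat_ge (12 / ε)
  have hlog2 : 0 < Real.log 2 := Real.log_pos (by norm_num)
  set PP0 : ℕ := 4 + P0 + P1 with hPP
  set δ : ℝ := min (ε * c / (12 * (8 * Real.exp 5 ^ 2))) (Real.log 2 ^ 4 / (PP0 + 1)) with hδ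
  have hδ0 : 0 < δ := by
    rw [hδ]; apply lt_min <;> positivity
  refine ⟨δ, hδ0, Q, fun p k hp hk => ?_⟩
  intro hz hkδ hq
  have hne : ∀ i, NeZero (p ^ i) := fun i => ⟨pow_ne_zero i hp.ne_zero⟩
  have hp0 : (0:ℝ) < p := by exact_mod_cast hp.pos
  have hk1 : (1:ℝ) ≤ k := by exact_mod_cast hk
  have hl2 : Real.log 2 ≤ Real.log p := Real.log_le_log (by norm_num) (by exact_mod_cast hp.two_le)
  have hlp : 0 < Real.log p := hlog2.trans_le hl2
  -- `p` is large
  have hpP : PP0 ≤ p := by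
    by_contra hlt
    push Not at hlt
    have hlt' : (p:ℝ) ≤ PP0 := by exact_mod_cast hlt.le
    have h1 : δ * p / Real.log p ^ 4 ≤ (Real.log 2 ^ 4 / (PP0 + 1)) * PP0 / Real.log 2 ^ 4 := by
      gcongr
      exact min_le_right _ _
    have h2 : (Real.log 2 ^ 4 / ((PP0:ℝ) + 1)) * PP0 / Real.log 2 ^ 4 < 1 := by
      have : (Real.log 2 ^ 4 / ((PP0:ℝ) + 1)) * PP0 / Real.log 2 ^ 4 = PP0 / (PP0 + 1) := by
        field_simp
      rw [this, div_lt_one (by positivity)]; linarith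
    linarith
  have hp4 : (4:ℝ) ≤ p := by exact_mod_cast (by omega : 4 ≤ p)
  have hp12 : 12 / ε ≤ p := hP1.trans (by exact_mod_cast (by omega : P1 ≤ p))
  have hlog1 : 1 ≤ Real.log p := by
    rw [Real.le_log_iff_exp_le hp0]
    linarith [Real.exp_one_lt_d9]
  -- the complex characters
  set S : ℕ → ℝ := fun i => ∑ χ : DirichletCharacter ℂ (p ^ i),
    (if χ.Odd ∧ χ ^ 2 ≠ 1 then (‖χ.LFunction 1‖ ^ 2)⁻¹ else 0) with hS
  have hT := NegMoment.T_eq (p := p) (k := k) hp S hk (fun i h1 h2 => NegMoment.S_eq hp h1 h2)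
  have hF := NegMoment.final_bound (p := p) (k := k) (c := c / 2) (η := ε * c / 12) hp.one_le hk (by positivity) S
    (fun i h1 _ => by
      have := hP0 p i hp (by omega) h1
      push_cast at this
      exact this)
  rw [← hT] at hF
  -- the real characters
  have hR := hQ p k hp (by omega) hq hz
  set R := ∑ χ : DirichletCharacter ℂ (p ^ k), (if χ.Odd ∧ χ ^ 2 = 1 then 1 / ((χ.conductor:ℝ) * ‖χ.LFunction 1‖ ^ 2) else 0) with hRdef
  have hR0 : 0 ≤ R := Finset.sum_nonneg fun χ _ => by split_ifs <;> positivity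
  have hsplit : (∑ χ : DirichletCharacter ℂ (p ^ k),
            if χ.Odd then 1 / ((χ.conductor : ℝ) * ‖χ.LFunction 1‖ ^ 2) else 0) =
      (∑ χ : DirichletCharacter ℂ (p ^ k), (if χ.Odd ∧ χ ^ 2 ≠ 1 then 1 / ((χ.conductor:ℝ) * ‖χ.LFunction 1‖ ^ 2) else 0)) + R := by
    rw [hRdef, ← Finset.sum_add_distrib]
    refine Finset.sum_congr rfl fun χ _ => ?_
    by_cases h1 : χ.Odd <;> by_cases h2 : χ ^ 2 = 1 <;> simp [h1, h2]
  rw [hsplit, NegMoment.const_eq, ← hc]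
  set T := ∑ χ : DirichletCharacter ℂ (p ^ k), (if χ.Odd ∧ χ ^ 2 ≠ 1 then 1 / ((χ.conductor:ℝ) * ‖χ.LFunction 1‖ ^ 2) else 0) with hTdef
  have hRb : R ≤ ε * c / 12 * k := by
    have a1 : (k:ℝ) * Real.log p ^ 2 / p ≤ δ := by
      rw [le_div_iff₀ (by positivity)] at hkδ
      rw [div_le_iff₀ hp0]
      refine le_trans ?_ hkδ
      gcongr
      norm_num
    have a2 : δ ≤ ε * c / (12 * (8 * Real.exp 5 ^ 2)) := min_le_left _ _
    have he : 0 < Real.exp 5 := Real.exp_pos 5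
    calc R ≤ _ := hR
      _ = 8 * Real.exp 5 ^ 2 * k * ((k:ℝ) * Real.log p ^ 2 / p) := by ring
      _ ≤ 8 * Real.exp 5 ^ 2 * k * (ε * c / (12 * (8 * Real.exp 5 ^ 2))) := by
        exact mul_le_mul_of_nonneg_left (a1.trans a2) (by positivity)
      _ = _ := by field_simp
  -- the factor
  have hinv : (p:ℝ)⁻¹ ≤ ε / 12 := by
    rw [inv_le_comm₀ hp0 (by positivity), inv_div]; exact hp12
  have hinv4 : (p:ℝ)⁻¹ ≤ 1 / 4 := by
    rw [inv_le_comm₀ hp0 (by positivity)]; norm_num; exact_mod_cast hp4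
  have hinv0 : 0 < (p:ℝ)⁻¹ := by positivity
  set B := ((p : ℝ) - 1) ^ 2 / ((p : ℝ) ^ 2 + 1) with hB
  have hB1 : B ≤ 1 := by
    rw [hB, div_le_one (by positivity)]; nlinarith
  have hB2 : 1 - 2 * (p:ℝ)⁻¹ ≤ B := by
    rw [hB, le_div_iff₀ (by positivity)]
    have : (p:ℝ)⁻¹ * p = 1 := inv_mul_cancel₀ hp0.ne'
    have e : (1 - 2 * (p:ℝ)⁻¹) * ((p:ℝ) ^ 2 + 1) = (p:ℝ) ^ 2 + 1 - 2 * p - 2 * (p:ℝ)⁻¹ := by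
      linear_combination (-2 * (p:ℝ)) * this
    rw [e]; nlinarith
  have hB3 : 1 / 2 ≤ B := by linarith
  set x := (p:ℝ)⁻¹ with hx
  have hD : |c / 2 * (1 + ((k:ℝ) - 1) * (1 - x)) - c / 2 * B * k| ≤ ε * c / 12 * k := by
    have e : c / 2 * (1 + ((k:ℝ) - 1) * (1 - x)) - c / 2 * B * k = c / 2 * (k - (k - 1) * x - B * k) := by ring
    have d : |(k:ℝ) - (k - 1) * x - B * k| ≤ 2 * x * k := by
      have u1 : 0 ≤ (k:ℝ) * (1 - B) := mul_nonneg (by linarith) (by linarith)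
      have u2 : (k:ℝ) * (1 - B) ≤ k * (2 * x) := mul_le_mul_of_nonneg_left (by linarith) (by linarith)
      have u3 : 0 ≤ ((k:ℝ) - 1) * x := mul_nonneg (by linarith) hinv0.le
      have u4 : 0 ≤ (k:ℝ) * x := by positivity
      rw [abs_le]; constructor <;> linarith
    rw [e, abs_mul, abs_of_pos (by positivity)]
    calc _ ≤ c / 2 * (2 * x * k) := by gcongr
      _ = c * k * x := by ring
      _ ≤ c * k * (ε / 12) := by gcongr
      _ = _ := by ring
  have hM : ε * c / 4 * k ≤ ε * (c / 2 * B * k) := by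
    calc ε * c / 4 * k = ε * (c / 2 * (1 / 2) * k) := by ring
      _ ≤ _ := by gcongr
  refine le_trans ?_ hM
  rw [abs_le] at hF hD ⊢
  constructor <;> linarith [hF.1, hF.2, hD.1, hD.2]
end

section
/- Let q be a positive integer. For any positive integer l and any real X > 1, Σ_{m,n ≥ 1, gcd(mn,q)=1, m ≡ n (mod l) or m ≡ −n (mod l)} μ(m)μ(n)/(mn) · e^{−mn/X} = (ζ(2)/ζ(4)) · ∏_{p | q} (1 + p^{−2})^{−1} + O(X^{−1/2}) + O((log X)^2 / l), with absolute implied constants. -/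
open Complex ArithmeticFunction

theorem gen {α β : Type*} (s : Set α) (φ : α → β) (hφ : Set.InjOn φ s) (f : α → ℝ) (g : β → ℝ) (c : ℝ)
    (hf : ∀ a, 0 ≤ f a) (hs : ∀ a, a ∉ s → f a = 0) (hg : ∀ b, 0 ≤ g b) (hc : 0 ≤ c) (hgs : Summable g)
    (h : ∀ a ∈ s, f a ≤ c * g (φ a)) : Summable f ∧ ∑' a, f a ≤ c * ∑' b, g b := by
  classical
  have key : ∀ u : Finset α, ∑ a ∈ u, f a ≤ c * ∑' b, g b := by
    intro u
    calc ∑ a ∈ u, f a = ∑ a ∈ u with a ∈ s, f a := by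
          rw [Finset.sum_filter]
          refine Finset.sum_congr rfl fun a _ => ?_
          split_ifs with h1
          · rfl
          · exact hs a h1
      _ ≤ ∑ a ∈ u with a ∈ s, c * g (φ a) :=
          Finset.sum_le_sum fun a ha => h a (Finset.mem_filter.1 ha).2
      _ = c * ∑ b ∈ (u.filter (· ∈ s)).image φ, g b := by
          rw [← Finset.mul_sum, Finset.sum_image]
          intro a ha b hb hab
          exact hφ (Finset.mem_filter.1 ha).2 (Finset.mem_filter.1 hb).2 hab
      _ ≤ c * ∑' b, g b :=
          mul_le_mul_of_nonneg_left (hgs.sum_le_tsum _ fun b _ => hg b) hc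
  exact ⟨summable_of_sum_le hf key, Real.tsum_le_of_sum_le hf key⟩

theorem tele (x s : ℝ) (hx : 1 < x) (hs : 0 < s) (hs1 : s ≤ 1) :
    s * (1 / x ^ (1 + s)) ≤ 1 / (x - 1) ^ s - 1 / x ^ s := by
  have hx0 : 0 < x := by linarith
  have hx1 : 0 < x - 1 := by linarith
  have hB : (1 + (-1 / x)) ^ s ≤ 1 + s * (-1 / x) :=
    rpow_one_add_le_one_add_mul_self (by rw [le_div_iff₀ hx0]; linarith) hs.le hs1
  have e1 : (1 + (-1 / x)) = (x - 1) / x := by field_simp; ring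
  rw [e1, Real.div_rpow hx1.le hx0.le] at hB
  have e2 : x ^ (1 + s) = x * x ^ s := by rw [Real.rpow_add hx0, Real.rpow_one]
  rw [e2]
  set A := x ^ s with hA
  set B := (x - 1) ^ s with hB'
  have hA0 : 0 < A := Real.rpow_pos_of_pos hx0 _
  have hB0 : 0 < B := Real.rpow_pos_of_pos hx1 _
  have h2 : B ≤ A * (1 - s / x) := by
    rw [div_le_iff₀ hA0] at hB
    calc B ≤ _ := hB
      _ = _ := by ring
  have hsx : 0 < s / x := by positivity
  have h3 : B * (1 + s / x) ≤ A := by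
    calc B * (1 + s / x) ≤ A * (1 - s / x) * (1 + s / x) := by gcongr
      _ = A - A * (s / x) ^ 2 := by ring
      _ ≤ A := by nlinarith [mul_nonneg hA0.le (sq_nonneg (s / x))]
  have h4 : (1 + s / x) / A ≤ 1 / B := by
    rw [div_le_div_iff₀ hA0 hB0]; linarith
  have h5 : s * (1 / (x * A)) = (1 + s / x) / A - 1 / A := by field_simp; ring
  linarith

theorem zbound (s : ℝ) (hs : 0 < s) (hs1 : s ≤ 1) :
    ∑' n : ℕ, 1 / (n : ℝ) ^ (1 + s) ≤ 1 + 1 / s := by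
  have key : ∀ n : ℕ, ∑ i ∈ Finset.range (n + 2), 1 / (i : ℝ) ^ (1 + s)
      ≤ 1 + (1 - 1 / ((n : ℝ) + 1) ^ s) / s := by
    intro n
    induction n with
    | zero =>
      have : (0 : ℝ) ^ (1 + s) = 0 := Real.zero_rpow (by linarith)
      simp [Finset.sum_range_succ, this]
    | succ n ih =>
      rw [Finset.sum_range_succ]
      have := tele ((n : ℝ) + 2) s (by have := Nat.cast_nonneg (α := ℝ) n; linarith) hs hs1
      push_cast
      have e : (n : ℝ) + 2 - 1 = n + 1 := by ring
      have e' : (n : ℝ) + 1 + 1 = n + 2 := by ring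
      rw [e] at this
      rw [e']
      have h6 : 1 / ((n : ℝ) + 2) ^ (1 + s) ≤ (1 / ((n : ℝ) + 1) ^ s - 1 / ((n : ℝ) + 2) ^ s) / s := by
        rw [le_div_iff₀ hs]; linarith
      calc _ ≤ 1 + (1 - 1 / ((n : ℝ) + 1) ^ s) / s + (1 / ((n : ℝ) + 1) ^ s - 1 / ((n : ℝ) + 2) ^ s) / s := by
            gcongr
        _ = _ := by ring
  refine Real.tsum_le_of_sum_range_le (fun n => by positivity) fun n => ?_
  calc _ ≤ ∑ i ∈ Finset.range (n + 2), 1 / (i : ℝ) ^ (1 + s) :=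
        Finset.sum_le_sum_of_subset_of_nonneg (by intro i; simp; omega) fun i _ _ => by positivity
    _ ≤ _ := key n
    _ ≤ _ := by
      gcongr
      have : 0 ≤ 1 / ((n : ℝ) + 1) ^ s := by positivity
      linarith

theorem exp_le (t s : ℝ) (ht : 0 < t) (hs : 0 < s) (hs1 : s ≤ 1) : Real.exp (-t) ≤ 1 / t ^ s := by
  rw [Real.exp_neg, ← one_div]
  have : 0 < t ^ s := Real.rpow_pos_of_pos ht _
  refine one_div_le_one_div_of_le this ?_
  rcases le_total t 1 with h | h
  · calc t ^ s ≤ 1 := Real.rpow_le_one ht.le h hs.le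
      _ ≤ _ := Real.one_le_exp ht.le
  · calc t ^ s ≤ t ^ (1 : ℝ) := Real.rpow_le_rpow_of_exponent_le h hs1
      _ = t := Real.rpow_one t
      _ ≤ _ := by linarith [Real.add_one_le_exp t]

/-- pointwise bound -/
theorem ptbound (X s : ℝ) (hX : 1 < X) (hs : 0 < s) (hs1 : s ≤ 1) (m n k l : ℝ)
    (hn : 1 ≤ n) (hk : 1 ≤ k) (hl : 1 ≤ l) (h : k * l ≤ 2 * m) :
    1 / (m * n) * Real.exp (-(m * n) / X) ≤ (2 * (2 * X) ^ s / l) * (1 / k ^ (1 + s) * (1 / n ^ (1 + s))) := by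
  have hkl : 1 ≤ k * l := one_le_mul_of_one_le_of_one_le hk hl
  have hk0 : 0 < k := by linarith
  have hn0 : 0 < n := by linarith
  have hl0 : 0 < l := by linarith
  have hm0 : 0 < m := by linarith
  have hX0 : 0 < X := by linarith
  have h1 : 1 / (m * n) ≤ 2 / (l * (k * n)) := by
    rw [div_le_div_iff₀ (by positivity) (by positivity)]
    nlinarith
  have h2 : Real.exp (-(m * n) / X) ≤ (2 * X) ^ s / (k * n) ^ s := by
    have h3 : k ≤ 2 * m := by nlinarith
    calc Real.exp (-(m * n) / X) ≤ Real.exp (-(k * n / (2 * X))) := by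
          apply Real.exp_le_exp.2
          rw [neg_div, neg_le_neg_iff, div_le_div_iff₀ (by positivity) hX0]
          have : k * n ≤ 2 * m * n := by gcongr
          nlinarith
      _ ≤ 1 / (k * n / (2 * X)) ^ s := exp_le _ _ (by positivity) hs hs1
      _ = _ := by
          rw [Real.div_rpow (by positivity) (by positivity), one_div_div]
  calc _ ≤ 2 / (l * (k * n)) * ((2 * X) ^ s / (k * n) ^ s) := by gcongr
    _ = _ := by
      rw [Real.rpow_add hk0, Real.rpow_add hn0, Real.mul_rpow hk0.le hn0.le, Real.rpow_one, Real.rpow_one]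
      field_simp

theorem diagb (c : ℝ) (hc : 1 ≤ c) (a : ℕ → ℝ) (ha : ∀ n, |a n| ≤ 1 / (n : ℝ) ^ 2) :
    |∑' n, a n * Real.exp (-((n : ℝ) * n) / c ^ 2) - ∑' n, a n| ≤ 4 / c := by
  have hc0 : 0 < c := by linarith
  have hs2 : Summable (fun n : ℕ => 1 / (n : ℝ) ^ 2) := Real.summable_one_div_nat_pow.2 (by norm_num)
  have hsa : Summable a := Summable.of_norm_bounded hs2 ha
  have hexp1 : ∀ n : ℕ, Real.exp (-((n : ℝ) * n) / c ^ 2) ≤ 1 := fun n =>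
    Real.exp_le_one_iff.2 (by rw [neg_div]; have : 0 ≤ ((n : ℝ) * n) / c ^ 2 := by positivity
                              linarith)
  have hse : Summable (fun n : ℕ => a n * Real.exp (-((n : ℝ) * n) / c ^ 2)) := by
    refine Summable.of_norm_bounded hs2 fun n => ?_
    rw [norm_mul, Real.norm_eq_abs, Real.norm_eq_abs, Real.abs_exp]
    calc _ ≤ |a n| * 1 := by gcongr; exact hexp1 n
      _ ≤ _ := by rw [mul_one]; exact ha n
  rw [← hse.tsum_sub hsa]
  have hd := hse.sub hsa
  have hb : ∀ n : ℕ, |a n * Real.exp (-((n : ℝ) * n) / c ^ 2) - a n| ≤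
      if n = 0 then 0 else 4 / (c + n) ^ 2 := by
    intro n
    have e : a n * Real.exp (-((n : ℝ) * n) / c ^ 2) - a n = -(a n * (1 - Real.exp (-((n : ℝ) * n) / c ^ 2))) := by ring
    rw [e, abs_neg, abs_mul, abs_of_nonneg (by linarith [hexp1 n] : 0 ≤ 1 - Real.exp (-((n : ℝ) * n) / c ^ 2))]
    split_ifs with h0
    · subst h0; simp
    have hn : (0 : ℝ) < n := by positivity
    rcases le_total (n : ℝ) c with h | h
    · have h1 : 1 - Real.exp (-((n : ℝ) * n) / c ^ 2) ≤ (n : ℝ) ^ 2 / c ^ 2 := by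
        have := Real.add_one_le_exp (-((n : ℝ) * n) / c ^ 2)
        have e2 : -((n : ℝ) * n) / c ^ 2 = - ((n : ℝ) ^ 2 / c ^ 2) := by ring
        rw [e2] at this ⊢
        linarith
      calc _ ≤ 1 / (n : ℝ) ^ 2 * ((n : ℝ) ^ 2 / c ^ 2) := by
            gcongr
            · linarith [hexp1 n]
            · exact ha n
        _ = 1 / c ^ 2 := by field_simp
        _ ≤ 4 / (c + n) ^ 2 := by
            rw [div_le_div_iff₀ (by positivity) (by positivity)]
            nlinarith
    · calc _ ≤ 1 / (n : ℝ) ^ 2 * 1 := by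
            gcongr
            · linarith [hexp1 n]
            · exact ha n
            · linarith [Real.exp_pos (-((n : ℝ) * n) / c ^ 2)]
        _ ≤ 4 / (c + n) ^ 2 := by
            rw [mul_one, div_le_div_iff₀ (by positivity) (by positivity)]
            nlinarith
  have hnorm := norm_tsum_le_tsum_norm hd.norm
  rw [Real.norm_eq_abs] at hnorm
  refine hnorm.trans ?_
  have key : ∀ n : ℕ, ∑ i ∈ Finset.range (n + 1), (if i = 0 then 0 else 4 / (c + i) ^ 2) ≤ 4 / c - 4 / (c + n) := by
    intro n
    induction n with
    | zero => simp
    | succ n ih =>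
      rw [Finset.sum_range_succ]
      simp only [Nat.add_eq_zero_iff, one_ne_zero, and_false, if_false]
      push_cast
      have : 4 / (c + ((n : ℝ) + 1)) ^ 2 ≤ 4 / (c + n) - 4 / (c + (n + 1)) := by
        have e : 4 / (c + n) - 4 / (c + (n + 1)) = 4 / ((c + n) * (c + (n + 1))) := by field_simp; ring
        rw [e]
        gcongr
        rw [pow_two]
        gcongr
        linarith
      linarith
  refine Real.tsum_le_of_sum_range_le (fun n => norm_nonneg _) fun n => ?_
  calc _ ≤ ∑ i ∈ Finset.range n, (if i = 0 then 0 else 4 / (c + i) ^ 2) := Finset.sum_le_sum fun i _ => hb i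
    _ ≤ ∑ i ∈ Finset.range (n + 1), (if i = 0 then 0 else 4 / (c + i) ^ 2) :=
        Finset.sum_le_sum_of_subset_of_nonneg (by intro i; simp; omega) fun i _ _ => by split_ifs <;> positivity
    _ ≤ _ := key n
    _ ≤ _ := by
      have : 0 ≤ 4 / (c + n) := by positivity
      linarith

theorem eulerpart (q : ℕ) (hq : 1 ≤ q) :
    ∑' n : ℕ, (if Nat.gcd n q = 1 then (moebius n : ℝ) ^ 2 / (n : ℝ) ^ 2 else 0) =
      (riemannZeta 2 / riemannZeta 4).re * ∏ p ∈ q.primeFactors, (1 + ((p : ℝ) ^ 2)⁻¹)⁻¹ := by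
  set f : ℕ → ℝ := fun n => if Nat.gcd n q = 1 then (moebius n : ℝ) ^ 2 / (n : ℝ) ^ 2 else 0 with hf
  have hs2 : Summable (fun n : ℕ => 1 / (n : ℝ) ^ 2) := Real.summable_one_div_nat_pow.2 (by norm_num)
  have habs : ∀ n, ‖f n‖ ≤ 1 / (n : ℝ) ^ 2 := by
    intro n
    simp only [hf]
    split_ifs with h
    · rw [Real.norm_eq_abs, abs_of_nonneg (by positivity)]
      gcongr
      rw [← sq_abs]
      have : |(moebius n : ℝ)| ≤ 1 := by exact_mod_cast abs_moebius_le_one (n := n)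
      exact pow_le_one₀ (abs_nonneg _) this
    · simp
  let F : ℕ → ℂ := fun n => (f n : ℂ)
  have hF := EulerProduct.eulerProduct_hasProd (f := F) (by simp [F, hf])
    (by
      intro m n hmn
      simp only [F, hf]
      rw [← Complex.ofReal_mul]
      congr 1
      have h1 : Nat.gcd (m * n) q = 1 ↔ Nat.gcd m q = 1 ∧ Nat.gcd n q = 1 := Nat.coprime_mul_iff_left
      rw [isMultiplicative_moebius.map_mul_of_coprime hmn]
      by_cases ha : Nat.gcd m q = 1 <;> by_cases hb : Nat.gcd n q = 1 <;> simp [h1, ha, hb]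
      ring)
    (by
      refine Summable.of_norm_bounded hs2 fun n => ?_
      simpa [F] using habs n)
    (by simp [F, hf])
  have hloc : ∀ p : Nat.Primes, ∑' e : ℕ, F ((p : ℕ) ^ e) = if (p : ℕ) ∣ q then 1 else 1 + ((p : ℂ) ^ 2)⁻¹ := by
    intro p
    rw [tsum_eq_sum (s := Finset.range 2)]
    · simp only [Finset.sum_range_succ, Finset.sum_range_zero, pow_zero, pow_one, F, hf]
      have hc : Nat.gcd p q = 1 ↔ ¬ (p : ℕ) ∣ q := (Nat.Prime.coprime_iff_not_dvd p.2)
      by_cases h : (p : ℕ) ∣ q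
      · simp [hc, h]
      · simp [hc, h, moebius_apply_prime p.2]
    · intro e he
      have he2 : 2 ≤ e := by
        have : 1 < e := by simpa using he
        omega
      have : moebius ((p : ℕ) ^ e) = 0 := by
        rw [moebius_apply_prime_pow p.2 (by omega), if_neg (by omega)]
      simp [F, hf, this]
  simp only [hloc] at hF
  have h2 := riemannZeta_eulerProduct_hasProd (s := 2) (by norm_num)
  have h4 := riemannZeta_eulerProduct_hasProd (s := 4) (by norm_num)
  have hfin : HasProd (fun p : Nat.Primes => if (p : ℕ) ∣ q then 1 + ((p : ℂ) ^ 2)⁻¹ else 1)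
      (∏ p ∈ q.primeFactors, (1 + ((p : ℂ) ^ 2)⁻¹)) := by
    have := hasProd_prod_of_ne_finset_one (f := fun p : {p : ℕ // Nat.Prime p} => if (p : ℕ) ∣ q then 1 + ((p : ℂ) ^ 2)⁻¹ else 1)
      (s := q.primeFactors.subtype Nat.Prime) (L := SummationFilter.unconditional _) (by
        intro b hb
        rw [Finset.mem_subtype, Nat.mem_primeFactors] at hb
        rw [if_neg]
        intro h
        exact hb ⟨b.2, h, by omega⟩)
    rw [Finset.prod_subtype_of_mem (f := fun p : ℕ => if (p : ℕ) ∣ q then 1 + ((p : ℂ) ^ 2)⁻¹ else 1)] at this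
    · suffices e : ∏ p ∈ q.primeFactors, (1 + ((p : ℂ) ^ 2)⁻¹) =
          ∏ p ∈ q.primeFactors, (if (p : ℕ) ∣ q then 1 + ((p : ℂ) ^ 2)⁻¹ else 1) by
        rw [e]; exact this
      refine Finset.prod_congr rfl fun p hp => ?_
      rw [if_pos (Nat.dvd_of_mem_primeFactors hp)]
    · exact fun p hp => Nat.prime_of_mem_primeFactors hp
  have hprod := (hF.mul hfin).mul h4
  have heq : riemannZeta 2 = (∑' n, F n) * (∏ p ∈ q.primeFactors, (1 + ((p : ℂ) ^ 2)⁻¹)) * riemannZeta 4 := by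
    refine HasProd.unique h2 ?_
    convert hprod using 1
    funext p
    have e2 : (p : ℂ) ^ (-(2 : ℂ)) = ((p : ℂ) ^ 2)⁻¹ := by
      rw [Complex.cpow_neg]; norm_cast
    have e4 : (p : ℂ) ^ (-(4 : ℂ)) = (((p : ℂ) ^ 2)⁻¹) ^ 2 := by
      rw [Complex.cpow_neg, inv_pow, ← pow_mul]; norm_cast
    rw [e2, e4]
    have hp2 : (2 : ℝ) ≤ p := by exact_mod_cast p.2.two_le
    have hy : (((p : ℝ) ^ 2)⁻¹) < 1 := inv_lt_one_of_one_lt₀ (by nlinarith)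
    have hy0 : 0 < (((p : ℝ) ^ 2)⁻¹) := by positivity
    have ec : ((p : ℂ) ^ 2)⁻¹ = ((((p : ℝ) ^ 2)⁻¹ : ℝ) : ℂ) := by push_cast; rfl
    rw [ec]
    set y := ((p : ℝ) ^ 2)⁻¹
    have hn1 : (1 : ℂ) - y ≠ 0 := by
      have : (1 - y : ℝ) ≠ 0 := by linarith
      exact_mod_cast this
    have hn2 : (1 : ℂ) + y ≠ 0 := by
      have : (1 + y : ℝ) ≠ 0 := by linarith
      exact_mod_cast this
    have e5 : (1 : ℂ) - (y : ℂ) ^ 2 = (1 - y) * (1 + y) := by ring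
    rw [e5]
    split_ifs <;> field_simp
  have hz4 : riemannZeta 4 ≠ 0 := riemannZeta_ne_zero_of_one_le_re (by norm_num)
  have hP : (∏ p ∈ q.primeFactors, (1 + ((p : ℝ) ^ 2)⁻¹)) ≠ 0 :=
    Finset.prod_ne_zero_iff.2 fun p _ => by positivity
  have hre : riemannZeta 2 / riemannZeta 4 =
      (((∑' n, f n) * ∏ p ∈ q.primeFactors, (1 + ((p : ℝ) ^ 2)⁻¹) : ℝ) : ℂ) := by
    rw [heq, mul_div_assoc, div_self hz4, mul_one]
    push_cast
    rfl
  rw [hre, Complex.ofReal_re, Finset.prod_inv_distrib, mul_assoc, mul_inv_cancel₀ hP, mul_one]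

/-- one class of off-diagonal pairs -/
theorem classb (X s : ℝ) (hX : 1 < X) (hs : 0 < s) (hs1 : s ≤ 1) (l : ℕ) (hl : 1 ≤ l)
    (S : Set (ℕ × ℕ)) (φ : ℕ × ℕ → ℕ × ℕ) (hφ : Set.InjOn φ S) (f : ℕ × ℕ → ℝ) (hf : ∀ a, 0 ≤ f a)
    (hS : ∀ a, a ∉ S → f a = 0)
    (h : ∀ a ∈ S, ∃ m : ℕ, 1 ≤ (φ a).1 ∧ 1 ≤ (φ a).2 ∧ (φ a).1 * l ≤ 2 * m ∧
      f a ≤ 1 / ((m : ℝ) * (φ a).2) * Real.exp (-((m : ℝ) * (φ a).2) / X)) :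
    Summable f ∧ ∑' a, f a ≤ (2 * (2 * X) ^ s / l) * (1 + 1 / s) ^ 2 := by
  have hz : Summable (fun n : ℕ => 1 / (n : ℝ) ^ (1 + s)) :=
    Real.summable_one_div_nat_rpow.2 (by linarith)
  have hg := hz.mul_of_nonneg hz (fun n => by positivity) (fun n => by positivity)
  have hc : 0 ≤ 2 * (2 * X) ^ s / (l : ℝ) := by positivity
  obtain ⟨h1, h2⟩ := gen S φ hφ f (fun x : ℕ × ℕ => 1 / (x.1 : ℝ) ^ (1 + s) * (1 / (x.2 : ℝ) ^ (1 + s)))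
    (2 * (2 * X) ^ s / l) hf hS (fun b => by positivity) hc hg (by
      intro a ha
      obtain ⟨m, hk, hn, hm, hfa⟩ := h a ha
      refine hfa.trans (ptbound X s hX hs hs1 m _ _ l ?_ ?_ ?_ ?_) <;> exact_mod_cast (by assumption))
  refine ⟨h1, h2.trans ?_⟩
  rw [← hz.tsum_mul_tsum hz hg, ← pow_two]
  have h0 : 0 ≤ ∑' n : ℕ, 1 / (n : ℝ) ^ (1 + s) := tsum_nonneg fun n => by positivity
  have := zbound s hs hs1
  gcongr
  
theorem classes (X s : ℝ) (hX : 1 < X) (hs : 0 < s) (hs1 : s ≤ 1) (l : ℕ) (hl : 1 ≤ l)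
    (f : ℕ × ℕ → ℝ)
    (hf : ∀ a, f a ≠ 0 → 1 ≤ a.1 ∧ 1 ≤ a.2 ∧ a.1 ≠ a.2 ∧ ((l : ℤ) ∣ a.1 - a.2 ∨ (l : ℤ) ∣ a.1 + a.2))
    (hb : ∀ a, |f a| ≤ 1 / ((a.1 : ℝ) * a.2) * Real.exp (-((a.1 : ℝ) * a.2) / X)) :
    Summable f ∧ |∑' a, f a| ≤ 4 * ((2 * (2 * X) ^ s / l) * (1 + 1 / s) ^ 2) := by
  classical
  let A1 : Set (ℕ × ℕ) := {a | 1 ≤ a.2 ∧ a.2 < a.1 ∧ ∃ k : ℕ, a.1 = a.2 + k * l}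
  let A2 : Set (ℕ × ℕ) := {a | 1 ≤ a.2 ∧ a.2 < a.1 ∧ ∃ k : ℕ, a.1 + a.2 = k * l}
  let B1 : Set (ℕ × ℕ) := {a | 1 ≤ a.1 ∧ a.1 < a.2 ∧ ∃ k : ℕ, a.2 = a.1 + k * l}
  let B2 : Set (ℕ × ℕ) := {a | 1 ≤ a.1 ∧ a.1 < a.2 ∧ ∃ k : ℕ, a.2 + a.1 = k * l}
  have hl0 : 0 < l := hl
  have d1 : ∀ a k : ℕ, (a + k * l - a) / l = k := fun a k => by
    rw [Nat.add_sub_cancel_left, Nat.mul_div_cancel _ hl0]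
  have d2 : ∀ k : ℕ, k * l / l = k := fun k => Nat.mul_div_cancel _ hl0
  have kpos : ∀ k n : ℕ, 0 < n → n = k * l → 1 ≤ k := by
    rintro k n hn rfl
    exact Nat.pos_of_mul_pos_right hn
  have c1 := classb X s hX hs hs1 l hl A1 (fun a => ((a.1 - a.2) / l, a.2)) (by
      rintro ⟨m, n⟩ ⟨h1, h2, k, hk⟩ ⟨m', n'⟩ ⟨h1', h2', k', hk'⟩ h
      dsimp only at *
      subst hk hk'
      simp only [d1, Prod.mk.injEq] at h ⊢
      obtain ⟨rfl, rfl⟩ := h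
      simp)
    (A1.indicator fun a => |f a|) (fun a => Set.indicator_nonneg (fun _ _ => abs_nonneg _) a)
    (fun a ha => Set.indicator_of_notMem ha _) (by
      rintro ⟨m, n⟩ ha
      rw [Set.indicator_of_mem ha]
      refine ⟨m, ?_⟩
      have hb' := hb (m, n)
      obtain ⟨h1, h2, k, hk⟩ := ha
      dsimp only at *
      have := kpos k (m - n) (by omega) (by omega)
      refine ⟨?_, h1, ?_, hb'⟩
      · rw [hk, d1]; exact this
      · rw [hk, d1]; omega)
  have c2 := classb X s hX hs hs1 l hl A2 (fun a => ((a.1 + a.2) / l, a.2)) (by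
      rintro ⟨m, n⟩ ⟨h1, h2, k, hk⟩ ⟨m', n'⟩ ⟨h1', h2', k', hk'⟩ h
      dsimp only at *
      rw [hk, hk'] at h
      simp only [d2, Prod.mk.injEq] at h ⊢
      obtain ⟨rfl, rfl⟩ := h
      simp; omega)
    (A2.indicator fun a => |f a|) (fun a => Set.indicator_nonneg (fun _ _ => abs_nonneg _) a)
    (fun a ha => Set.indicator_of_notMem ha _) (by
      rintro ⟨m, n⟩ ha
      rw [Set.indicator_of_mem ha]
      refine ⟨m, ?_⟩
      have hb' := hb (m, n)
      obtain ⟨h1, h2, k, hk⟩ := ha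
      dsimp only at *
      have := kpos k (m + n) (by omega) (by omega)
      refine ⟨?_, h1, ?_, hb'⟩
      · rw [hk, d2]; exact this
      · rw [hk, d2]; omega)
  have c3 := classb X s hX hs hs1 l hl B1 (fun a => ((a.2 - a.1) / l, a.1)) (by
      rintro ⟨m, n⟩ ⟨h1, h2, k, hk⟩ ⟨m', n'⟩ ⟨h1', h2', k', hk'⟩ h
      dsimp only at *
      subst hk hk'
      simp only [d1, Prod.mk.injEq] at h ⊢
      obtain ⟨rfl, rfl⟩ := h
      simp)
    (B1.indicator fun a => |f a|) (fun a => Set.indicator_nonneg (fun _ _ => abs_nonneg _) a)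
    (fun a ha => Set.indicator_of_notMem ha _) (by
      rintro ⟨m, n⟩ ha
      rw [Set.indicator_of_mem ha]
      refine ⟨n, ?_⟩
      have hb' := hb (m, n)
      obtain ⟨h1, h2, k, hk⟩ := ha
      dsimp only at *
      rw [mul_comm (m : ℝ)] at hb'
      have := kpos k (n - m) (by omega) (by omega)
      refine ⟨?_, h1, ?_, hb'⟩
      · rw [hk, d1]; exact this
      · rw [hk, d1]; omega)
  have c4 := classb X s hX hs hs1 l hl B2 (fun a => ((a.2 + a.1) / l, a.1)) (by
      rintro ⟨m, n⟩ ⟨h1, h2, k, hk⟩ ⟨m', n'⟩ ⟨h1', h2', k', hk'⟩ h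
      dsimp only at *
      rw [hk, hk'] at h
      simp only [d2, Prod.mk.injEq] at h ⊢
      obtain ⟨rfl, rfl⟩ := h
      simp; omega)
    (B2.indicator fun a => |f a|) (fun a => Set.indicator_nonneg (fun _ _ => abs_nonneg _) a)
    (fun a ha => Set.indicator_of_notMem ha _) (by
      rintro ⟨m, n⟩ ha
      rw [Set.indicator_of_mem ha]
      refine ⟨n, ?_⟩
      have hb' := hb (m, n)
      obtain ⟨h1, h2, k, hk⟩ := ha
      dsimp only at *
      rw [mul_comm (m : ℝ)] at hb'
      have := kpos k (n + m) (by omega) (by omega)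
      refine ⟨?_, h1, ?_, hb'⟩
      · rw [hk, d2]; exact this
      · rw [hk, d2]; omega)
  obtain ⟨s1, t1⟩ := c1
  obtain ⟨s2, t2⟩ := c2
  obtain ⟨s3, t3⟩ := c3
  obtain ⟨s4, t4⟩ := c4
  have hle : ∀ a, ‖f a‖ ≤ A1.indicator (fun a => |f a|) a + A2.indicator (fun a => |f a|) a +
      B1.indicator (fun a => |f a|) a + B2.indicator (fun a => |f a|) a := by
    intro a
    have n1 : 0 ≤ A1.indicator (fun a => |f a|) a := Set.indicator_nonneg (fun _ _ => abs_nonneg _) a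
    have n2 : 0 ≤ A2.indicator (fun a => |f a|) a := Set.indicator_nonneg (fun _ _ => abs_nonneg _) a
    have n3 : 0 ≤ B1.indicator (fun a => |f a|) a := Set.indicator_nonneg (fun _ _ => abs_nonneg _) a
    have n4 : 0 ≤ B2.indicator (fun a => |f a|) a := Set.indicator_nonneg (fun _ _ => abs_nonneg _) a
    by_cases h0 : f a = 0
    · rw [h0, norm_zero]; linarith
    rw [Real.norm_eq_abs]
    obtain ⟨h1, h2, h3, h4⟩ := hf a h0
    have hmem : a ∈ A1 ∨ a ∈ A2 ∨ a ∈ B1 ∨ a ∈ B2 := by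
      obtain ⟨m, n⟩ := a
      dsimp only at *
      rcases lt_or_gt_of_ne h3 with hlt | hlt
      · right; right
        rcases h4 with h4 | h4
        · left
          refine ⟨h1, hlt, ?_⟩
          have h5 : (l : ℤ) ∣ ((n - m : ℕ) : ℤ) := by
            rw [Nat.cast_sub hlt.le, dvd_sub_comm]; exact h4
          obtain ⟨k, hk⟩ := Int.natCast_dvd_natCast.1 h5
          exact ⟨k, by dsimp only; rw [mul_comm k]; omega⟩
        · right
          refine ⟨h1, hlt, ?_⟩
          obtain ⟨k, hk⟩ := Int.natCast_dvd_natCast.1 (by exact_mod_cast h4 : (l : ℤ) ∣ ((m + n : ℕ) : ℤ))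
          exact ⟨k, by dsimp only; rw [mul_comm k]; omega⟩
      · rcases h4 with h4 | h4
        · left
          refine ⟨h2, hlt, ?_⟩
          have h5 : (l : ℤ) ∣ ((m - n : ℕ) : ℤ) := by
            rw [Nat.cast_sub (le_of_lt hlt)]; exact h4
          obtain ⟨k, hk⟩ := Int.natCast_dvd_natCast.1 h5
          exact ⟨k, by dsimp only; rw [mul_comm k]; omega⟩
        · right; left
          refine ⟨h2, hlt, ?_⟩
          obtain ⟨k, hk⟩ := Int.natCast_dvd_natCast.1 (by exact_mod_cast h4 : (l : ℤ) ∣ ((m + n : ℕ) : ℤ))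
          exact ⟨k, by dsimp only; rw [mul_comm k]; omega⟩
    rcases hmem with h | h | h | h
    · have e := Set.indicator_of_mem h (fun a => |f a|); linarith
    · have e := Set.indicator_of_mem h (fun a => |f a|); linarith
    · have e := Set.indicator_of_mem h (fun a => |f a|); linarith
    · have e := Set.indicator_of_mem h (fun a => |f a|); linarith
  have hsum := ((s1.add s2).add s3).add s4
  refine ⟨Summable.of_norm_bounded hsum hle, ?_⟩
  have := tsum_of_norm_bounded hsum.hasSum hle
  rw [((s1.add s2).add s3).tsum_add s4, (s1.add s2).tsum_add s3, s1.tsum_add s2] at this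
  rw [Real.norm_eq_abs] at this
  linarith

theorem constb (X : ℝ) (hX : 1 < X) (l : ℕ) (hl : 1 ≤ l) :
    4 * ((2 * (2 * X) ^ (1 / (1 + Real.log X)) / l) * (1 + 1 / (1 / (1 + Real.log X))) ^ 2) ≤
      864 * (X ^ (-(1 : ℝ) / 2) + (Real.log X) ^ 2 / l) := by
  have hL : 0 < Real.log X := Real.log_pos hX
  have hX0 : 0 < X := by linarith
  have hl1 : (1 : ℝ) ≤ l := by exact_mod_cast hl
  set L := Real.log X with hLdef
  have h2 : (2 * X) ^ (1 / (1 + L)) ≤ 6 := by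
    rw [Real.mul_rpow (by norm_num) hX0.le]
    have a1 : (2 : ℝ) ^ (1 / (1 + L)) ≤ 2 := by
      calc (2 : ℝ) ^ (1 / (1 + L)) ≤ 2 ^ (1 : ℝ) := by
            apply Real.rpow_le_rpow_of_exponent_le (by norm_num)
            rw [div_le_one (by linarith)]; linarith
        _ = 2 := Real.rpow_one 2
    have a2 : X ^ (1 / (1 + L)) ≤ 3 := by
      rw [Real.rpow_def_of_pos hX0]
      calc Real.exp (Real.log X * (1 / (1 + L))) ≤ Real.exp 1 := by
            apply Real.exp_le_exp.2
            rw [mul_one_div, div_le_one (by linarith)]; linarith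
        _ ≤ 3 := by linarith [Real.exp_one_lt_d9]
    have : 0 < X ^ (1 / (1 + L)) := Real.rpow_pos_of_pos hX0 _
    nlinarith
  rw [one_div_one_div]
  have h3 : 4 * ((2 * (2 * X) ^ (1 / (1 + L)) / l) * (1 + (1 + L)) ^ 2) ≤ 48 * ((2 + L) ^ 2 / l) := by
    calc _ ≤ 4 * ((2 * 6 / (l : ℝ)) * (1 + (1 + L)) ^ 2) := by gcongr
      _ = _ := by ring
  refine h3.trans ?_
  have hp : 0 < X ^ (-(1 : ℝ) / 2) := Real.rpow_pos_of_pos hX0 _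
  rcases le_total 1 L with h | h
  · have : (2 + L) ^ 2 / l ≤ (9 * L ^ 2) / l := by gcongr; nlinarith
    have e : (9 * L ^ 2) / l = 9 * (L ^ 2 / l) := by ring
    have : 0 ≤ L ^ 2 / l := by positivity
    linarith
  · have h5 : (2 + L) ^ 2 / l ≤ 9 := by
      rw [div_le_iff₀ (by linarith)]; nlinarith
    have h6 : 1 / 2 ≤ X ^ (-(1 : ℝ) / 2) := by
      rw [Real.rpow_def_of_pos hX0, ← hLdef]
      have := Real.add_one_le_exp (L * (-1 / 2))
      linarith
    have : 0 ≤ L ^ 2 / l := by positivity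
    linarith


open scoped Classical in
/-- For a positive integer `q`, any positive integer `l` and any `X > 1`,
`Σ_{m,n ≥ 1, (mn,q)=1, m ≡ ±n [l]} μ(m)μ(n)/(mn) e^{−mn/X}
  = (ζ(2)/ζ(4)) ∏_{p ∣ q} (1+p⁻²)⁻¹ + O(X^{−1/2}) + O((log X)²/l)`
with absolute implied constants. -/
theorem weighted_moebius_sum :
    ∃ C > (0 : ℝ), ∀ (q l : ℕ), 1 ≤ q → 1 ≤ l → ∀ X : ℝ, 1 < X →
      |(∑' mn : ℕ × ℕ,
          if 1 ≤ mn.1 ∧ 1 ≤ mn.2 ∧ Nat.gcd (mn.1 * mn.2) q = 1 ∧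
              ((mn.1 : ZMod l) = (mn.2 : ZMod l) ∨ (mn.1 : ZMod l) = -(mn.2 : ZMod l)) then
            ((moebius mn.1 : ℝ) * (moebius mn.2 : ℝ)) / (mn.1 * mn.2) *
              Real.exp (-(mn.1 * mn.2 : ℝ) / X)
          else 0) -
        (riemannZeta 2 / riemannZeta 4).re *
          ∏ p ∈ q.primeFactors, (1 + ((p : ℝ) ^ 2)⁻¹)⁻¹| ≤
      C * (X ^ (-(1 : ℝ) / 2) + (Real.log X) ^ 2 / l) := by
  classical
  refine ⟨1000, by norm_num, ?_⟩
  intro q l hq hl X hX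
  have hX0 : 0 < X := by linarith
  have hL : 0 < Real.log X := Real.log_pos hX
  set F : ℕ × ℕ → ℝ := fun mn => if 1 ≤ mn.1 ∧ 1 ≤ mn.2 ∧ Nat.gcd (mn.1 * mn.2) q = 1 ∧
              ((mn.1 : ZMod l) = (mn.2 : ZMod l) ∨ (mn.1 : ZMod l) = -(mn.2 : ZMod l)) then
            ((moebius mn.1 : ℝ) * (moebius mn.2 : ℝ)) / (mn.1 * mn.2) *
              Real.exp (-(mn.1 * mn.2 : ℝ) / X)
          else 0 with hF
  have hmu : ∀ n : ℕ, |(moebius n : ℝ)| ≤ 1 := fun n => by exact_mod_cast abs_moebius_le_one (n := n)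
  have hFb : ∀ a, |F a| ≤ 1 / ((a.1 : ℝ) * a.2) * Real.exp (-((a.1 : ℝ) * a.2) / X) := by
    intro a
    simp only [hF]
    split_ifs with h
    · rw [abs_mul, Real.abs_exp, abs_div, abs_mul, abs_of_nonneg (by positivity : (0 : ℝ) ≤ (a.1 : ℝ) * a.2)]
      gcongr
      exact mul_le_one₀ (hmu _) (abs_nonneg _) (hmu _)
    · rw [abs_zero]; positivity
  let O : ℕ × ℕ → ℝ := fun a => if a.1 = a.2 then 0 else F a
  let D : ℕ × ℕ → ℝ := fun a => if a.1 = a.2 then F a else 0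
  have hFOD : F = fun a => D a + O a := by
    funext a
    simp only [O, D]
    split_ifs <;> simp
  obtain ⟨hOs, hOb⟩ := classes X (1 / (1 + Real.log X)) hX (by positivity)
    (by rw [div_le_one (by linarith)]; linarith) l hl O (by
      intro a ha
      simp only [O, hF] at ha
      by_cases h1 : a.1 = a.2
      · simp [h1] at ha
      rw [if_neg h1] at ha
      by_cases h2 : 1 ≤ a.1 ∧ 1 ≤ a.2 ∧ Nat.gcd (a.1 * a.2) q = 1 ∧
              ((a.1 : ZMod l) = (a.2 : ZMod l) ∨ (a.1 : ZMod l) = -(a.2 : ZMod l))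
      · obtain ⟨u, v, _, w⟩ := h2
        refine ⟨u, v, h1, ?_⟩
        rcases w with w | w
        · left
          rw [← ZMod.intCast_zmod_eq_zero_iff_dvd]
          push_cast
          rw [w, sub_self]
        · right
          rw [← ZMod.intCast_zmod_eq_zero_iff_dvd]
          push_cast
          rw [w, neg_add_cancel]
      · rw [if_neg h2] at ha; exact absurd rfl ha) (by
      intro a
      simp only [O]
      split_ifs
      · rw [abs_zero]; positivity
      · exact hFb a)
  set a : ℕ → ℝ := fun n => if Nat.gcd n q = 1 then (moebius n : ℝ) ^ 2 / (n : ℝ) ^ 2 else 0 with ha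
  have hab : ∀ n, |a n| ≤ 1 / (n : ℝ) ^ 2 := by
    intro n
    simp only [ha]
    split_ifs with h
    · rw [abs_of_nonneg (by positivity)]
      gcongr
      rw [← sq_abs]
      exact pow_le_one₀ (abs_nonneg _) (hmu n)
    · rw [abs_zero]; positivity
  have hc : 1 ≤ √X := Real.one_le_sqrt.2 hX.le
  have hdiag := diagb (√X) hc a hab
  rw [Real.sq_sqrt hX0.le] at hdiag
  have hinj : Function.Injective (fun n : ℕ => (n, n)) := fun x y h => (Prod.mk.inj h).1
  have hDa : D ∘ (fun n : ℕ => (n, n)) = fun n => a n * Real.exp (-((n : ℝ) * n) / X) := by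
    funext n
    simp only [D, Function.comp, hF, ha, if_true, true_or, and_true]
    rcases Nat.eq_zero_or_pos n with rfl | hn
    · simp
    have hn' : 1 ≤ n := hn
    have hg : Nat.gcd (n * n) q = 1 ↔ Nat.gcd n q = 1 := by
      have := Nat.coprime_mul_iff_left (m := n) (n := n) (k := q)
      rw [and_self] at this
      exact this
    simp only [hn', hg, true_and]
    split_ifs
    · ring
    · simp
  have hsa : Summable (fun n : ℕ => a n * Real.exp (-((n : ℝ) * n) / X)) := by
    refine Summable.of_norm_bounded (Real.summable_one_div_nat_pow.2 (by norm_num : 1 < 2)) fun n => ?_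
    rw [norm_mul, Real.norm_eq_abs, Real.norm_eq_abs, Real.abs_exp]
    have : Real.exp (-((n : ℝ) * n) / X) ≤ 1 := Real.exp_le_one_iff.2 (by
      rw [neg_div]
      have : 0 ≤ ((n : ℝ) * n) / X := by positivity
      linarith)
    calc _ ≤ |a n| * 1 := by gcongr
      _ ≤ _ := by rw [mul_one]; exact hab n
  have hD : HasSum D (∑' n, a n * Real.exp (-((n : ℝ) * n) / X)) := by
    rw [← hinj.hasSum_iff, hDa]
    · exact hsa.hasSum
    · intro x hx
      simp only [D]
      rw [if_neg]
      intro h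
      exact hx ⟨x.1, by ext <;> simp [h]⟩
  have hT : ∑' mn, F mn = ∑' n, a n * Real.exp (-((n : ℝ) * n) / X) + ∑' mn, O mn := by
    rw [hFOD, hD.summable.tsum_add hOs, hD.tsum_eq]
  rw [hT, ← eulerpart q hq]
  have hcb := constb X hX l hl
  have hsq : 4 / √X = 4 * X ^ (-(1 : ℝ) / 2) := by
    rw [neg_div, Real.rpow_neg hX0.le, ← Real.sqrt_eq_rpow]; rfl
  rw [hsq] at hdiag
  have hp : 0 < X ^ (-(1 : ℝ) / 2) := Real.rpow_pos_of_pos hX0 _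
  have hq' : 0 ≤ (Real.log X) ^ 2 / l := by positivity
  calc _ = |(∑' n, a n * Real.exp (-((n : ℝ) * n) / X) - ∑' n, a n) + ∑' mn, O mn| := by
        congr 1; ring
    _ ≤ _ := abs_add_le _ _
    _ ≤ 4 * X ^ (-(1 : ℝ) / 2) + 864 * (X ^ (-(1 : ℝ) / 2) + (Real.log X) ^ 2 / l) := add_le_add hdiag (hOb.trans hcb)
    _ ≤ _ := by linarith
end
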